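/- Let D be a bounded pseudoconvex domain in ℂ^n. Then D is an L²_h-domain of holomorphy if and only if for every boundary point w ∈ ∂D one has limsup_{D ∋ z → w} K_D(z) = ∞. -/

import Mathlib

open MeasureTheory Filter Topology Metric Set
open scoped ENNReal NNReal

/-- Truncated circle average of an `EReal`-valued function: the average over the circle of
center `c` and radius `R` of the function truncated below at `-n`. -/
noncomputable def circleAvgTrunc (u : ℂ → EReal) (c : ℂ) (R : ℝ) (n : ℕ) : ℝ :=
  (2 * Real.pi)⁻¹ * ∫ θ in (0:ℝ)..(2 * Real.pi),
    (max (u (c + R * Complex.exp (θ * Complex.I))) (-(n : ℝ) : EReal)).toReal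

/-- `u` is subharmonic on `Ω ⊆ ℂ`: values in `[-∞, ∞)`, upper semicontinuous on `Ω`, and for
every closed disc contained in `Ω` the value at the center is at most the mean over the
boundary circle (in the extended sense, via decreasing truncations). -/
def SubharmonicOn (u : ℂ → EReal) (Ω : Set ℂ) : Prop :=
  UpperSemicontinuousOn u Ω ∧ (∀ z ∈ Ω, u z < ⊤) ∧
    ∀ c ∈ Ω, ∀ R : ℝ, 0 < R → Metric.closedBall c R ⊆ Ω →
      u c ≤ ⨅ n : ℕ, (circleAvgTrunc u c R n : EReal)

/-- `u` is plurisubharmonic on `Ω`: values in `[-∞, ∞)`, upper semicontinuous on `Ω`, and its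
restriction to every complex line is subharmonic. -/
def PlurisubharmonicOn {E : Type*} [NormedAddCommGroup E] [NormedSpace ℂ E]
    (u : E → EReal) (Ω : Set E) : Prop :=
  UpperSemicontinuousOn u Ω ∧ (∀ z ∈ Ω, u z < ⊤) ∧
    ∀ a b : E, SubharmonicOn (fun lam : ℂ => u (a + lam • b)) {lam : ℂ | a + lam • b ∈ Ω}

/-- A set `P ⊆ ℂ` is polar. -/
def PolarSet (P : Set ℂ) : Prop :=
  ∀ z ∈ P, ∃ U : Set ℂ, IsOpen U ∧ IsConnected U ∧ z ∈ U ∧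
    ∃ u : ℂ → EReal, SubharmonicOn u U ∧ (∃ x ∈ U, u x ≠ ⊥) ∧ ∀ x ∈ P ∩ U, u x = ⊥

/-- A set `P ⊆ ℂⁿ` is pluripolar. -/
def PluripolarSet {E : Type*} [NormedAddCommGroup E] [NormedSpace ℂ E] (P : Set E) : Prop :=
  ∀ z ∈ P, ∃ U : Set E, IsOpen U ∧ IsConnected U ∧ z ∈ U ∧
    ∃ u : E → EReal, PlurisubharmonicOn u U ∧ (∃ x ∈ U, u x ≠ ⊥) ∧ ∀ x ∈ P ∩ U, u x = ⊥

/-- A domain `D` is pseudoconvex if `z ↦ -log dist(z, ∂D)` is plurisubharmonic on `D`. -/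
def IsPseudoconvex {E : Type*} [NormedAddCommGroup E] [NormedSpace ℂ E] (D : Set E) : Prop :=
  PlurisubharmonicOn (fun z => ((- Real.log (Metric.infDist z Dᶜ) : ℝ) : EReal)) D

/-- The square-integrable holomorphic functions on an open set `Ω`. -/
def L2h {E : Type*} [NormedAddCommGroup E] [NormedSpace ℂ E] [MeasureSpace E]
    (Ω : Set E) : Set (E → ℂ) :=
  {f | DifferentiableOn ℂ f Ω ∧ (∫⁻ z in Ω, (‖f z‖₊ : ℝ≥0∞) ^ 2) < ⊤}

/-- The Bergman kernel of `Ω` on the diagonal,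
`K_Ω(z) = sup { |f(z)|²/‖f‖²_{L²(Ω)} : f ∈ L²ₕ(Ω), f ≢ 0 }`. -/
noncomputable def bergmanKernel {E : Type*} [NormedAddCommGroup E] [NormedSpace ℂ E]
    [MeasureSpace E] (Ω : Set E) (z : E) : ℝ≥0∞ :=
  ⨆ (f : E → ℂ) (_ : f ∈ L2h Ω) (_ : ∃ w ∈ Ω, f w ≠ 0),
    (‖f z‖₊ : ℝ≥0∞) ^ 2 / ∫⁻ w in Ω, (‖f w‖₊ : ℝ≥0∞) ^ 2

/-- `D` is an `L²ₕ`-domain of holomorphy: there are no domains `D₀, D₁` with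
`∅ ≠ D₀ ⊆ D₁ ∩ D`, `D₁ ⊄ D`, such that every `f ∈ L²ₕ(D)` extends holomorphically to `D₁`
(agreeing with `f` on `D₀`). -/
def IsL2hDomainOfHolomorphy {E : Type*} [NormedAddCommGroup E] [NormedSpace ℂ E]
    [MeasureSpace E] (D : Set E) : Prop :=
  ¬ ∃ D0 D1 : Set E, IsOpen D0 ∧ IsConnected D0 ∧ IsOpen D1 ∧ IsConnected D1 ∧
      D0 ⊆ D1 ∩ D ∧ ¬ (D1 ⊆ D) ∧
      ∀ f ∈ L2h D, ∃ F : E → ℂ, DifferentiableOn ℂ F D1 ∧ Set.EqOn F f D0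

/-- `w` is a regular boundary point of the domain `D ⊆ ℂ`. -/
def RegularBoundaryPt (D : Set ℂ) (w : ℂ) : Prop :=
  ∃ U : Set ℂ, IsOpen U ∧ w ∈ U ∧ ∃ u : ℂ → EReal, SubharmonicOn u (U ∩ D) ∧
    (∀ z ∈ U ∩ D, u z < 0) ∧ Tendsto u (𝓝[U ∩ D] w) (𝓝 (0 : EReal))

/-- The (pluricomplex) Green function of a domain `D ⊆ ℂ` with logarithmic pole at `p`. -/
noncomputable def greenFn (D : Set ℂ) (p z : ℂ) : EReal :=
  sSup {v : EReal | ∃ u : ℂ → EReal, SubharmonicOn u D ∧ (∀ x ∈ D, u x < 0) ∧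
    (∃ C : ℝ, ∀ᶠ x in 𝓝 p, u x ≤ ((Real.log ‖x - p‖ + C : ℝ) : EReal)) ∧ v = u z}

/-- A polydisc in `ℂⁿ` with centre `c` and multiradius `r`. -/
def polydisc {n : ℕ} (c : Fin n → ℂ) (r : Fin n → ℝ) : Set (Fin n → ℂ) :=
  {z | ∀ i, ‖z i - c i‖ < r i}

open MeasureTheory Filter Topology Metric Set
open scoped ENNReal NNReal ContDiff

abbrev Cn (n : ℕ) := Fin n → ℂ
open MeasureTheory Filter Topology Metric Set Complex
open scoped ENNReal NNReal ContDiff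
notation "oR" => ENNReal.ofReal
notation "Fc" n:max => Cn n → ℂ
notation "eX" => Real.exp
notation "lG" => Real.log
notation "pS" => (by positivity)
notation "nN" => (by norm_num)
notation "fP" => (by fun_prop)
notation "sM" => (by simp)
notation "lA" => (by linarith)

lemma rot_mp {n : ℕ} {c : ℂ} (hc : ‖c‖ = 1) :
    MeasurePreserving (fun z : Cn n => c • z) volume volume := by
  have h1 : MeasurePreserving (fun z : ℂ => c * z) volume volume := by
    exact (rotation ⟨c, by simpa [Submonoid.unitSphere] using hc⟩).measurePreserving
  exact volume_preserving_pi (fun _ : Fin n => h1)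

lemma bergman_ineq {n : ℕ} {f : Fc n} {z : Cn n} {r : ℝ}
    (hf : DifferentiableOn ℂ f (ball z r)) :
    ‖f z‖ₑ ^ 2 * volume (ball z r) ≤ ∫⁻ w in ball z r, ‖f w‖ₑ ^ 2 := by
  set h : Cn n → ℝ≥0∞ := (ball z r).indicator (fun w => ‖f w‖ₑ ^ 2) with hh
  have hm : Measurable h := by
    classical
    have h1 : Measurable ((ball z r).piecewise f 0) :=
      hf.continuousOn.measurable_piecewise continuousOn_const measurableSet_ball
    have : h = fun w => ‖(ball z r).piecewise f 0 w‖ₑ ^ 2 := by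
      ext w; by_cases hw : w ∈ ball z r <;> simp [hh, hw]
    rw [this]; fun_prop
  have key : ∀ w ∈ ball z r, oR (2 * Real.pi) * ‖f z‖ₑ ^ 2 ≤
      ∫⁻ θ in Ioc 0 (2 * Real.pi), h (z + circleMap 0 1 θ • (w - z)) := by
    intro w hw
    have hin : ∀ ζ : ℂ, ‖ζ‖ ≤ 1 → z + ζ • (w - z) ∈ ball z r := by
      intro ζ hζ
      rw [mem_ball, dist_eq_norm] at hw ⊢
      rw [add_sub_cancel_left, norm_smul]
      nlinarith [norm_nonneg (w - z)]
    have hd : DifferentiableOn ℂ (fun ζ : ℂ => f (z + ζ • (w - z)) ^ 2) (closedBall 0 1) := by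
      refine DifferentiableOn.pow (hf.comp fP fun ζ hζ => hin ζ (by simpa using hζ)) 2
    have hmv2 := DiffContOnCl.circleAverage (f := fun ζ : ℂ => f (z + ζ • (w - z)) ^ 2)
      (c := 0) (R := 1) (by
        refine DifferentiableOn.diffContOnCl ?_
        rw [abs_one]; exact hd.mono closure_ball_subset_closedBall)
    simp only [zero_smul, add_zero] at hmv2
    rw [Real.circleAverage_def] at hmv2
    have h2 : (2 * Real.pi) • f z ^ 2 =
        ∫ θ in (0:ℝ)..2 * Real.pi, f (z + circleMap 0 1 θ • (w - z)) ^ 2 := by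
      rw [← hmv2, smul_smul, mul_inv_cancel₀ pS, one_smul]
    have h3 : oR (2 * Real.pi) * ‖f z‖ₑ ^ 2 = ‖(2 * Real.pi) • f z ^ 2‖ₑ := by
      rw [enorm_smul, enorm_pow, Real.enorm_of_nonneg pS]
    rw [h3, h2, intervalIntegral.integral_of_le pS]
    refine (enorm_integral_le_lintegral_enorm _).trans (lintegral_mono fun θ => ?_)
    rw [hh, indicator_of_mem (hin _ sM), enorm_pow]
  have hp : oR (2 * Real.pi) ≠ 0 := by simp [Real.pi_pos]
  refine (ENNReal.mul_le_mul_iff_right hp ENNReal.ofReal_ne_top).1 ?_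
  calc _ = ∫⁻ w in ball z r, oR (2 * Real.pi) * ‖f z‖ₑ ^ 2 := by
        rw [setLIntegral_const, mul_assoc]
    _ ≤ ∫⁻ w in ball z r, ∫⁻ θ in Ioc 0 (2 * Real.pi), h (z + circleMap 0 1 θ • (w - z)) :=
        setLIntegral_mono' measurableSet_ball key
    _ ≤ ∫⁻ w, ∫⁻ θ in Ioc 0 (2 * Real.pi), h (z + circleMap 0 1 θ • (w - z)) :=
        setLIntegral_le_lintegral _ _
    _ = ∫⁻ θ in Ioc 0 (2 * Real.pi), ∫⁻ w, h (z + circleMap 0 1 θ • (w - z)) := by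
        refine lintegral_lintegral_swap (Measurable.aemeasurable ?_)
        refine hm.comp (Continuous.measurable ?_)
        have := continuous_circleMap 0 1
        fun_prop
    _ = ∫⁻ θ in Ioc 0 (2 * Real.pi), ∫⁻ w, h w := by
        refine lintegral_congr fun θ => ?_
        rw [lintegral_sub_right_eq_self (fun w => h (z + circleMap 0 1 θ • w)) z,
          (rot_mp sM).lintegral_comp (f := fun w => h (z + w)) fP,
          lintegral_add_left_eq_self]
    _ = _ := by
        rw [lintegral_const, hh, lintegral_indicator measurableSet_ball, mul_comm]; simp

lemma bergman_unif {n : ℕ} {f : Fc n} {z w : Cn n} {r : ℝ} (hw : w ∈ ball z r)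
    (hf : DifferentiableOn ℂ f (ball z (2 * r))) :
    ‖f w‖ₑ ^ 2 * volume (ball (0 : Cn n) r) ≤ ∫⁻ x in ball z (2 * r), ‖f x‖ₑ ^ 2 := by
  have hs : ball w r ⊆ ball z (2 * r) := by
    intro x hx; rw [mem_ball] at *; linarith [dist_triangle x w z]
  rw [← Measure.addHaar_ball_center volume w]
  exact (bergman_ineq (hf.mono hs)).trans (lintegral_mono_set hs)

lemma hol_lim {n : ℕ} {F : ℕ → Fc n} {f : Fc n} {z : Cn n} {r : ℝ} (hr : 0 < r) (N : ℕ)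
    (hF : ∀ m ≥ N, DifferentiableOn ℂ (F m) (ball z r))
    (h : TendstoUniformlyOn F f atTop (ball z r)) : DifferentiableAt ℂ f z := by
  have hC := h.uniformCauchySeqOn
  rw [Metric.uniformCauchySeqOn_iff] at hC
  have hsub : ∀ y ∈ ball z (r/2), ball y (r/2) ⊆ ball z r := by
    intro y hy x hx; rw [mem_ball] at *; linarith [dist_triangle x y z]
  have hdiff : ∀ m ≥ N, ∀ y ∈ ball z r, DifferentiableAt ℂ (F m) y := fun m hm y hy =>
    (hF m hm).differentiableAt (isOpen_ball.mem_nhds hy)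
  have hC' : UniformCauchySeqOn (fun m y => fderiv ℂ (F (m + N)) y) atTop (ball z (r/2)) := by
    rw [Metric.uniformCauchySeqOn_iff]
    intro ε hε
    obtain ⟨M, hM⟩ := hC (ε * r / 8) pS
    refine ⟨M, fun m hm k hk y hy => ?_⟩
    have hyz : y ∈ ball z r := hsub y hy (mem_ball_self pS)
    rw [dist_eq_norm, ← fderiv_sub (hdiff _ (by omega) y hyz) (hdiff _ (by omega) y hyz)]
    refine lt_of_le_of_lt (Complex.norm_fderiv_le_div_of_mapsTo_ball (R₁ := r/2) (R₂ := ε*r/4)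
      (((hF _ (by omega)).sub (hF _ (by omega))).mono (hsub y hy)) ?_ pS) ?_
    · intro x hx
      have h1 := hM (m + N) (by omega) (k + N) (by omega) x (hsub y hy hx)
      have h2 := hM (m + N) (by omega) (k + N) (by omega) y hyz
      rw [dist_eq_norm] at h1 h2
      rw [mem_closedBall, dist_eq_norm]
      refine (norm_sub_le _ _).trans ?_
      simp only [Pi.sub_apply]
      linarith
    · field_simp; linarith
  have hlim : ∀ y, ∃ L : Cn n →L[ℂ] ℂ, y ∈ ball z (r/2) →
      Tendsto (fun m => fderiv ℂ (F (m + N)) y) atTop (𝓝 L) := by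
    intro y
    by_cases hy : y ∈ ball z (r/2)
    · obtain ⟨L, hL⟩ := cauchySeq_tendsto_of_complete (hC'.cauchySeq hy)
      exact ⟨L, fun _ => hL⟩
    · exact ⟨0, fun h => absurd h hy⟩
  choose g hg using hlim
  exact (hasFDerivAt_of_tendstoUniformlyOn isOpen_ball
    (hC'.tendstoUniformlyOn_of_tendsto hg)
    (fun m x hx => (hdiff (m + N) (by omega) x
      (hsub x hx (mem_ball_self pS))).hasFDerivAt)
    (fun x hx => ((h.tendsto_at (hsub x hx (mem_ball_self pS))).comp
      (tendsto_add_atTop_nat N))) (mem_ball_self pS)).differentiableAt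

lemma hol_id {n : ℕ} {f : Fc n} {U V : Set (Cn n)} (hU : IsOpen U) (hc : IsPreconnected U)
    (hf : DifferentiableOn ℂ f U) (hV : IsOpen V) (hVn : V.Nonempty) (hVU : V ⊆ U)
    (h0 : ∀ z ∈ V, f z = 0) : ∀ z ∈ U, f z = 0 := by
  set Z := interior {z | f z = 0} with hZ
  have : U ⊆ Z := by
    refine hc.subset_of_closure_inter_subset isOpen_interior ?_ ?_
    · obtain ⟨v, hv⟩ := hVn
      exact ⟨v, hVU hv, mem_interior.2 ⟨V, h0, hV, hv⟩⟩
    · rintro x ⟨hx, hxU⟩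
      obtain ⟨r, hr, hrU⟩ := Metric.isOpen_iff.1 hU x hxU
      obtain ⟨y, hyZ, hy⟩ := Metric.mem_closure_iff.1 hx r hr
      refine mem_interior.2 ⟨ball x r, fun w hw => ?_, isOpen_ball, mem_ball_self hr⟩
      have hyb : y ∈ ball x r := by rwa [mem_ball, dist_comm]
      let ℓ : ℂ → Cn n := fun t => y + t • (w - y)
      have hlc : Continuous ℓ := by fun_prop
      have hld : Differentiable ℂ ℓ := by fun_prop
      have hconv : Convex ℝ (ℓ ⁻¹' ball x r) := by
        intro t ht u hu p q hp hq hpq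
        have : ℓ (p • t + q • u) = p • ℓ t + q • ℓ u := by
          ext i
          have h' : (p : ℂ) + q = 1 := by exact_mod_cast hpq
          simp only [ℓ, Pi.add_apply, Pi.smul_apply, Pi.sub_apply, smul_eq_mul, Complex.real_smul]
          linear_combination (-(y i)) * h'
        show ℓ (p • t + q • u) ∈ ball x r
        rw [this]; exact convex_ball x r ht hu hp hq hpq
      have hopen : IsOpen (ℓ ⁻¹' ball x r) := isOpen_ball.preimage hlc
      have han : AnalyticOnNhd ℂ (f ∘ ℓ) (ℓ ⁻¹' ball x r) :=
        DifferentiableOn.analyticOnNhd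
          (hf.comp hld.differentiableOn fun t ht => hrU ht) hopen
      have h00 : (f ∘ ℓ) =ᶠ[𝓝 0] 0 := by
        have : ∀ᶠ t in 𝓝 (0:ℂ), ℓ t ∈ Z :=
          hlc.continuousAt.eventually (isOpen_interior.mem_nhds (by simpa [ℓ] using hyZ))
        filter_upwards [this] with t ht
        exact (interior_subset ht : ℓ t ∈ {z | f z = 0})
      have := han.eqOn_zero_of_preconnected_of_eventuallyEq_zero hconv.isPreconnected
        (by show ℓ 0 ∈ ball x r; simpa [ℓ] using hyb : (0:ℂ) ∈ ℓ ⁻¹' ball x r) h00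
        (by show ℓ 1 ∈ ball x r; simpa [ℓ] using hw : (1:ℂ) ∈ ℓ ⁻¹' ball x r)
      simpa [ℓ] using this
  exact fun z hz => (interior_subset (this hz) : z ∈ {z | f z = 0})

lemma eLp2 {α G : Type*} [MeasurableSpace α] [NormedAddCommGroup G] (f : α → G) (μ : Measure α) :
    eLpNorm f 2 μ ^ 2 = ∫⁻ x, ‖f x‖ₑ ^ 2 ∂μ := by
  have h := eLpNorm_nnreal_pow_eq_lintegral (f := f) (μ := μ) (p := 2) nN
  simpa using h
open MeasureTheory Filter Topology Metric Set
open scoped ENNReal NNReal ContDiff Convolution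

noncomputable def bmp (n m : ℕ) : ContDiffBump (0 : Cn n) :=
  ⟨1 / (2 * ((m : ℝ) + 1)), 1 / ((m : ℝ) + 1), by positivity, by
    apply one_div_lt_one_div_of_lt <;> linarith [(Nat.cast_nonneg m : (0:ℝ) ≤ m)]⟩

noncomputable def rho (n m : ℕ) : Cn n → ℝ := (bmp n m).normed volume

noncomputable def moll {n : ℕ} {F : Type*} [NormedAddCommGroup F] [NormedSpace ℝ F] (m : ℕ)
    (u : Cn n → F) : Cn n → F := rho n m ⋆[ContinuousLinearMap.lsmul ℝ ℝ, volume] u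

section
variable {n : ℕ} {F : Type*} [NormedAddCommGroup F] [NormedSpace ℝ F]

lemma rho_smooth (m : ℕ) : ContDiff ℝ ∞ (rho n m) := (bmp n m).contDiff_normed
lemma rho_cpt (m : ℕ) : HasCompactSupport (rho n m) := (bmp n m).hasCompactSupport_normed
lemma rho_nonneg (m : ℕ) (x : Cn n) : 0 ≤ rho n m x := (bmp n m).nonneg_normed x
lemma rho_supp (m : ℕ) : Function.support (rho n m) = ball 0 (1 / ((m : ℝ) + 1)) :=
  (bmp n m).support_normed_eq
lemma rho_tsupp (m : ℕ) : tsupport (rho n m) = closedBall 0 (1 / ((m : ℝ) + 1)) :=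
  (bmp n m).tsupport_normed_eq
lemma rho_integrable (m : ℕ) : Integrable (rho n m) := (bmp n m).integrable_normed
lemma rho_int (m : ℕ) : ∫ x, rho n m x = 1 := (bmp n m).integral_normed

lemma moll_apply (m : ℕ) (u : Cn n → F) (x : Cn n) : moll m u x = ∫ y, rho n m (x - y) • u y := by
  rw [moll, convolution_eq_swap]; rfl

lemma moll_apply' (m : ℕ) (u : Cn n → F) (x : Cn n) : moll m u x = ∫ y, rho n m y • u (x - y) := by
  rw [moll, convolution_def]; rfl

lemma moll_congr {m : ℕ} {u v : Cn n → F} (h : u =ᵐ[volume] v) : moll m u = moll m v := by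
  ext x; rw [moll_apply, moll_apply]
  exact integral_congr_ae (by filter_upwards [h] with y hy; rw [hy])

lemma moll_smooth (m : ℕ) {u : Cn n → F} [CompleteSpace F] (hu : LocallyIntegrable u) :
    ContDiff ℝ ∞ (moll m u) :=
  (rho_cpt m).contDiff_convolution_left _ (rho_smooth m) hu

lemma moll_integrable (m : ℕ) {u : Cn n → F} (hu : LocallyIntegrable u) (x : Cn n) :
    Integrable (fun y => rho n m y • u (x - y)) :=
  (rho_cpt m).convolutionExists_left (ContinuousLinearMap.lsmul ℝ ℝ) (rho_smooth m).continuous hu x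

lemma moll_ae {u : Cn n → F} [CompleteSpace F] (hu : LocallyIntegrable u) :
    ∀ᵐ x, Tendsto (fun m => moll m u x) atTop (𝓝 (u x)) := by
  refine ContDiffBump.ae_convolution_tendsto_right_of_locallyIntegrable (K := 2)
    tendsto_one_div_add_atTop_nhds_zero_nat (Eventually.of_forall fun m => ?_) hu
  have : (0:ℝ) < (m:ℝ) + 1 := by positivity
  simp only [bmp]; field_simp; rfl

lemma moll_fderiv (m : ℕ) {u : Cn n → F} [CompleteSpace F] (hu : LocallyIntegrable u) (x v : Cn n) :
    fderiv ℝ (moll m u) x v = ∫ y, fderiv ℝ (rho n m) (x - y) v • u y := by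
  have h := (rho_cpt m).hasFDerivAt_convolution_left (ContinuousLinearMap.lsmul ℝ ℝ)
    ((rho_smooth m).of_le sM) hu x
  have he := (HasCompactSupport.fderiv ℝ (rho_cpt (n := n) m)).convolutionExists_left
    ((ContinuousLinearMap.lsmul ℝ ℝ : ℝ →L[ℝ] F →L[ℝ] F).precompL (Cn n))
    ((rho_smooth m).continuous_fderiv sM) hu x
  rw [moll, h.fderiv, convolution_eq_swap, ContinuousLinearMap.integral_apply]
  · rfl
  · exact he.integrable_swap

lemma moll_L2 {u : Fc n} (hu : MemLp u 2) :
    Tendsto (fun m => eLpNorm (moll m u - u) 2 volume) atTop (𝓝 0) := by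
  wlog hum : StronglyMeasurable u
  · have h := this (hu.ae_eq hu.1.ae_eq_mk) hu.1.stronglyMeasurable_mk
    convert h using 2 with m
    rw [moll_congr hu.1.ae_eq_mk]
    exact eLpNorm_congr_ae (by filter_upwards [hu.1.ae_eq_mk] with y hy; simp [← hy])
  have hli : LocallyIntegrable u := hu.locallyIntegrable nN
  have htr : Tendsto (fun t : Cn n => eLpNorm (fun x => u (x - t) - u x) 2 volume) (𝓝 0) (𝓝 0) := by
    let g : C(Cn n, C(Cn n, Cn n)) :=
      (ContinuousMap.mk (fun a : Cn n × Cn n => a.2 - a.1) fP).curry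
    have hg : ∀ t, MeasurePreserving (g t) volume volume :=
      fun t => measurePreserving_sub_right volume t
    have hc := (continuous_const (y := hu.toLp u) (X := Cn n)).compMeasurePreservingLp g.continuous
      hg (by norm_num : (2:ℝ≥0∞) ≠ ⊤)
    have h2 := (hc.tendsto 0).edist (tendsto_const_nhds (x := hu.toLp u))
    have h0 : ∀ t, edist (Lp.compMeasurePreserving (g t) (hg t)
        (hu.toLp u)) (hu.toLp u) = eLpNorm (fun x => u (x - t) - u x) 2 volume := by
      intro t
      rw [Lp.toLp_compMeasurePreserving hu (hg t), Lp.edist_toLp_toLp]; rfl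
    simp only [h0] at h2
    simpa using h2
  rw [ENNReal.tendsto_atTop_zero]
  intro ε hε
  obtain ⟨d, hd, hdε⟩ := Metric.eventually_nhds_iff_ball.1
    ((ENNReal.tendsto_nhds_zero.1 htr) ε hε)
  obtain ⟨N, hN⟩ := exists_nat_one_div_lt hd
  refine ⟨N, fun m hm => ?_⟩
  have hr : ∀ t, rho n m t ≠ 0 → t ∈ ball (0 : Cn n) d := by
    intro t ht
    have : t ∈ ball (0 : Cn n) (1 / ((m : ℝ) + 1)) := by rw [← rho_supp]; exact ht
    refine ball_subset_ball (le_trans ?_ hN.le) this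
    exact one_div_le_one_div_of_le pS (by exact_mod_cast by omega)
  set ν : Measure (Cn n) := volume.withDensity (fun t => oR (rho n m t)) with hν
  have hrm : Measurable fun t => oR (rho n m t) :=
    (rho_smooth m).continuous.measurable.ennreal_ofReal
  have : IsProbabilityMeasure ν := by
    constructor
    rw [hν, withDensity_apply _ MeasurableSet.univ, setLIntegral_univ,
      ← ofReal_integral_eq_lintegral_ofReal (rho_integrable m)
        (Eventually.of_forall (rho_nonneg m)), rho_int]; simp
  have hpt : ∀ x, ‖(moll m u - u) x‖ₑ ^ 2 ≤ ∫⁻ t, ‖u (x - t) - u x‖ₑ ^ 2 ∂ν := by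
    intro x
    have h1 : (moll m u - u) x = ∫ t, rho n m t • (u (x - t) - u x) := by
      simp only [smul_sub]
      rw [integral_sub (moll_integrable m hli x) ((rho_integrable m).smul_const _),
        integral_smul_const, rho_int, one_smul, Pi.sub_apply, moll_apply']
    have hmeas : StronglyMeasurable fun t => u (x - t) - u x :=
      (hum.comp_measurable (measurable_const.sub measurable_id)).sub stronglyMeasurable_const
    have h2 : ‖(moll m u - u) x‖ₑ ≤ ∫⁻ t, ‖u (x - t) - u x‖ₑ ∂ν := by
      rw [h1, hν, lintegral_withDensity_eq_lintegral_mul _ hrm hmeas.enorm]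
      refine (enorm_integral_le_lintegral_enorm _).trans (lintegral_mono fun t => ?_)
      simp only [Pi.mul_apply]
      rw [enorm_smul, Real.enorm_of_nonneg (rho_nonneg m t)]
    have h3 := eLpNorm_le_eLpNorm_of_exponent_le (μ := ν) (p := 1) (q := 2)
      nN hmeas.aestronglyMeasurable
    rw [eLpNorm_one_eq_lintegral_enorm] at h3
    have h4 := pow_le_pow_left' (h2.trans h3) 2
    rwa [eLp2] at h4
  have h5 : eLpNorm (moll m u - u) 2 volume ^ 2 ≤ ε ^ 2 := by
    rw [eLp2]
    calc _ ≤ ∫⁻ x, ∫⁻ t, ‖u (x - t) - u x‖ₑ ^ 2 ∂ν := lintegral_mono hpt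
      _ = ∫⁻ t, (∫⁻ x, ‖u (x - t) - u x‖ₑ ^ 2) ∂ν := by
        refine lintegral_lintegral_swap (Measurable.aemeasurable ?_)
        have := hum.measurable
        unfold Function.uncurry; fun_prop
      _ ≤ ∫⁻ t, ε ^ 2 ∂ν := by
        refine lintegral_mono_ae ?_
        rw [hν, ae_withDensity_iff hrm]
        refine Eventually.of_forall fun t ht => ?_
        have := pow_le_pow_left' (hdε t (hr t (by contrapose! ht; simp [ht]))) 2
        rwa [eLp2] at this
      _ = ε ^ 2 := by simp
  exact (ENNReal.pow_right_strictMono (by norm_num : 2 ≠ 0)).le_iff_le.1 h5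
end
open MeasureTheory Filter Topology Metric Set Complex
open scoped ENNReal NNReal ContDiff

noncomputable def wd {n : ℕ} (c : ℂ) (j : Fin n) (f : Fc n) (z : Cn n) : ℂ :=
  (1 / 2) * (fderiv ℝ f z (Pi.single j 1) + c * fderiv ℝ f z (Pi.single j I))

notation "wm" => wd (-Complex.I)

structure Tst {n : ℕ} (U : Set (Cn n)) (η : Fc n) : Prop where
  sm : ContDiff ℝ ∞ η
  cp : HasCompactSupport η
  su : tsupport η ⊆ U

section
variable {n : ℕ} {c : ℂ} {j k : Fin n} {f g : Fc n} {z : Cn n} {U : Set (Cn n)}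

lemma wd_mul (hf : DifferentiableAt ℝ f z) (hg : DifferentiableAt ℝ g z) :
    wd c j (fun x => f x * g x) z = wd c j f z * g z + f z * wd c j g z := by
  simp only [wd, fderiv_fun_mul hf hg, add_apply, smul_apply, smul_eq_mul]; ring

lemma wd_add (hf : DifferentiableAt ℝ f z) (hg : DifferentiableAt ℝ g z) :
    wd c j (fun x => f x + g x) z = wd c j f z + wd c j g z := by
  simp only [wd, fderiv_fun_add hf hg, add_apply]; ring

lemma wd_sub (hf : DifferentiableAt ℝ f z) (hg : DifferentiableAt ℝ g z) :
    wd c j (fun x => f x - g x) z = wd c j f z - wd c j g z := by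
  simp only [wd, fderiv_fun_sub hf hg, sub_apply]; ring

lemma wd_sum {ι : Type*} {s : Finset ι} {F : ι → Fc n}
    (hF : ∀ i ∈ s, DifferentiableAt ℝ (F i) z) :
    wd c j (fun x => ∑ i ∈ s, F i x) z = ∑ i ∈ s, wd c j (F i) z := by
  simp only [wd, fderiv_fun_sum hF, sum_apply, Finset.mul_sum,
    ← Finset.sum_add_distrib]

lemma wd_conj (hf : DifferentiableAt ℝ f z) :
    wd c j (fun x => star (f x)) z = star (wd (star c) j f z) := by
  have h : HasFDerivAt (fun x => star (f x)) (conjCLE.toContinuousLinearMap.comp (fderiv ℝ f z)) z :=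
    (conjCLE.toContinuousLinearMap.hasFDerivAt).comp z hf.hasFDerivAt
  simp only [wd]; rw [h.fderiv]; simp

lemma wd_congr (h : f =ᶠ[𝓝 z] g) : wd c j f z = wd c j g z := by
  simp only [wd, h.fderiv_eq]

lemma wd_smooth (hf : ContDiff ℝ ∞ f) : ContDiff ℝ ∞ (wd c j f) := by
  have h : ∀ v, ContDiff ℝ ∞ fun z => fderiv ℝ f z v := fun v =>
    (hf.fderiv_right (m := ∞) sM).clm_apply contDiff_const
  unfold wd
  exact contDiff_const.mul ((h _).add (contDiff_const.mul (h _)))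

lemma wd_comm (hf : ContDiff ℝ ∞ f) (c' : ℂ) :
    wd c j (wd c' k f) z = wd c' k (wd c j f) z := by
  have hd : Differentiable ℝ (fderiv ℝ f) := (hf.fderiv_right (m := ∞) sM).differentiable sM
  have h2 : ∀ (c : ℂ) (j : Fin n) v, fderiv ℝ (wd c j f) z v = (1/2) *
      (fderiv ℝ (fderiv ℝ f) z v (Pi.single j 1) + c * fderiv ℝ (fderiv ℝ f) z v (Pi.single j I)) := by
    intro c j v
    have hv : ∀ w, HasFDerivAt (fun x => fderiv ℝ f x w) ((fderiv ℝ (fderiv ℝ f) z).flip w) z := by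
      intro w
      simpa using (hd z).hasFDerivAt.clm_apply (hasFDerivAt_const w z)
    have := ((hv (Pi.single j 1)).add ((hv (Pi.single j I)).const_mul c)).const_mul (1/2 : ℂ)
    have h3 : fderiv ℝ (wd c j f) z = _ := this.fderiv
    rw [h3]; simp; ring
  have hs : ∀ v w, fderiv ℝ (fderiv ℝ f) z v w = fderiv ℝ (fderiv ℝ f) z w v := fun v w =>
    (hf.contDiffAt.isSymmSndFDerivAt (by simp; exact ENat.LEInfty.out)) v w
  rw [wd, wd]
  simp only [h2]
  rw [hs (Pi.single k 1) (Pi.single j 1), hs (Pi.single k 1) (Pi.single j I),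
    hs (Pi.single k I) (Pi.single j 1), hs (Pi.single k I) (Pi.single j I)]
  ring

lemma wd_support : tsupport (wd c j f) ⊆ tsupport f := by
  refine closure_minimal (fun x hx => ?_) (isClosed_tsupport f)
  by_contra h
  apply hx
  have h0 : fderiv ℝ f x = 0 := by
    have := notMem_tsupport_iff_eventuallyEq.1 h
    rw [this.fderiv_eq]; simp
  simp [wd, h0]

lemma Tst.wd (h : Tst U f) (c : ℂ) (j : Fin n) : Tst U (wd c j f) :=
  ⟨wd_smooth h.sm, h.cp.mono' ((subset_tsupport _).trans wd_support), wd_support.trans h.su⟩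

lemma Tst.mul_smooth (h : Tst U f) (hU : IsOpen U) (hg : ContDiffOn ℝ ∞ g U) :
    Tst U (fun x => f x * g x) := by
  have hts : tsupport (fun x => f x * g x) ⊆ tsupport f := closure_mono fun x hx => by
    intro h0; exact hx (by simp [h0])
  refine ⟨?_, h.cp.mul_right, hts.trans h.su⟩
  rw [contDiff_iff_contDiffAt]
  intro x
  by_cases hx : x ∈ tsupport f
  · exact h.sm.contDiffAt.mul (hg.contDiffAt (hU.mem_nhds (h.su hx)))
  · have := notMem_tsupport_iff_eventuallyEq.1 hx
    refine (contDiffAt_const (c := (0:ℂ))).congr_of_eventuallyEq ?_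
    filter_upwards [this] with y hy; simp [hy]

lemma Tst.conj (h : Tst U f) : Tst U (fun x => star (f x)) := by
  refine ⟨conjCLE.contDiff.comp h.sm, h.cp.comp_left (g := star) sM, ?_⟩
  refine subset_trans (closure_mono fun x hx => ?_) h.su
  intro h0; exact hx (by simp [h0])

lemma Tst.add (h : Tst U f) (h' : Tst U g) : Tst U (fun x => f x + g x) :=
  ⟨h.sm.add h'.sm, h.cp.add h'.cp, (tsupport_add f g).trans (union_subset h.su h'.su)⟩

lemma Tst.mono {V : Set (Cn n)} (h : Tst U f) (hV : U ⊆ V) : Tst V f := ⟨h.sm, h.cp, h.su.trans hV⟩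

lemma Tst.integrable (h : Tst U f) : Integrable f := h.sm.continuous.integrable_of_hasCompactSupport h.cp

lemma Tst.memLp (h : Tst U f) : MemLp f 2 := h.sm.continuous.memLp_of_hasCompactSupport h.cp

lemma wd_ibp (hf : Tst univ f) (hg : ContDiff ℝ ∞ g) :
    ∫ x, f x * wd c j g x = - ∫ x, wd c j f x * g x := by
  have hc : ∀ h : Fc n, Continuous h → (∀ x, f x = 0 → h x = 0) → Integrable h := fun h hh h0 =>
    hh.integrable_of_hasCompactSupport (hf.cp.mono fun x hx h1 => hx (h0 x h1))
  have hfc := hf.sm.continuous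
  have hgc := hg.continuous
  have hcg : ∀ v, Continuous fun x => fderiv ℝ g x v := fun v =>
    (hg.continuous_fderiv sM).clm_apply continuous_const
  have hcf : ∀ v, Continuous fun x => fderiv ℝ f x v := fun v =>
    (hf.sm.continuous_fderiv sM).clm_apply continuous_const
  have i1 : ∀ v, Integrable fun x => f x * fderiv ℝ g x v := fun v =>
    (hfc.mul (hcg v)).integrable_of_hasCompactSupport hf.cp.mul_right
  have i2 : ∀ v, Integrable fun x => fderiv ℝ f x v * g x := fun v =>
    ((hcf v).mul hgc).integrable_of_hasCompactSupport (hf.cp.fderiv_apply ℝ v).mul_right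
  have hv : ∀ v, ∫ x, f x * fderiv ℝ g x v = - ∫ x, fderiv ℝ f x v * g x := fun v =>
    integral_mul_fderiv_eq_neg_fderiv_mul_of_integrable (i2 v) (i1 v)
      ((hfc.mul hgc).integrable_of_hasCompactSupport hf.cp.mul_right)
      (fun x _ => hf.sm.differentiable sM x) (fun x _ => hg.differentiable sM x)
  have e1 : ∀ x, f x * wd c j g x = (1/2) * (f x * fderiv ℝ g x (Pi.single j 1)) +
      (c/2) * (f x * fderiv ℝ g x (Pi.single j I)) := fun x => by simp only [wd]; ring
  have e2 : ∀ x, wd c j f x * g x = (1/2) * (fderiv ℝ f x (Pi.single j 1) * g x) +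
      (c/2) * (fderiv ℝ f x (Pi.single j I) * g x) := fun x => by simp only [wd]; ring
  simp only [e1, e2]
  rw [integral_add ((i1 _).const_mul _) ((i1 _).const_mul _),
    integral_add ((i2 _).const_mul _) ((i2 _).const_mul _)]
  simp only [integral_const_mul, hv]; ring

lemma rho_tst (m : ℕ) (x : Cn n) (h : closedBall x (1 / ((m:ℝ) + 1)) ⊆ U) :
    Tst U (fun y => (rho n m (x - y) : ℂ)) := by
  have hts : tsupport (fun y => (rho n m (x - y) : ℂ)) ⊆ closedBall x (1 / ((m:ℝ) + 1)) := by
    refine closure_minimal (fun y hy => ?_) isClosed_closedBall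
    have : x - y ∈ Function.support (rho n m) := by
      intro h0; exact hy (by simp [h0])
    rw [rho_supp] at this
    rw [mem_closedBall, dist_comm, dist_eq_norm]; simpa using (mem_ball_zero_iff.1 this).le
  refine ⟨ofRealCLM.contDiff.comp ((rho_smooth m).comp (contDiff_const.sub contDiff_id)), ?_, hts.trans h⟩
  exact (isCompact_closedBall x _).of_isClosed_subset (isClosed_tsupport _) hts

lemma wd_moll (m : ℕ) (hf : LocallyIntegrable f) (x : Cn n) :
    wd c j (moll m f) x = - ∫ y, f y * wd c j (fun y => (rho n m (x - y) : ℂ)) y := by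
  have hr : ∀ y v, fderiv ℝ (fun y => (rho n m (x - y) : ℂ)) y v
      = -(fderiv ℝ (rho n m) (x - y) v : ℂ) := by
    intro y v
    have h1 : HasFDerivAt (rho n m) (fderiv ℝ (rho n m) (x - y)) (x - y) :=
      ((rho_smooth m).differentiable sM _).hasFDerivAt
    have h2 := ofRealCLM.hasFDerivAt.comp y (h1.comp y ((hasFDerivAt_id y).const_sub x))
    have h3 : fderiv ℝ (fun y => (rho n m (x - y) : ℂ)) y = _ := h2.fderiv
    rw [h3]; simp
  have hi : ∀ v, Integrable fun y => (fderiv ℝ (rho n m) (x - y) v : ℂ) * f y := by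
    intro v
    have := ((rho_cpt (n := n) m).fderiv_apply ℝ v).convolutionExists_left
      (ContinuousLinearMap.lsmul ℝ ℝ : ℝ →L[ℝ] ℂ →L[ℝ] ℂ)
      (((rho_smooth m).continuous_fderiv sM).clm_apply continuous_const) hf x
    simpa using this.integrable_swap
  have e1 : ∀ y, f y * wd c j (fun y => (rho n m (x - y) : ℂ)) y =
      -((1/2) * ((fderiv ℝ (rho n m) (x - y) (Pi.single j 1) : ℂ) * f y) +
      (c/2) * ((fderiv ℝ (rho n m) (x - y) (Pi.single j I) : ℂ) * f y)) := fun y => by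
    simp only [wd, hr]; ring
  simp only [e1]
  rw [integral_neg, integral_add ((hi _).const_mul _) ((hi _).const_mul _), wd, moll_fderiv m hf,
    moll_fderiv m hf]
  simp only [integral_const_mul, real_smul]; ring

lemma hol_of_wd (hf : DifferentiableAt ℝ f z) (h : ∀ j, wd I j f z = 0) : DifferentiableAt ℂ f z := by
  set L := fderiv ℝ f z
  have hI : ∀ j, L (Pi.single j I) = I * L (Pi.single j 1) := by
    intro j
    have := h j
    simp only [wd] at this
    have h2 : L (Pi.single j 1) + I * L (Pi.single j I) = 0 := by simpa using this
    linear_combination (-I) * h2 + L (Pi.single j I) * I_mul_I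
  have hc : ∀ (j) (a : ℂ), L (Pi.single j a) = a * L (Pi.single j 1) := by
    intro j a
    have : (Pi.single j a : Cn n) = a.re • (Pi.single j 1 : Cn n) + a.im • (Pi.single j I : Cn n) := by
      rw [← Pi.single_smul, ← Pi.single_smul, ← Pi.single_add]; congr 1; apply Complex.ext <;> simp
    rw [this, map_add, map_smul, map_smul, hI]
    conv_rhs => rw [← re_add_im a]
    simp only [real_smul]; ring
  have hsum : ∀ v, L v = ∑ j, v j * L (Pi.single j 1) := by
    intro v
    conv_lhs => rw [← Finset.univ_sum_single v]
    rw [map_sum]; exact Finset.sum_congr rfl fun j _ => hc j _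
  let L' : Cn n →L[ℂ] ℂ := ∑ j, (L (Pi.single j 1)) • ContinuousLinearMap.proj j
  have : L'.restrictScalars ℝ = L := by
    ext v; rw [hsum]; simp [L', mul_comm]
  exact (hasFDerivAt_of_restrictScalars ℝ hf.hasFDerivAt this).differentiableAt

lemma wd_of_hol (hf : DifferentiableAt ℂ f z) : wd I j f z = 0 := by
  have h := hf.hasFDerivAt.restrictScalars ℝ
  have e : (Pi.single j I : Cn n) = I • Pi.single j 1 := by rw [← Pi.single_smul]; simp
  simp only [wd, h.fderiv, ContinuousLinearMap.coe_restrictScalars', e, map_smul, smul_eq_mul]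
  linear_combination (1/2) * fderiv ℂ f z (Pi.single j 1) * I_mul_I
end

section
variable {n : ℕ} {u : Fc n} {Ω : Set (Cn n)}
theorem weyl (hΩ : IsOpen Ω) (hu : MemLp u 2)
    (h : ∀ η, Tst Ω η → ∀ j, ∫ x, u x * wd I j η x = 0) :
    ∃ f, DifferentiableOn ℂ f Ω ∧ ∀ᵐ x, x ∈ Ω → f x = u x := by
  have hli : LocallyIntegrable u := hu.locallyIntegrable nN
  have hhol : ∀ z r, 0 < r → ball z (4 * r) ⊆ Ω → ∃ N : ℕ, ∀ m ≥ N,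
      DifferentiableOn ℂ (moll m u) (ball z (2 * r)) := by
    intro z r hr hz
    obtain ⟨N, hN⟩ := exists_nat_one_div_lt hr
    refine ⟨N, fun m hm x hx => DifferentiableAt.differentiableWithinAt ?_⟩
    refine hol_of_wd ((moll_smooth m hli).differentiable sM x) fun j => ?_
    rw [wd_moll m hli, h _ (rho_tst m x ?_), neg_zero]
    intro y hy
    apply hz
    have h1 : 1 / ((m:ℝ) + 1) ≤ 1 / ((N:ℝ) + 1) :=
      one_div_le_one_div_of_le pS (by exact_mod_cast by omega)
    rw [mem_closedBall] at hy; rw [mem_ball] at *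
    linarith [dist_triangle y x z]
  have hC : ∀ z r, 0 < r → ball z (4 * r) ⊆ Ω →
      UniformCauchySeqOn (fun m => moll m u) atTop (ball z r) := by
    intro z r hr hz
    obtain ⟨N, hN⟩ := hhol z r hr hz
    rw [Metric.uniformCauchySeqOn_iff]
    intro ε hε
    set v := volume (ball (0 : Cn n) r) with hv
    have hv0 : v ≠ 0 := (measure_ball_pos volume _ hr).ne'
    have hvt : v ≠ ⊤ := measure_ball_lt_top.ne
    have hlim : Tendsto (fun p : ℕ × ℕ => (eLpNorm (moll p.1 u - u) 2 volume +
        eLpNorm (moll p.2 u - u) 2 volume) ^ 2) atTop (𝓝 0) := by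
      rw [← prod_atTop_atTop_eq]
      have := ((moll_L2 hu).comp tendsto_fst).add ((moll_L2 hu).comp
        (tendsto_snd (f := (atTop : Filter ℕ)) (g := (atTop : Filter ℕ))))
      have h2 := (ENNReal.continuous_pow 2).tendsto 0 |>.comp (by simpa using this)
      simpa [Function.comp_def] using h2
    have he : (0:ℝ≥0∞) < oR ε ^ 2 * v :=
      ENNReal.mul_pos (pow_ne_zero 2 (by simpa using hε)) hv0
    obtain ⟨⟨a, b⟩, hab⟩ := eventually_atTop.1 (hlim.eventually_lt_const he)
    refine ⟨max N (max a b), fun m hm k hk x hx => ?_⟩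
    have h1 := bergman_unif hx ((hN m (by omega)).sub (hN k (by omega)))
    have h2 : ∫⁻ y in ball z (2 * r), ‖(moll m u - moll k u) y‖ₑ ^ 2 ≤
        (eLpNorm (moll m u - u) 2 volume + eLpNorm (moll k u - u) 2 volume) ^ 2 := by
      refine (setLIntegral_le_lintegral _ _).trans ?_
      rw [← eLp2]
      refine pow_le_pow_left' ?_ 2
      rw [← eLpNorm_sub_comm u (moll k u)]
      have e : moll m u - moll k u = (moll m u - u) + (u - moll k u) := by abel
      rw [e]
      have hs : ∀ m, AEStronglyMeasurable (moll m u) := fun m =>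
        (moll_smooth m hli).continuous.aestronglyMeasurable
      exact eLpNorm_add_le ((hs m).sub hu.1) (hu.1.sub (hs k)) nN
    have h3 := lt_of_le_of_lt (h1.trans h2) (hab (m, k) ⟨by omega, by omega⟩)
    rw [ENNReal.mul_lt_mul_iff_left hv0 hvt] at h3
    have h4 := (ENNReal.pow_right_strictMono (by norm_num : 2 ≠ 0)).lt_iff_lt.1 h3
    rw [dist_eq_norm, ← ENNReal.ofReal_lt_ofReal_iff hε, ofReal_norm]
    exact h4
  have hr4 : ∀ z ∈ Ω, ∃ r > 0, ball z (4 * r) ⊆ Ω := by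
    intro z hz
    obtain ⟨r, hr, h⟩ := Metric.isOpen_iff.1 hΩ z hz
    exact ⟨r / 4, by positivity, by rwa [mul_div_cancel₀ _ nN]⟩
  have hlim : ∀ z, ∃ l, z ∈ Ω → Tendsto (fun m => moll m u z) atTop (𝓝 l) := by
    intro z
    by_cases hz : z ∈ Ω
    · obtain ⟨r, hr, h⟩ := hr4 z hz
      obtain ⟨l, hl⟩ := cauchySeq_tendsto_of_complete ((hC z r hr h).cauchySeq (mem_ball_self hr))
      exact ⟨l, fun _ => hl⟩
    · exact ⟨0, fun h => absurd h hz⟩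
  choose f hf using hlim
  refine ⟨f, fun z hz => DifferentiableAt.differentiableWithinAt ?_, ?_⟩
  · obtain ⟨r, hr, h⟩ := hr4 z hz
    obtain ⟨N, hN⟩ := hhol z r hr h
    exact hol_lim hr N (fun m hm => (hN m hm).mono (ball_subset_ball lA))
      ((hC z r hr h).tendstoUniformlyOn_of_tendsto fun x hx =>
        hf x (h (ball_subset_ball lA hx)))
  · filter_upwards [moll_ae hli] with x hx hxΩ using tendsto_nhds_unique (hf x hxΩ) hx
end

noncomputable def cx {n : ℕ} (Φ : Cn n → ℝ) : Fc n := fun z => (Φ z : ℂ)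
noncomputable def levi {n : ℕ} (Φ : Cn n → ℝ) (z ξ : Cn n) : ℝ :=
  (∑ j, ∑ k, wm k (wd I j (cx Φ)) z * ξ k * star (ξ j)).re
noncomputable def del {n : ℕ} (Φ : Cn n → ℝ) (j : Fin n) (f : Fc n) (z : Cn n) : ℂ :=
  wm j f z - wm j (cx Φ) z * f z
noncomputable def ew {n : ℕ} (Φ : Cn n → ℝ) : Fc n := fun z => (eX (-Φ z) : ℂ)

section
variable {n : ℕ} {c : ℂ} {j k : Fin n} {f g : Fc n} {z : Cn n} {U : Set (Cn n)} {Φ : Cn n → ℝ}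

lemma cx_smooth (h : ContDiff ℝ ∞ Φ) : ContDiff ℝ ∞ (cx Φ) := ofRealCLM.contDiff.comp h
lemma ew_smooth (h : ContDiff ℝ ∞ Φ) : ContDiff ℝ ∞ (ew Φ) := cx_smooth (h.neg.exp)

lemma wd_real {F : ℝ → ℝ} {F' : ℝ} (hΦ : DifferentiableAt ℝ Φ z) (hF : HasDerivAt F F' (Φ z)) :
    wd c j (cx fun x => F (Φ x)) z = F' * wd c j (cx Φ) z := by
  have h1 := ofRealCLM.hasFDerivAt.comp z (hF.hasFDerivAt.comp z hΦ.hasFDerivAt)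
  have h2 := ofRealCLM.hasFDerivAt.comp z hΦ.hasFDerivAt
  have e1 : fderiv ℝ (cx fun x => F (Φ x)) z = _ := h1.fderiv
  have e2 : fderiv ℝ (cx Φ) z = _ := h2.fderiv
  simp [wd, e1, e2]; ring

lemma wd_ew (h : ContDiff ℝ ∞ Φ) : wd c j (ew Φ) z = - wd c j (cx Φ) z * ew Φ z := by
  have := wd_real (c := c) (j := j) (F := fun t => eX (-t)) (h.differentiable sM z)
    ((Real.hasDerivAt_exp _).comp (Φ z) (hasDerivAt_neg (Φ z)))
  show wd c j (cx fun x => eX (-Φ x)) z = _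
  rw [this]; simp [ew]; ring

lemma Tst.mul' (h : Tst U f) (hg : ContDiff ℝ ∞ g) : Tst U (fun x => f x * g x) :=
  ⟨h.sm.mul hg, h.cp.mul_right, (closure_mono fun x (hx : f x * g x ≠ 0) (h0 : f x = 0) => hx (by simp [h0])).trans h.su⟩
lemma Tst.neg (h : Tst U f) : Tst U (fun x => - f x) := by
  simpa using h.mul' (g := fun _ => -1) contDiff_const
lemma Tst.sub (h : Tst U f) (h' : Tst U g) : Tst U (fun x => f x - g x) := by
  simpa [sub_eq_add_neg] using h.add h'.neg
lemma Tst.zero : Tst U (fun _ => 0) := ⟨contDiff_const, HasCompactSupport.zero, by simp [tsupport]⟩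
lemma Tst.sum {ι : Type*} {s : Finset ι} {F : ι → Fc n} (h : ∀ i ∈ s, Tst U (F i)) :
    Tst U (fun x => ∑ i ∈ s, F i x) := by
  classical
  induction s using Finset.induction_on with
  | empty => simpa using Tst.zero
  | insert a s ha ih =>
    simp only [Finset.sum_insert ha]
    exact (h a sM).add (ih fun i hi => h i (by simp [hi]))

lemma del_tst (h : ContDiff ℝ ∞ Φ) (hf : Tst U f) : Tst U (del Φ j f) := by
  have := (hf.wd (-I) j).sub (hf.mul' (wd_smooth (c := -I) (j := j) (cx_smooth h)))
  convert this using 2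
  simp only [del]; ring

lemma del_ibp (h : ContDiff ℝ ∞ Φ) (hf : Tst univ f) (hg : ContDiff ℝ ∞ g) :
    ∫ x, del Φ j f x * star (g x) * ew Φ x = - ∫ x, f x * star (wd I j g x) * ew Φ x := by
  have h1 := wd_ibp (c := -I) (j := j) (hf.mul' (ew_smooth h)) (g := fun x => star (g x))
    (conjCLE.contDiff.comp hg)
  have e1 : ∀ x, f x * star (wd I j g x) * ew Φ x =
      f x * ew Φ x * wm j (fun x => star (g x)) x := by
    intro x; rw [wd_conj (hg.differentiable sM x)]; simp; ring
  have e2 : ∀ x, del Φ j f x * star (g x) * ew Φ x =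
      wm j (fun x => f x * ew Φ x) x * star (g x) := by
    intro x
    rw [wd_mul (hf.sm.differentiable sM x) ((ew_smooth h).differentiable sM x), wd_ew h]
    simp only [del]; ring
  simp only [e1, e2]; rw [h1, neg_neg]

lemma wd_del (h : ContDiff ℝ ∞ Φ) (hf : ContDiff ℝ ∞ f) :
    wd I j (del Φ k f) z = del Φ k (wd I j f) z - wm k (wd I j (cx Φ)) z * f z := by
  have d1 := (wd_smooth (c := -I) (j := k) hf).differentiable sM z
  have d2 := (wd_smooth (c := -I) (j := k) (cx_smooth h)).differentiable sM z
  have d3 := hf.differentiable sM z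
  have : wd I j (del Φ k f) z = _ := wd_sub (c := I) (j := j) d1 (d2.fun_mul d3)
  rw [this, wd_mul d2 d3, wd_comm hf, wd_comm (cx_smooth h)]
  simp only [del]; ring

lemma ew_star (x : Cn n) : star (ew Φ x) = ew Φ x := conj_ofReal _

theorem bochner (h : ContDiff ℝ ∞ Φ) {b : Fin n → Fc n} (hb : ∀ j, Tst univ (b j)) :
    ∫ z, (‖∑ j, del Φ j (b j) z‖ ^ 2 + (1 / 2) * ∑ j, ∑ k, ‖wd I j (b k) z - wd I k (b j) z‖ ^ 2
      - ∑ j, ∑ k, ‖wd I j (b k) z‖ ^ 2 - levi Φ z (fun j => b j z)) * eX (-Φ z) = 0 := by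
  let T : Fin n → Fin n → Fc n := fun j k x =>
    del Φ j (b j) x * star (del Φ k (b k) x) * ew Φ x
    - wd I k (b j) x * star (wd I j (b k) x) * ew Φ x
    - b j x * star (wm k (wd I j (cx Φ)) x * b k x) * ew Φ x
  have hew := ew_smooth h
  have hst : ∀ {g : Fc n}, ContDiff ℝ ∞ g → ContDiff ℝ ∞ fun x => star (g x) :=
    fun hg => conjCLE.contDiff.comp hg
  have t1 : ∀ j k, Tst univ fun x => del Φ j (b j) x * star (del Φ k (b k) x) * ew Φ x := fun j k =>
    ((del_tst h (hb j)).mul' (hst (del_tst h (hb k)).sm)).mul' hew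
  have t2 : ∀ j k, Tst univ fun x => wd I k (b j) x * star (wd I j (b k) x) * ew Φ x := fun j k =>
    (((hb j).wd _ _).mul' (hst ((hb k).wd _ _).sm)).mul' hew
  have t3 : ∀ j k, Tst univ fun x => b j x * star (wm k (wd I j (cx Φ)) x * b k x) * ew Φ x :=
    fun j k => ((hb j).mul' (hst ((wd_smooth (wd_smooth (cx_smooth h))).mul (hb k).sm))).mul' hew
  have t4 : ∀ j k, Tst univ fun x => b j x * star (del Φ k (wd I j (b k)) x) * ew Φ x :=
    fun j k => ((hb j).mul' (hst (del_tst h ((hb k).wd _ _)).sm)).mul' hew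
  have hT : ∀ j k, Tst univ (T j k) := fun j k => ((t1 j k).sub (t2 j k)).sub (t3 j k)
  have hT0 : ∀ j k, ∫ x, T j k x = 0 := by
    intro j k
    have i1 := del_ibp (j := j) h (hb j) (del_tst (j := k) h (hb k)).sm
    have i2 := del_ibp (j := k) h ((hb k).wd I j) (hb j).sm
    have i3 := congrArg star i2
    have hs : ∀ F : Fc n, star (∫ x, F x) = ∫ x, star (F x) := fun F => integral_conj.symm
    rw [star_neg, hs, hs] at i3
    simp only [star_mul', star_star, ew_star] at i3
    have i4 : ∀ x, b j x * star (wd I j (del Φ k (b k)) x) * ew Φ x =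
      b j x * star (del Φ k (wd I j (b k)) x) * ew Φ x -
      b j x * star (wm k (wd I j (cx Φ)) x * b k x) * ew Φ x := by
      intro x; rw [wd_del h (hb k).sm, star_sub]; ring
    simp only [i4] at i1
    rw [integral_sub (t4 j k).integrable (t3 j k).integrable] at i1
    have i5 : ∫ x, star (del Φ k (wd I j (b k)) x) * b j x * ew Φ x =
        ∫ x, b j x * star (del Φ k (wd I j (b k)) x) * ew Φ x := by congr 1; ext x; ring
    have i6 : ∫ x, star (wd I j (b k) x) * wd I k (b j) x * ew Φ x =
        ∫ x, wd I k (b j) x * star (wd I j (b k) x) * ew Φ x := by congr 1; ext x; ring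
    rw [i5, i6] at i3
    simp only [T]
    rw [integral_sub ((t1 j k).sub (t2 j k)).integrable (t3 j k).integrable,
      integral_sub (t1 j k).integrable (t2 j k).integrable, i1, i3]
    ring
  have hS := Tst.sum (U := univ) (s := Finset.univ) (F := fun j x => ∑ k, T j k x)
    fun j _ => Tst.sum fun k _ => hT j k
  have h0 : ∫ x, ∑ j, ∑ k, T j k x = 0 := by
    rw [integral_finsetSum _ fun j _ => (Tst.sum fun k _ => hT j k).integrable]
    refine Finset.sum_eq_zero fun j _ => ?_
    rw [integral_finsetSum _ fun k _ => (hT j k).integrable]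
    exact Finset.sum_eq_zero fun k _ => hT0 j k
  have h1 := congrArg re h0
  have h2 : (∫ x, ∑ j, ∑ k, T j k x).re = ∫ x, (∑ j, ∑ k, T j k x).re :=
    (reCLM.integral_comp_comm hS.integrable).symm
  rw [h2, zero_re] at h1
  rw [← h1]
  congr 1; ext x
  have hsq : ∀ a : ℂ, ‖a‖ ^ 2 = (a * star a).re := by
    intro a
    have : a * star a = ((‖a‖ ^ 2 : ℝ) : ℂ) := by
      have := mul_conj' a; simpa using this
    rw [this, ofReal_re]
  have hre : ∀ a : ℂ, (a * ew Φ x).re = a.re * eX (-Φ x) := by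
    intro a; rw [ew, re_mul_ofReal]
  have e : ∑ j, ∑ k, T j k x = ((∑ j, del Φ j (b j) x) * star (∑ j, del Φ j (b j) x) -
      ∑ j, ∑ k, wd I k (b j) x * star (wd I j (b k) x) -
      ∑ j, ∑ k, b j x * star (wm k (wd I j (cx Φ)) x * b k x)) * ew Φ x := by
    rw [star_sum, Finset.sum_mul_sum]
    simp only [T, Finset.sum_sub_distrib, sub_mul, Finset.sum_mul]
  rw [e, hre, sub_re, sub_re, ← hsq]
  congr 1
  have e1 : levi Φ x (fun j => b j x) =
      (∑ j, ∑ k, b j x * star (wm k (wd I j (cx Φ)) x * b k x)).re := by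
    rw [levi, ← conj_re]
    congr 1
    simp only [map_sum]
    refine Finset.sum_congr rfl fun j _ => Finset.sum_congr rfl fun k _ => ?_
    simp; ring
  rw [← e1]
  have e2 : (∑ j, ∑ k, wd I k (b j) x * star (wd I j (b k) x)).re =
      ∑ j, ∑ k, ‖wd I j (b k) x‖ ^ 2 -
        (1 / 2) * ∑ j, ∑ k, ‖wd I j (b k) x - wd I k (b j) x‖ ^ 2 := by
    have e3 : ∀ j k, ‖wd I j (b k) x - wd I k (b j) x‖ ^ 2 = ‖wd I j (b k) x‖ ^ 2 +
      ‖wd I k (b j) x‖ ^ 2 - 2 * (wd I k (b j) x * star (wd I j (b k) x)).re := by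
      intro j k
      simp only [← normSq_eq_norm_sq, normSq_apply]; simp; ring
    simp only [e3, Finset.sum_add_distrib, Finset.sum_sub_distrib]
    rw [Finset.sum_comm (f := fun j k => ‖wd I k (b j) x‖ ^ 2)]
    simp only [← Finset.mul_sum, re_sum]; ring
  rw [e2]; ring
end

noncomputable def nu {n : ℕ} (Φ : Cn n → ℝ) : Measure (Cn n) :=
  volume.withDensity fun z => oR (eX (-Φ z))

section
variable {n : ℕ} {Φ : Cn n → ℝ}

lemma nu_lint (hΦ : Measurable Φ) (F : Cn n → ℝ≥0∞) :
    ∫⁻ z, F z ∂(nu Φ) = ∫⁻ z, oR (eX (-Φ z)) * F z := by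
  have hm : Measurable fun z => oR (eX (-Φ z)) := by fun_prop
  rw [nu, lintegral_withDensity_eq_lintegral_mul_non_measurable _ hm
    (Eventually.of_forall fun x => ENNReal.ofReal_lt_top)]
  rfl

lemma levi_cont (h : ContDiff ℝ ∞ Φ) {b : Fin n → Fc n} (hb : ∀ j, Continuous (b j)) :
    Continuous fun z => levi Φ z (fun j => b j z) := by
  unfold levi
  refine continuous_re.comp (continuous_finsetSum _ fun j _ => continuous_finsetSum _ fun k _ => ?_)
  exact ((wd_smooth (wd_smooth (cx_smooth h))).continuous.mul (hb k)).mul (hb j).star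

lemma ofReal_sq (a : ℂ) : oR (‖a‖ ^ 2) = ‖a‖ₑ ^ 2 := by
  rw [ENNReal.ofReal_pow (norm_nonneg _), ofReal_norm]

theorem bochner_l (h : ContDiff ℝ ∞ Φ) {b : Fin n → Fc n} (hb : ∀ j, Tst univ (b j))
    (hl : ∀ z, 0 ≤ levi Φ z (fun j => b j z)) :
    ∫⁻ z, oR (levi Φ z (fun j => b j z)) ∂(nu Φ) ≤
      ∫⁻ z, ‖∑ j, del Φ j (b j) z‖ₑ ^ 2 ∂(nu Φ) +
      ∑ j, ∑ k, ∫⁻ z, ‖wd I j (b k) z - wd I k (b j) z‖ₑ ^ 2 ∂(nu Φ) := by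
  have hΦc := h.continuous
  have hE : Continuous fun z => eX (-Φ z) := by fun_prop
  let K : Set (Cn n) := ⋃ j, tsupport (b j)
  have hK : IsCompact K := isCompact_iUnion fun j => (hb j).cp
  have hout : ∀ z ∉ K, ∀ j, b j z = 0 ∧ (∀ c k, wd c k (b j) z = 0) ∧ del Φ j (b j) z = 0 := by
    intro z hz j
    have hz' : z ∉ tsupport (b j) := fun h => hz (mem_iUnion.2 ⟨j, h⟩)
    have h1 := image_eq_zero_of_notMem_tsupport hz'
    have h2 : ∀ c k, wd c k (b j) z = 0 := fun c k =>
      image_eq_zero_of_notMem_tsupport fun h => hz' (wd_support h)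
    exact ⟨h1, h2, by simp [del, h1, h2]⟩
  have hint : ∀ F : Cn n → ℝ, Continuous F → (∀ z ∉ K, F z = 0) →
      Integrable fun z => F z * eX (-Φ z) := fun F hF h0 =>
    (hF.mul hE).integrable_of_hasCompactSupport (HasCompactSupport.intro hK fun z hz => by simp [h0 z hz])
  have cw : ∀ c j k, Continuous (wd c j (b k)) := fun c j k => (wd_smooth (hb k).sm).continuous
  have cd : ∀ j, Continuous (del Φ j (b j)) := fun j => (del_tst h (hb j)).sm.continuous
  have hP := hint (fun z => ‖∑ j, del Φ j (b j) z‖ ^ 2 +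
      ∑ j, ∑ k, ‖wd I j (b k) z - wd I k (b j) z‖ ^ 2) fP (fun z hz => by
        simp [(hout z hz _).2])
  have hP' := hint (fun z => ‖∑ j, del Φ j (b j) z‖ ^ 2 + (1/2) *
      ∑ j, ∑ k, ‖wd I j (b k) z - wd I k (b j) z‖ ^ 2) fP (fun z hz => by
        simp [(hout z hz _).2])
  have hQ := hint (fun z => ∑ j, ∑ k, ‖wd I j (b k) z‖ ^ 2) fP (fun z hz => by
        simp [(hout z hz _).2])
  have hL := hint (fun z => levi Φ z (fun j => b j z)) (levi_cont h fun j => (hb j).sm.continuous)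
    (fun z hz => by simp [levi, (hout z hz _).1])
  have key := bochner h hb
  simp only [sub_mul] at key
  replace key := (integral_sub (hP'.sub hQ) hL).symm.trans key
  rw [integral_sub' hP' hQ] at key
  have hQ0 : 0 ≤ ∫ z, (∑ j, ∑ k, ‖wd I j (b k) z‖ ^ 2) * eX (-Φ z) :=
    integral_nonneg fun z => by positivity
  have hPP : ∫ z, (‖∑ j, del Φ j (b j) z‖ ^ 2 + (1/2) *
      ∑ j, ∑ k, ‖wd I j (b k) z - wd I k (b j) z‖ ^ 2) * eX (-Φ z) ≤
      ∫ z, (‖∑ j, del Φ j (b j) z‖ ^ 2 +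
      ∑ j, ∑ k, ‖wd I j (b k) z - wd I k (b j) z‖ ^ 2) * eX (-Φ z) := by
    refine integral_mono hP' hP fun z => mul_le_mul_of_nonneg_right ?_ (Real.exp_pos _).le
    have : 0 ≤ ∑ j, ∑ k, ‖wd I j (b k) z - wd I k (b j) z‖ ^ 2 := by positivity
    linarith
  have fin : ∫ z, levi Φ z (fun j => b j z) * eX (-Φ z) ≤
      ∫ z, (‖∑ j, del Φ j (b j) z‖ ^ 2 +
      ∑ j, ∑ k, ‖wd I j (b k) z - wd I k (b j) z‖ ^ 2) * eX (-Φ z) := by linarith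
  have fin2 := ENNReal.ofReal_le_ofReal fin
  rw [ofReal_integral_eq_lintegral_ofReal hL (Eventually.of_forall fun z =>
      mul_nonneg (hl z) (Real.exp_pos _).le), ofReal_integral_eq_lintegral_ofReal hP
      (Eventually.of_forall fun z => by positivity)] at fin2
  simp only [nu_lint hΦc.measurable]
  have e : ∀ F : Fc n, Continuous F →
    Measurable fun z => oR (eX (-Φ z)) * ‖F z‖ₑ ^ 2 := fun F hF => by
      have := hE.measurable
      have := hF.measurable
      fun_prop
  have cc : ∀ j k, Continuous fun z => wd I j (b k) z - wd I k (b j) z := fun j k => by fun_prop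
  have eS : ∀ j, ∑ k, ∫⁻ z, oR (eX (-Φ z)) * ‖wd I j (b k) z - wd I k (b j) z‖ₑ ^ 2
      = ∫⁻ z, ∑ k, oR (eX (-Φ z)) * ‖wd I j (b k) z - wd I k (b j) z‖ₑ ^ 2 :=
    fun j => (lintegral_finsetSum _ fun k _ => e _ (cc j k)).symm
  have cS : Continuous fun z => ∑ j, del Φ j (b j) z := by fun_prop
  simp_rw [eS]
  rw [← lintegral_finsetSum _ fun j _ => Finset.measurable_sum _ fun k _ => e _ (cc j k),
    ← lintegral_add_left (e _ cS)]
  refine le_trans (le_of_eq ?_) (fin2.trans (le_of_eq ?_))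
  · refine lintegral_congr fun z => ?_
    rw [mul_comm, ENNReal.ofReal_mul (hl z)]
  · refine lintegral_congr fun z => ?_
    rw [mul_comm, ENNReal.ofReal_mul (Real.exp_pos _).le, ENNReal.ofReal_add pS pS,
      ENNReal.ofReal_sum_of_nonneg (fun _ _ => by positivity), mul_add, Finset.mul_sum]
    simp_rw [ENNReal.ofReal_sum_of_nonneg (fun k (_ : k ∈ Finset.univ) => sq_nonneg _), ofReal_sq, Finset.mul_sum]
end

section
variable {n : ℕ} {Φ : Cn n → ℝ}

lemma nu_ac : nu Φ ≪ volume := withDensity_absolutelyContinuous _ _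

lemma nu_lim {C : ℝ} (hC : ∀ z, eX (-Φ z) ≤ C) {F : ℕ → Fc n} {G : Fc n}
    (hF : ∀ m, AEStronglyMeasurable (F m)) (hG : AEStronglyMeasurable G)
    (h : Tendsto (fun m => eLpNorm (F m - G) 2 volume) atTop (𝓝 0)) :
    ∃ u : ℕ → ℝ≥0∞, (∀ m, ∫⁻ z, ‖F m z‖ₑ ^ 2 ∂(nu Φ) ≤ u m) ∧
      Tendsto u atTop (𝓝 (∫⁻ z, ‖G z‖ₑ ^ 2 ∂(nu Φ))) := by
  have hle : nu Φ ≤ oR C • volume := by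
    rw [← withDensity_const]
    exact withDensity_mono (Eventually.of_forall fun z => ENNReal.ofReal_le_ofReal (hC z))
  refine ⟨fun m => (eLpNorm G 2 (nu Φ) + oR C ^ (1 / (2:ℝ≥0∞)).toReal *
    eLpNorm (F m - G) 2 volume) ^ 2, fun m => ?_, ?_⟩
  · rw [← eLp2]
    refine pow_le_pow_left' ?_ 2
    have e : F m = G + (F m - G) := by abel
    conv_lhs => rw [e]
    refine (eLpNorm_add_le (hG.mono_ac nu_ac) (((hF m).sub hG).mono_ac nu_ac) nN).trans ?_
    gcongr
    refine (eLpNorm_mono_measure _ hle).trans ?_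
    rw [eLpNorm_smul_measure_of_ne_top sM]; simp
  · rw [← eLp2]
    have := (ENNReal.Tendsto.const_mul h (a := oR C ^ (1 / (2:ℝ≥0∞)).toReal)
      (Or.inr (by finiteness))).const_add (eLpNorm G 2 (nu Φ))
    rw [mul_zero, add_zero] at this
    exact ((ENNReal.continuous_pow 2).tendsto _).comp this

lemma tst_bdd {U : Set (Cn n)} {f : Fc n} (h : Tst U f) : ∃ C : ℝ, ∀ z, ‖f z‖ ≤ C :=
  h.cp.exists_bound_of_continuous h.sm.continuous

theorem bochner_w (hΦ : Tst univ (cx Φ)) (hs : ContDiff ℝ ∞ Φ) {K V : Set (Cn n)} (hK : IsCompact K)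
    (hV : IsOpen V) (hKV : K ⊆ V) (hl : ∀ z ∈ V, ∀ ξ, 0 ≤ levi Φ z ξ)
    {B : Fin n → Fc n} {h : Fc n} {c : Fin n → Fin n → Fc n}
    (hB : ∀ j, MemLp (B j) 2) (hB0 : ∀ j, ∀ z ∉ K, B j z = 0) (hh : MemLp h 2)
    (hc : ∀ j k, MemLp (c j k) 2)
    (h1 : ∀ η, Tst univ η → ∑ j, ∫ x, B j x * wm j η x = - ∫ x, h x * η x)
    (h2 : ∀ η, Tst univ η → ∀ j k, (∫ x, B k x * wd I j η x) - ∫ x, B j x * wd I k η x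
      = - ∫ x, c j k x * η x) :
    ∫⁻ z, oR (levi Φ z (fun j => B j z)) ∂(nu Φ) ≤
      ∫⁻ z, ‖h z - ∑ j, wm j (cx Φ) z * B j z‖ₑ ^ 2 ∂(nu Φ) +
      ∑ j, ∑ k, ∫⁻ z, ‖c j k z‖ₑ ^ 2 ∂(nu Φ) := by
  have hli : ∀ {u : Fc n}, MemLp u 2 → LocallyIntegrable u := fun hu =>
    hu.locallyIntegrable nN
  obtain ⟨δ, hδ, hδV⟩ := hK.exists_thickening_subset_open hV hKV
  have hsup : ∀ (m : ℕ) j, ∀ x ∉ thickening (1 / ((m:ℝ) + 1)) K, moll m (B j) x = 0 := by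
    intro m j x hx
    rw [moll_apply]
    refine integral_eq_zero_of_ae (Eventually.of_forall fun y => ?_)
    by_cases hy : y ∈ K
    · have : x - y ∉ Function.support (rho n m) := by
        rw [rho_supp, mem_ball_zero_iff, ← dist_eq_norm]
        exact fun hxy => hx (mem_thickening_iff.2 ⟨y, hy, hxy⟩)
      simp [Function.notMem_support.1 this]
    · simp [hB0 j y hy]
  have hT : ∀ m j, Tst univ (moll m (B j)) := fun m j => ⟨moll_smooth m (hli (hB j)), by
    refine HasCompactSupport.intro (hK.cthickening (r := 1 / ((m:ℝ) + 1))) fun x hx => hsup m j x ?_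
    exact fun h => hx (thickening_subset_cthickening _ _ h), subset_univ _⟩
  have hρ : ∀ m x, Tst univ (fun y => (rho n m (x - y) : ℂ)) := fun m x => rho_tst m x (subset_univ _)
  have hmr : ∀ m (u : Fc n) x, ∫ y, u y * (rho n m (x - y) : ℂ) = moll m u x := by
    intro m u x; rw [moll_apply]; congr 1; ext y; simp [mul_comm]
  have e1 : ∀ m z, ∑ j, del Φ j (moll m (B j)) z =
      moll m h z - ∑ j, wm j (cx Φ) z * moll m (B j) z := by
    intro m z
    simp only [del, Finset.sum_sub_distrib]
    congr 1
    have := h1 _ (hρ m z)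
    simp only [wd_moll m (hli (hB _)), Finset.sum_neg_distrib, this, neg_neg, hmr]
  have e2 : ∀ m z j k, wd I j (moll m (B k)) z - wd I k (moll m (B j)) z = moll m (c j k) z := by
    intro m z j k
    have := h2 _ (hρ m z) j k
    rw [hmr] at this
    rw [wd_moll m (hli (hB _)), wd_moll m (hli (hB _))]
    linear_combination - this
  obtain ⟨C, hC⟩ := tst_bdd hΦ
  have hCe : ∀ z, eX (-Φ z) ≤ eX C := fun z => Real.exp_le_exp.2 (by
    have := hC z
    simp only [cx, norm_real, Real.norm_eq_abs] at this
    linarith [neg_abs_le (Φ z)])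
  choose D hD using fun j => tst_bdd (hΦ.wd (-I) j)
  have hmm : ∀ m (u : Fc n), MemLp u 2 → AEStronglyMeasurable (moll m u) := fun m u hu =>
    (moll_smooth m (hli hu)).continuous.aestronglyMeasurable
  have hwm : ∀ j, AEStronglyMeasurable (wm j (cx Φ)) := fun j =>
    (hΦ.wd (-I) j).sm.continuous.aestronglyMeasurable
  have hsm : ∀ (u : Fin n → Fc n), (∀ j, AEStronglyMeasurable (u j)) →
      AEStronglyMeasurable (fun z => ∑ j, wm j (cx Φ) z * u j z) := fun u hu =>
    Finset.aestronglyMeasurable_fun_sum _ fun j _ => (hwm j).mul (hu j)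
  obtain ⟨u, hu, hul⟩ := nu_lim (Φ := Φ) hCe
    (F := fun m z => moll m h z - ∑ j, wm j (cx Φ) z * moll m (B j) z)
    (G := fun z => h z - ∑ j, wm j (cx Φ) z * B j z)
    (fun m => (hmm m h hh).sub (hsm _ fun j => hmm m _ (hB j))) (hh.1.sub (hsm _ fun j => (hB j).1)) (by
      have hb : Tendsto (fun m => eLpNorm (moll m h - h) 2 volume +
          ∑ j, oR (D j) * eLpNorm (moll m (B j) - B j) 2 volume) atTop (𝓝 0) := by
        have := (moll_L2 hh).add (tendsto_finsetSum Finset.univ fun j _ =>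
          ENNReal.Tendsto.const_mul (moll_L2 (hB j)) (a := oR (D j)) (Or.inr sM))
        simpa using this
      refine tendsto_of_tendsto_of_tendsto_of_le_of_le tendsto_const_nhds hb (fun _ => zero_le) fun m => ?_
      have e : ((fun z => moll m h z - ∑ j, wm j (cx Φ) z * moll m (B j) z) -
          fun z => h z - ∑ j, wm j (cx Φ) z * B j z) =
          (moll m h - h) - ∑ j, (wm j (cx Φ) * (moll m (B j) - B j)) := by
        ext z
        simp only [Pi.sub_apply, Finset.sum_apply, Pi.mul_apply, mul_sub, Finset.sum_sub_distrib]; ring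
      rw [e]
      have hms : ∀ j, AEStronglyMeasurable (wm j (cx Φ) * (moll m (B j) - B j)) := fun j =>
        (hwm j).mul ((hmm m _ (hB j)).sub (hB j).1)
      refine (eLpNorm_sub_le ((hmm m h hh).sub hh.1)
        (Finset.aestronglyMeasurable_sum _ fun j _ => hms j) nN).trans ?_
      gcongr
      refine (eLpNorm_sum_le (fun j _ => hms j) nN).trans ?_
      gcongr with j
      refine eLpNorm_le_mul_eLpNorm_of_ae_le_mul (Eventually.of_forall fun z => ?_) _
      rw [Pi.mul_apply, norm_mul]
      exact mul_le_mul_of_nonneg_right (hD j z) (norm_nonneg _))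
  have hv := fun j k => nu_lim (Φ := Φ) hCe (fun m => hmm m _ (hc j k)) (hc j k).1 (moll_L2 (hc j k))
  choose v hv hvl using hv
  have hlim : Tendsto (fun m => u m + ∑ j, ∑ k, v j k m) atTop (𝓝 _) :=
    hul.add (tendsto_finsetSum Finset.univ fun j _ => tendsto_finsetSum Finset.univ fun k _ => hvl j k)
  obtain ⟨N, hN⟩ := exists_nat_one_div_lt hδ
  have hle : ∀ m ≥ N, ∫⁻ z, oR (levi Φ z (fun j => moll m (B j) z)) ∂(nu Φ) ≤
      u m + ∑ j, ∑ k, v j k m := by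
    intro m hm
    refine (bochner_l hs (hT m) fun z => ?_).trans ?_
    · by_cases hz : z ∈ V
      · exact hl z hz _
      · have : ∀ j, moll m (B j) z = 0 := fun j => hsup m j z fun h => hz (hδV (thickening_mono ?_ _ h))
        · simp [levi, this]
        · refine le_trans ?_ hN.le
          exact one_div_le_one_div_of_le pS (by exact_mod_cast by omega)
    · simp only [e1, e2]
      exact add_le_add (hu m) (Finset.sum_le_sum fun j _ => Finset.sum_le_sum fun k _ => hv j k m)
  have hae : ∀ᵐ z ∂(nu Φ), ∀ j, Tendsto (fun m => moll m (B j) z) atTop (𝓝 (B j z)) :=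
    ae_all_iff.2 fun j => nu_ac.ae_le (moll_ae (hli (hB j)))
  have hlv : ∀ᵐ z ∂(nu Φ), oR (levi Φ z (fun j => B j z)) =
      liminf (fun m => oR (levi Φ z (fun j => moll m (B j) z))) atTop := by
    filter_upwards [hae] with z hz
    refine (Tendsto.liminf_eq ?_).symm
    refine (ENNReal.continuous_ofReal.tendsto _).comp ((continuous_re.tendsto _).comp ?_)
    refine tendsto_finsetSum _ fun j _ => tendsto_finsetSum _ fun k _ => ?_
    exact ((hz k).const_mul _).mul ((continuous_star.tendsto _).comp (hz j))
  rw [lintegral_congr_ae hlv]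
  refine (lintegral_liminf_le fun m => ?_).trans ?_
  · exact (ENNReal.continuous_ofReal.comp (levi_cont hs fun j => (hT m j).sm.continuous)).measurable
  · rw [← hlim.liminf_eq]
    refine liminf_le_liminf ?_
    filter_upwards [eventually_ge_atTop N] with m hm using hle m hm
end

section
variable {n : ℕ} {Ω : Set (Cn n)} {Φ ψ χ : Cn n → ℝ}

lemma exists_bump {K : Set (Cn n)} (hK : IsCompact K) (hΩ : IsOpen Ω) (h : K ⊆ Ω) :
    ∃ χ : Cn n → ℝ, ContDiff ℝ ∞ χ ∧ Tst Ω (cx χ) ∧ (∀ z, χ z ∈ Icc (0:ℝ) 1) ∧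
      ∃ V, IsOpen V ∧ K ⊆ V ∧ V ⊆ Ω ∧ ∀ z ∈ V, χ z = 1 := by
  obtain ⟨K', hK', h1, h2⟩ := exists_compact_between hK hΩ h
  obtain ⟨f, f1, f2, f3⟩ := exists_contMDiffMap_one_nhds_of_subset_interior
    (n := (⊤ : ℕ∞)) (modelWithCornersSelf ℝ (Cn n)) hK.isClosed h1
  obtain ⟨V, hV, hKV, hVf⟩ := mem_nhdsSet_iff_exists.1 f1
  have hs : ContDiff ℝ ∞ (f : Cn n → ℝ) := f.contMDiff.contDiff
  have hts : tsupport (cx f) ⊆ K' := by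
    refine closure_minimal (fun x hx => ?_) hK'.isClosed
    by_contra hx'; exact hx (by simp [cx, f2 x hx'])
  refine ⟨f, hs, ⟨cx_smooth hs, hK'.of_isClosed_subset (isClosed_tsupport _) hts, hts.trans h2⟩, f3,
    V ∩ Ω, hV.inter hΩ, subset_inter hKV h, inter_subset_right, fun z hz => hVf hz.1⟩

lemma wd_cx_sub {c : ℂ} {j : Fin n} {z : Cn n} (h1 : DifferentiableAt ℝ Φ z) (h2 : DifferentiableAt ℝ ψ z) :
    wd c j (cx fun x => Φ x - ψ x) z = wd c j (cx Φ) z - wd c j (cx ψ) z := by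
  have e : (cx fun x => Φ x - ψ x) = fun x => cx Φ x - cx ψ x := by ext x; simp [cx]
  rw [e]
  exact wd_sub (ofRealCLM.differentiableAt.comp z h1) (ofRealCLM.differentiableAt.comp z h2)

lemma levi_congr {Φ' : Cn n → ℝ} {z : Cn n} (h : Φ =ᶠ[𝓝 z] Φ') (ξ : Cn n) : levi Φ z ξ = levi Φ' z ξ := by
  unfold levi
  have h1 : ∀ j, wd I j (cx Φ) =ᶠ[𝓝 z] wd I j (cx Φ') := fun j => by
    filter_upwards [h.eventuallyEq_nhds] with y hy
    exact wd_congr (hy.mono fun x hx => by simp [cx, hx])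
  simp only [wd_congr (h1 _)]

theorem kl_cut (hΩ : IsOpen Ω) (hΦ : ContDiffOn ℝ ∞ Φ Ω) (hψ : ContDiffOn ℝ ∞ ψ Ω)
    (mΦ : Measurable Φ) (hχ : Tst Ω (cx χ))
    (hl : ∀ z ∈ Ω, ∀ ξ, 0 ≤ levi Φ z ξ) {β : Fin n → Fc n} {g : Fc n}
    (hβ : ∀ j η, Tst Ω η → MemLp (fun x => η x * β j x) 2)
    (hg : ∀ η, Tst Ω η → MemLp (fun x => η x * g x) 2)
    (H1 : ∀ η, Tst Ω η → ∑ j, ∫ x, β j x * (eX (ψ x - Φ x) : ℂ) * wm j η x =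
      ∫ x, g x * (eX (2 * ψ x - Φ x) : ℂ) * η x)
    (H2 : ∀ η, Tst Ω η → ∀ j k, ∫ x, (β k x * wd I j η x - β j x * wd I k η x) = 0) :
    ∫⁻ z, oR (levi Φ z (fun j => χ z * β j z)) ∂(nu Φ) ≤
      ∫⁻ z, ‖g z * (eX (ψ z) : ℂ) * χ z - ∑ j, β j z *
        (wm j (cx χ) z - χ z * wm j (cx ψ) z)‖ₑ ^ 2 ∂(nu Φ) +
      ∑ j, ∑ k, ∫⁻ z, ‖β k z * wd I j (cx χ) z - β j z * wd I k (cx χ) z‖ₑ ^ 2 ∂(nu Φ) := by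
  obtain ⟨χ', hs', hχ', -, V, hV, hKV, hVΩ, hV1⟩ := exists_bump hχ.cp hΩ hχ.su
  set K := tsupport (cx χ)
  let Φ' : Cn n → ℝ := fun z => χ' z * Φ z
  have hcxs : ∀ {F : Cn n → ℝ}, ContDiffOn ℝ ∞ F Ω → ContDiffOn ℝ ∞ (cx F) Ω := fun hF =>
    ofRealCLM.contDiff.comp_contDiffOn hF
  have hT' : Tst univ (cx Φ') := by
    have := (hχ'.mul_smooth hΩ (hcxs hΦ)).mono (subset_univ _)
    convert this using 2
    simp [cx, Φ']
  have hs : ContDiff ℝ ∞ Φ' := by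
    exact reCLM.contDiff.comp hT'.sm
  have hgerm : ∀ z ∈ V, Φ' =ᶠ[𝓝 z] Φ := fun z hz => by
    filter_upwards [hV.mem_nhds hz] with y hy
    simp [Φ', hV1 y hy]
  have hd : ∀ {F : Cn n → ℝ}, ContDiffOn ℝ ∞ F Ω → ∀ z ∈ Ω, DifferentiableAt ℝ F z := fun hF z hz =>
    (hF.contDiffAt (hΩ.mem_nhds hz)).differentiableAt sM
  have hout : ∀ z ∉ K, χ z = 0 ∧ ∀ c j, wd c j (cx χ) z = 0 := fun z hz =>
    ⟨by simpa [cx] using image_eq_zero_of_notMem_tsupport hz,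
      fun c j => image_eq_zero_of_notMem_tsupport fun h => hz (wd_support h)⟩
  have hwc : ∀ c j {F : Cn n → ℝ}, ContDiffOn ℝ ∞ F Ω → ContDiffOn ℝ ∞ (wd c j (cx F)) Ω := by
    intro c j F hF
    have h : ∀ v, ContDiffOn ℝ ∞ (fun z => fderiv ℝ (cx F) z v) Ω := fun v =>
      ((hcxs hF).fderiv_of_isOpen hΩ (m := ∞) sM).clm_apply contDiffOn_const
    unfold wd
    exact contDiffOn_const.mul ((h _).add (contDiffOn_const.mul (h _)))
  have hE : ContDiffOn ℝ ∞ (fun x => eX (Φ x - ψ x)) Ω := (hΦ.sub hψ).exp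
  have hq : ContDiffOn ℝ ∞ (fun x => eX (ψ x)) Ω := hψ.exp
  have tχq : Tst Ω (fun x => cx χ x * cx (fun x => eX (ψ x)) x) := hχ.mul_smooth hΩ (hcxs hq)
  have tm : ∀ j, Tst Ω (fun x => wm j (cx χ) x + cx χ x *
      (wm j (cx Φ) x - wm j (cx ψ) x)) := fun j =>
    (hχ.wd _ _).add (hχ.mul_smooth hΩ ((hwc _ _ hΦ).sub (hwc _ _ hψ)))
  let h : Fc n := fun z => - (g z * (eX (ψ z) : ℂ) * χ z) + ∑ j, β j z *
    (wm j (cx χ) z + χ z * (wm j (cx Φ) z - wm j (cx ψ) z))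
  have mg : MemLp (fun z => g z * (eX (ψ z) : ℂ) * χ z) 2 := by
    have e : (fun z => g z * (eX (ψ z) : ℂ) * χ z) =
      fun x => cx χ x * cx (fun x => eX (ψ x)) x * g x := by ext z; simp only [cx]; ring
    rw [e]; exact hg _ tχq
  have mm : ∀ j, MemLp (fun z => β j z * (wm j (cx χ) z + χ z *
      (wm j (cx Φ) z - wm j (cx ψ) z))) 2 := fun j => by
    convert hβ j _ (tm j) using 2 with z; simp only [cx]; ring
  have mh : MemLp h 2 := mg.neg.add (memLp_finsetSum _ fun j _ => mm j)
  have mB : ∀ j, MemLp (fun z => χ z * β j z) 2 := fun j => hβ j _ hχ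
  have mc : ∀ j k, MemLp (fun z => β k z * wd I j (cx χ) z - β j z * wd I k (cx χ) z) 2 := fun j k => by
    convert (hβ k _ (hχ.wd I j)).sub (hβ j _ (hχ.wd I k)) using 2
    simp only [Pi.sub_apply]; ring
  have key := bochner_w hT' hs hχ.cp hV hKV (fun z hz ξ => by
      rw [levi_congr (hgerm z hz)]; exact hl z (hVΩ hz) ξ) (B := fun j z => χ z * β j z)
      (h := h) (c := fun j k z => β k z * wd I j (cx χ) z - β j z * wd I k (cx χ) z) mB
      (fun j z hz => by simp [(hout z hz).1]) mh mc ?_ ?_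
  · have hnu : ∀ F : Cn n → ℝ≥0∞, (∀ z ∉ K, F z = 0) → ∫⁻ z, F z ∂(nu Φ') = ∫⁻ z, F z ∂(nu Φ) := by
      intro F hF
      rw [nu_lint mΦ, nu_lint hs.continuous.measurable]
      refine lintegral_congr fun z => ?_
      by_cases hz : z ∈ K
      · rw [(hgerm z (hKV hz)).eq_of_nhds]
      · simp [hF z hz]
    rw [hnu _ fun z hz => by simp [levi, (hout z hz).1], hnu _ fun z hz => by simp [h, hout z hz]] at key
    have hnu' : ∀ j k, ∫⁻ z, ‖β k z * wd I j (cx χ) z - β j z * wd I k (cx χ) z‖ₑ ^ 2 ∂(nu Φ') =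
        ∫⁻ z, ‖β k z * wd I j (cx χ) z - β j z * wd I k (cx χ) z‖ₑ ^ 2 ∂(nu Φ) := fun j k =>
      hnu _ fun z hz => by simp [hout z hz]
    simp only [hnu'] at key
    refine le_trans (le_of_eq ?_) (key.trans (le_of_eq ?_))
    · refine lintegral_congr fun z => ?_
      by_cases hz : z ∈ K
      · rw [levi_congr (hgerm z (hKV hz))]
      · simp [levi, (hout z hz).1]
    · congr 1
      refine lintegral_congr fun z => ?_
      by_cases hz : z ∈ K
      · rw [← enorm_neg]
        congr 2
        have : ∀ j, wm j (cx Φ') z = wm j (cx Φ) z := fun j =>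
          wd_congr ((hgerm z (hKV hz)).mono fun x hx => by simp [cx, hx])
        simp only [h, this]
        rw [neg_sub, sub_eq_add_neg, neg_add, neg_neg, ← add_assoc, add_comm (∑ j, _), add_assoc, sub_eq_add_neg,
          ← Finset.sum_neg_distrib, ← Finset.sum_neg_distrib, ← Finset.sum_add_distrib]
        congr 1
        refine Finset.sum_congr rfl fun j _ => ?_
        ring
      · simp [h, hout z hz]
  · intro η hη
    have tη : Tst Ω (fun x => (cx χ x * cx (fun x => eX (Φ x - ψ x)) x) * η x) :=
      (hχ.mul_smooth hΩ (hcxs hE)).mul' hη.sm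
    have e := H1 _ tη
    have e1 : ∀ j z, β j z * (eX (ψ z - Φ z) : ℂ) * wm j (fun x => (cx χ x *
        cx (fun x => eX (Φ x - ψ x)) x) * η x) z = χ z * β j z * wm j η z +
        (β j z * (wm j (cx χ) z + χ z * (wm j (cx Φ) z - wm j (cx ψ) z))) * η z := by
      intro j z
      by_cases hz : z ∈ K
      · have hzΩ := hχ.su hz
        have dE := (hcxs hE).contDiffAt (hΩ.mem_nhds hzΩ) |>.differentiableAt sM
        have dχ := hχ.sm.differentiable sM z
        rw [wd_mul (dχ.fun_mul dE) (hη.sm.differentiable sM z), wd_mul dχ dE,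
          wd_real ((hd hΦ z hzΩ).fun_sub (hd hψ z hzΩ)) (Real.hasDerivAt_exp _),
          wd_cx_sub (hd hΦ z hzΩ) (hd hψ z hzΩ)]
        have hee : (eX (ψ z - Φ z) : ℂ) * (eX (Φ z - ψ z) : ℂ) = 1 := by
          rw [← ofReal_mul, ← Real.exp_add]; simp
        simp only [cx]
        linear_combination (β j z * (wm j (cx χ) z * η z + χ z * η z *
          (wm j (cx Φ) z - wm j (cx ψ) z) +
          χ z * wm j η z)) * hee
      · have : wm j (fun x => (cx χ x * cx (fun x => eX (Φ x - ψ x)) x) * η x) z = 0 := by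
          refine image_eq_zero_of_notMem_tsupport fun h => hz ?_
          refine closure_mono (fun x hx => ?_) (wd_support h)
          intro h0; exact hx (by simp [h0])
        rw [this]; simp [hout z hz]
    have e2 : ∀ z, g z * (eX (2 * ψ z - Φ z) : ℂ) * ((cx χ z *
        cx (fun x => eX (Φ x - ψ x)) z) * η z) = g z * (eX (ψ z) : ℂ) * χ z * η z := by
      intro z
      have hee : (eX (2 * ψ z - Φ z) : ℂ) * (eX (Φ z - ψ z) : ℂ) = (eX (ψ z) : ℂ) := by
        rw [← ofReal_mul, ← Real.exp_add]; congr 2; ring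
      simp only [cx]; rw [← hee]; ring
    simp only [e1, e2] at e
    have i1 : ∀ j, Integrable fun z => χ z * β j z * wm j η z := fun j =>
      (mB j).integrable_mul (hη.wd _ _).memLp
    have i2 : ∀ j, Integrable fun z => (β j z * (wm j (cx χ) z + χ z *
        (wm j (cx Φ) z - wm j (cx ψ) z))) * η z := fun j =>
      (mm j).integrable_mul hη.memLp
    have i3 : Integrable fun z => g z * (eX (ψ z) : ℂ) * χ z * η z := mg.integrable_mul hη.memLp
    have e3 : ∀ j, ∫ z, (χ z * β j z * wm j η z + (β j z * (wm j (cx χ) z + χ z *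
        (wm j (cx Φ) z - wm j (cx ψ) z))) * η z) = _ := fun j => integral_add (i1 j) (i2 j)
    simp only [e3, Finset.sum_add_distrib] at e
    have e4 : ∫ x, h x * η x = - (∫ z, g z * (eX (ψ z) : ℂ) * χ z * η z) + ∑ j, ∫ z, (β j z *
        (wm j (cx χ) z + χ z * (wm j (cx Φ) z - wm j (cx ψ) z))) * η z := by
      rw [← integral_neg, ← integral_finsetSum _ fun j _ => i2 j]
      refine Eq.trans ?_ (integral_add i3.neg (integrable_finsetSum _ fun j _ => i2 j))
      congr 1; ext z; simp only [h, add_mul, Finset.sum_mul]; ring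
    rw [e4]
    linear_combination e
  · intro η hη j k
    have e := H2 _ (hχ.mul' hη.sm) j k
    have i1 : ∀ j k, Integrable fun z => χ z * β k z * wd I j η z := fun j k =>
      (mB k).integrable_mul (hη.wd _ _).memLp
    have i2 := (mc j k).integrable_mul hη.memLp
    rw [← integral_sub (i1 j k) (i1 k j), ← integral_neg]
    rw [← sub_eq_zero, ← e]
    refine (integral_sub ((i1 j k).sub (i1 k j)) i2.neg).symm.trans ?_
    congr 1; ext z
    have dχ := hχ.sm.differentiable sM z
    have dη := hη.sm.differentiable sM z
    rw [wd_mul dχ dη, wd_mul dχ dη]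
    simp only [Pi.mul_apply, Pi.sub_apply, Pi.neg_apply, cx]; ring
end

section
variable {n : ℕ} {Ω : Set (Cn n)} {Φ ψ : Cn n → ℝ}

lemma cs_sum (a b : Fin n → ℂ) : ‖∑ j, a j * b j‖ ^ 2 ≤ (∑ j, ‖a j‖ ^ 2) * ∑ j, ‖b j‖ ^ 2 := by
  refine le_trans ?_ (Finset.sum_mul_sq_le_sq_mul_sq Finset.univ (fun j => ‖a j‖) fun j => ‖b j‖)
  gcongr
  refine (norm_sum_le _ _).trans (le_of_eq ?_)
  simp

lemma young {ε : ℝ} (hε : 0 < ε) (a b : ℂ) :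
    ‖a - b‖ ^ 2 ≤ (1 + ε) * ‖a‖ ^ 2 + (1 + 1 / ε) * ‖b‖ ^ 2 := by
  have h1 := norm_sub_le a b
  have h2 : ‖a - b‖ ^ 2 ≤ (‖a‖ + ‖b‖) ^ 2 := by gcongr
  have h3 : (1 + ε) * ‖a‖ ^ 2 + (1 + 1 / ε) * ‖b‖ ^ 2 - (‖a‖ + ‖b‖) ^ 2 =
      (ε * ‖a‖ - ‖b‖) ^ 2 / ε := by field_simp; ring
  have h4 : 0 ≤ (ε * ‖a‖ - ‖b‖) ^ 2 / ε := by positivity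
  linarith

lemma two_sq (a b : ℂ) : ‖a - b‖ ^ 2 ≤ 2 * ‖a‖ ^ 2 + 2 * ‖b‖ ^ 2 := by
  have := young one_pos a b; norm_num at this; linarith

lemma kl_pt {ε : ℝ} (hε : 0 < ε) (a : ℂ) (x : ℝ) (β u v : Fin n → ℂ) :
    ‖a - ∑ j, β j * (u j - x * v j)‖ ^ 2 ≤ (1 + ε) * ‖a‖ ^ 2 +
      (2 * (1 + 1 / ε) * (∑ j, ‖v j‖ ^ 2) * ∑ j, ‖(x : ℂ) * β j‖ ^ 2 +
      2 * (1 + 1 / ε) * (∑ j, ‖u j‖ ^ 2) * ∑ j, ‖β j‖ ^ 2) := by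
  refine (young hε _ _).trans ?_
  gcongr
  have h1 := cs_sum β (fun j => u j - x * v j)
  have h2 : ∑ j, ‖u j - x * v j‖ ^ 2 ≤ 2 * ∑ j, ‖u j‖ ^ 2 + 2 * (x ^ 2 * ∑ j, ‖v j‖ ^ 2) := by
    rw [Finset.mul_sum, Finset.mul_sum, Finset.mul_sum, ← Finset.sum_add_distrib]
    refine Finset.sum_le_sum fun j _ => (two_sq _ _).trans (le_of_eq ?_)
    rw [norm_mul, norm_real, mul_pow, Real.norm_eq_abs, sq_abs]
  have h3 : ∑ j, ‖(x : ℂ) * β j‖ ^ 2 = x ^ 2 * ∑ j, ‖β j‖ ^ 2 := by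
    rw [Finset.mul_sum]
    refine Finset.sum_congr rfl fun j _ => ?_
    rw [norm_mul, norm_real, mul_pow, Real.norm_eq_abs, sq_abs]
  rw [h3]
  have hb : 0 ≤ ∑ j, ‖β j‖ ^ 2 := by positivity
  have h4 := h1.trans (mul_le_mul_of_nonneg_left h2 hb)
  have h5 : 0 ≤ 1 + 1 / ε := by positivity
  calc _ ≤ (1 + 1 / ε) * _ := mul_le_mul_of_nonneg_left h4 h5
    _ = _ := by ring

lemma kl_pt2 (β u : Fin n → ℂ) : ∑ j, ∑ k, ‖β k * u j - β j * u k‖ ^ 2 ≤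
    4 * (∑ j, ‖u j‖ ^ 2) * ∑ j, ‖β j‖ ^ 2 := by
  have h : ∀ j k, ‖β k * u j - β j * u k‖ ^ 2 ≤ 2 * (‖u j‖ ^ 2 * ‖β k‖ ^ 2) +
      2 * (‖u k‖ ^ 2 * ‖β j‖ ^ 2) := fun j k => (two_sq _ _).trans (le_of_eq (by
        rw [norm_mul, norm_mul]; ring))
  refine (Finset.sum_le_sum fun j _ => Finset.sum_le_sum fun k _ => h j k).trans (le_of_eq ?_)
  simp only [Finset.sum_add_distrib, ← Finset.mul_sum]
  rw [Finset.sum_comm (f := fun j k => ‖u k‖ ^ 2 * ‖β j‖ ^ 2)]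
  simp only [← Finset.mul_sum, ← Finset.sum_mul]; ring

lemma lint_supp {μ : Measure (Cn n)} (hΩ : MeasurableSet Ω) {F : Cn n → ℝ≥0∞} (h : ∀ z ∉ Ω, F z = 0) :
    ∫⁻ z, F z ∂μ = ∫⁻ z in Ω, F z ∂μ := by
  rw [← lintegral_indicator hΩ]
  congr 1; ext z
  by_cases hz : z ∈ Ω <;> simp [hz, h z]

theorem kl (hΩ : IsOpen Ω) (hΦ : ContDiffOn ℝ ∞ Φ Ω) (hψ : ContDiffOn ℝ ∞ ψ Ω)
    (mΦ : Measurable Φ) (mψ : Measurable ψ) {χ : ℕ → Cn n → ℝ} (hχ : ∀ N, Tst Ω (cx (χ N)))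
    (hχ1 : ∀ N z, χ N z ∈ Icc (0:ℝ) 1) {C0 : ℝ}
    (hχ2 : ∀ N, ∀ z ∈ Ω, ∑ j, ‖wm j (cx (χ N)) z‖ ^ 2 + ∑ j, ‖wd I j (cx (χ N)) z‖ ^ 2 ≤
      C0 * eX (ψ z))
    (hχ3 : ∀ z ∈ Ω, ∀ᶠ N in atTop, χ N z = 1 ∧ ∀ c j, wd c j (cx (χ N)) z = 0)
    {ε : ℝ} (hε : 0 < ε) {A : Cn n → Cn n → ℝ} (hA0 : ∀ z ∈ Ω, ∀ ξ, 0 ≤ A z ξ)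
    (hA : ∀ z ∈ Ω, ∀ ξ, A z ξ + 2 * (1 + 1 / ε) * (∑ j, ‖wm j (cx ψ) z‖ ^ 2) * ∑ j, ‖ξ j‖ ^ 2
      ≤ levi Φ z ξ)
    (hAm : ∀ b : Fin n → Fc n, (∀ j, Measurable (b j)) → Measurable fun z => A z fun j => b j z)
    {β : Fin n → Fc n} {g : Fc n} (mβ : ∀ j, Measurable (β j)) (mg : Measurable g)
    (hβ : ∀ j η, Tst Ω η → MemLp (fun x => η x * β j x) 2)
    (hg : ∀ η, Tst Ω η → MemLp (fun x => η x * g x) 2)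
    (hβ2 : ∫⁻ z in Ω, oR (eX (ψ z - Φ z) * ∑ j, ‖β j z‖ ^ 2) ≠ ⊤)
    (H1 : ∀ η, Tst Ω η → ∑ j, ∫ x, β j x * (eX (ψ x - Φ x) : ℂ) * wm j η x =
      ∫ x, g x * (eX (2 * ψ x - Φ x) : ℂ) * η x)
    (H2 : ∀ η, Tst Ω η → ∀ j k, ∫ x, (β k x * wd I j η x - β j x * wd I k η x) = 0) :
    ∫⁻ z in Ω, oR (eX (-Φ z) * A z (fun j => β j z)) ≤
      oR (1 + ε) *
        ∫⁻ z in Ω, oR (eX (2 * ψ z - Φ z) * ‖g z‖ ^ 2) := by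
  have hl : ∀ z ∈ Ω, ∀ ξ, 0 ≤ levi Φ z ξ := fun z hz ξ => by
    refine le_trans ?_ (hA z hz ξ)
    have := hA0 z hz ξ
    positivity
  set k1 := 2 * (1 + 1 / ε) with hk1
  have hk1p : 0 < k1 := by positivity
  set μ := (volume : Measure (Cn n)).restrict Ω
  have mΩ := hΩ.measurableSet
  have step : ∀ N, ∫⁻ z in Ω, oR (eX (-Φ z) * A z (fun j => χ N z * β j z)) ≤
      oR (1 + ε) *
        (∫⁻ z in Ω, oR (eX (2 * ψ z - Φ z) * ‖g z‖ ^ 2)) +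
      oR (k1 + 4) * ∫⁻ z in Ω, oR (eX (-Φ z) *
        ((∑ j, ‖wm j (cx (χ N)) z‖ ^ 2 + ∑ j, ‖wd I j (cx (χ N)) z‖ ^ 2) * ∑ j, ‖β j z‖ ^ 2)) := by
    intro N
    have key := kl_cut hΩ hΦ hψ mΦ (hχ N) hl hβ hg H1 H2
    set x := χ N
    have hx0 : ∀ z ∉ Ω, x z = 0 ∧ ∀ c j, wd c j (cx x) z = 0 := fun z hz =>
      ⟨by simpa [cx] using image_eq_zero_of_notMem_tsupport fun h => hz ((hχ N).su h),
      fun c j => image_eq_zero_of_notMem_tsupport fun h => hz ((hχ N).su (wd_support h))⟩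
    have mx : Measurable x := by
      have := (hχ N).sm.continuous.measurable
      exact measurable_re.comp this
    have mwx : ∀ c j, Measurable (wd c j (cx x)) := fun c j => ((hχ N).wd c j).sm.continuous.measurable
    have mwψ : ∀ c j, Measurable (wd c j (cx ψ)) := fun c j => by
      unfold wd
      exact ((measurable_fderiv_apply_const ℝ _ _).add ((measurable_fderiv_apply_const ℝ _ _).const_mul c)).const_mul _
    let T : Cn n → ℝ := fun z => k1 * (∑ j, ‖wm j (cx ψ) z‖ ^ 2) * ∑ j, ‖(x z : ℂ) * β j z‖ ^ 2
    have mT : Measurable T := by fun_prop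
    have mA : Measurable fun z => A z (fun j => x z * β j z) := hAm (fun j z => x z * β j z) fun j => by fun_prop
    have hTfin : ∫⁻ z in Ω, oR (eX (-Φ z) * T z) ≠ ⊤ := by
      have ht : ∀ i j, MemLp (fun z => (x z * (eX (-Φ z / 2) : ℂ) * wm j (cx ψ) z) * β i z) 2 := by
        intro i j
        refine hβ i _ ?_
        refine Tst.mul_smooth (f := fun z => x z * (eX (-Φ z / 2) : ℂ)) (Tst.mul_smooth (hχ N) hΩ ?_) hΩ ?_
        · exact ofRealCLM.contDiff.comp_contDiffOn (hΦ.neg.div_const 2).exp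
        · have h : ∀ v, ContDiffOn ℝ ∞ (fun z => fderiv ℝ (cx ψ) z v) Ω := fun v =>
            ((ofRealCLM.contDiff.comp_contDiffOn hψ).fderiv_of_isOpen hΩ (m := ∞) sM).clm_apply contDiffOn_const
          unfold wd
          exact contDiffOn_const.mul ((h _).add (contDiffOn_const.mul (h _)))
      have hpt : ∀ z, oR (eX (-Φ z) * T z) = oR k1 * ∑ j, ∑ i,
          ‖(x z * (eX (-Φ z / 2) : ℂ) * wm j (cx ψ) z) * β i z‖ₑ ^ 2 := by
        intro z
        simp only [← ofReal_sq]
        simp_rw [← ENNReal.ofReal_sum_of_nonneg (fun i (_ : i ∈ Finset.univ) => sq_nonneg _)]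
        rw [← ENNReal.ofReal_sum_of_nonneg (fun _ _ => by positivity), ← ENNReal.ofReal_mul hk1p.le]
        congr 1
        have he : eX (-Φ z) = eX (-Φ z / 2) ^ 2 := by rw [← Real.exp_nat_mul]; congr 1; push_cast; ring
        simp only [T, norm_mul, mul_pow, norm_real, Real.norm_eq_abs, sq_abs, he, ← Finset.mul_sum, ← Finset.sum_mul]
        ring
      simp only [hpt]
      rw [lintegral_const_mul' _ _ sM]
      refine ENNReal.mul_ne_top sM ?_
      have mm : ∀ j i, Measurable fun z => ‖(x z * (eX (-Φ z / 2) : ℂ) * wm j (cx ψ) z) * β i z‖ₑ ^ 2 :=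
        fun j i => by fun_prop
      rw [lintegral_finsetSum _ fun j _ => Finset.measurable_sum _ fun i _ => mm j i]
      refine ENNReal.sum_ne_top.2 fun j _ => ?_
      rw [lintegral_finsetSum _ fun i _ => mm j i]
      refine ENNReal.sum_ne_top.2 fun i _ => ne_top_of_le_ne_top ?_ (setLIntegral_le_lintegral _ _)
      rw [← eLp2]
      exact ENNReal.pow_ne_top (ht i j).2.ne
    have hlow : (∫⁻ z in Ω, oR (eX (-Φ z) * A z (fun j => x z * β j z))) +
        ∫⁻ z in Ω, oR (eX (-Φ z) * T z) ≤
        ∫⁻ z, oR (levi Φ z (fun j => x z * β j z)) ∂(nu Φ) := by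
      rw [← lintegral_add_right _ fP, nu_lint mΦ]
      refine le_trans ?_ (setLIntegral_le_lintegral Ω _)
      refine setLIntegral_mono' mΩ fun z hz => ?_
      have h1 := hA z hz (fun j => x z * β j z)
      have h2 := hA0 z hz (fun j => x z * β j z)
      rw [← ENNReal.ofReal_add pS pS, ← ENNReal.ofReal_mul (Real.exp_pos _).le, ← mul_add]
      exact ENNReal.ofReal_le_ofReal (mul_le_mul_of_nonneg_left h1 (Real.exp_pos _).le)
    have hup : ∫⁻ z, ‖g z * (eX (ψ z) : ℂ) * x z - ∑ j, β j z *
        (wm j (cx x) z - x z * wm j (cx ψ) z)‖ₑ ^ 2 ∂(nu Φ) +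
        ∑ j, ∑ k, ∫⁻ z, ‖β k z * wd I j (cx x) z - β j z * wd I k (cx x) z‖ₑ ^ 2 ∂(nu Φ) ≤
        (oR (1 + ε) *
        (∫⁻ z in Ω, oR (eX (2 * ψ z - Φ z) * ‖g z‖ ^ 2)) +
      oR (k1 + 4) * (∫⁻ z in Ω, oR (eX (-Φ z) *
        ((∑ j, ‖wm j (cx x) z‖ ^ 2 + ∑ j, ‖wd I j (cx x) z‖ ^ 2) * ∑ j, ‖β j z‖ ^ 2)))) +
        ∫⁻ z in Ω, oR (eX (-Φ z) * T z) := by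
      have mc : ∀ j k, Measurable fun z => ‖β k z * wd I j (cx x) z - β j z * wd I k (cx x) z‖ₑ ^ 2 :=
        fun j k => by fun_prop
      have eS : ∀ j, ∑ k, ∫⁻ z, ‖β k z * wd I j (cx x) z - β j z * wd I k (cx x) z‖ₑ ^ 2 ∂(nu Φ)
          = ∫⁻ z, ∑ k, ‖β k z * wd I j (cx x) z - β j z * wd I k (cx x) z‖ₑ ^ 2 ∂(nu Φ) :=
        fun j => (lintegral_finsetSum _ fun k _ => mc j k).symm
      simp_rw [eS]
      rw [← lintegral_finsetSum _ fun j _ => Finset.measurable_sum _ fun k _ => mc j k,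
        ← lintegral_add_right _ (Finset.measurable_sum _ fun j _ => Finset.measurable_sum _ fun k _ => mc j k),
        nu_lint mΦ, lint_supp mΩ (fun z hz => by simp [hx0 z hz]),
        ← lintegral_const_mul' _ _ sM, ← lintegral_const_mul' _ _ sM,
        ← lintegral_add_right _ fP, ← lintegral_add_right _ fP]
      refine setLIntegral_mono' mΩ fun z hz => ?_
      simp only [← ofReal_sq]
      simp_rw [← ENNReal.ofReal_sum_of_nonneg (fun i (_ : i ∈ Finset.univ) => sq_nonneg _)]
      rw [← ENNReal.ofReal_sum_of_nonneg (fun _ _ => by positivity),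
        ← ENNReal.ofReal_add pS pS, ← ENNReal.ofReal_mul pS,
        ← ENNReal.ofReal_mul pS, ← ENNReal.ofReal_mul pS,
        ← ENNReal.ofReal_add pS pS, ← ENNReal.ofReal_add pS pS]
      refine ENNReal.ofReal_le_ofReal ?_
      have p1 := kl_pt hε (g z * (eX (ψ z) : ℂ) * x z) (x z) (fun j => β j z)
        (fun j => wm j (cx x) z) (fun j => wm j (cx ψ) z)
      have p2 := kl_pt2 (fun j => β j z) (fun j => wd I j (cx x) z)
      have p3 : ‖g z * (eX (ψ z) : ℂ) * x z‖ ^ 2 ≤ eX (2 * ψ z) * ‖g z‖ ^ 2 := by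
        have h1 := hχ1 N z
        have h2 : x z ^ 2 ≤ 1 := by have := h1.1; have := h1.2; change 0 ≤ x z at *; change x z ≤ 1 at *; nlinarith
        have he : eX (2 * ψ z) = eX (ψ z) ^ 2 := by rw [← Real.exp_nat_mul]; congr 1
        rw [norm_mul, norm_mul, norm_real, norm_real, mul_pow, mul_pow, Real.norm_eq_abs, Real.norm_eq_abs,
          sq_abs, sq_abs, he]
        have : 0 ≤ ‖g z‖ ^ 2 * eX (ψ z) ^ 2 := by positivity
        nlinarith
      have e1 : eX (2 * ψ z - Φ z) = eX (-Φ z) * eX (2 * ψ z) := by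
        rw [← Real.exp_add]; congr 1; ring
      have hu1 : 0 ≤ (∑ j, ‖wm j (cx x) z‖ ^ 2) * ∑ j, ‖β j z‖ ^ 2 := by positivity
      have hu2 : 0 ≤ (∑ j, ‖wd I j (cx x) z‖ ^ 2) * ∑ j, ‖β j z‖ ^ 2 := by positivity
      have p4 : (1 + ε) * ‖g z * (eX (ψ z) : ℂ) * x z‖ ^ 2 ≤
        (1 + ε) * (eX (2 * ψ z) * ‖g z‖ ^ 2) := mul_le_mul_of_nonneg_left p3 pS
      have := mul_nonneg hk1p.le hu2
      have p5 : ‖g z * (eX (ψ z) : ℂ) * x z - ∑ j, β j z *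
        (wm j (cx x) z - x z * wm j (cx ψ) z)‖ ^ 2 +
        ∑ j, ∑ k, ‖β k z * wd I j (cx x) z - β j z * wd I k (cx x) z‖ ^ 2 ≤
        (1 + ε) * (eX (2 * ψ z) * ‖g z‖ ^ 2) + (k1 + 4) *
        ((∑ j, ‖wm j (cx x) z‖ ^ 2 + ∑ j, ‖wd I j (cx x) z‖ ^ 2) * ∑ j, ‖β j z‖ ^ 2) + T z := by
        rw [← hk1] at p1
        simp only [T]
        linarith
      rw [e1]
      calc _ ≤ eX (-Φ z) * _ := mul_le_mul_of_nonneg_left p5 (Real.exp_pos _).le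
        _ = _ := by ring
    exact (ENNReal.add_le_add_iff_right hTfin).1 (hlow.trans (key.trans hup))
  have mwx : ∀ N c j, Measurable (wd c j (cx (χ N))) := fun N c j => ((hχ N).wd c j).sm.continuous.measurable
  have mx : ∀ N, Measurable (χ N) := fun N => measurable_re.comp (hχ N).sm.continuous.measurable
  have hlim : Tendsto (fun N => ∫⁻ z in Ω, oR (eX (-Φ z) *
        ((∑ j, ‖wm j (cx (χ N)) z‖ ^ 2 + ∑ j, ‖wd I j (cx (χ N)) z‖ ^ 2) * ∑ j, ‖β j z‖ ^ 2)))
        atTop (𝓝 (∫⁻ z in Ω, 0)) := by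
    refine tendsto_lintegral_of_dominated_convergence
      (fun z => oR C0 * oR (eX (ψ z - Φ z) * ∑ j, ‖β j z‖ ^ 2))
      (fun N => by have := mwx N; fun_prop) (fun N => ?_) ?_ ?_
    · refine (ae_restrict_iff' mΩ).2 (Eventually.of_forall fun z hz => ?_)
      beta_reduce
      rw [← ENNReal.ofReal_mul' pS]
      refine ENNReal.ofReal_le_ofReal ?_
      have e1 : eX (ψ z - Φ z) = eX (-Φ z) * eX (ψ z) := by
        rw [← Real.exp_add]; congr 1; ring
      have hb : 0 ≤ ∑ j, ‖β j z‖ ^ 2 := by positivity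
      calc _ ≤ eX (-Φ z) * ((C0 * eX (ψ z)) * ∑ j, ‖β j z‖ ^ 2) :=
            mul_le_mul_of_nonneg_left (mul_le_mul_of_nonneg_right (hχ2 N z hz) hb) (Real.exp_pos _).le
        _ = _ := by rw [e1]; ring
    · rw [lintegral_const_mul' _ _ sM]
      exact ENNReal.mul_ne_top sM hβ2
    · refine (ae_restrict_iff' mΩ).2 (Eventually.of_forall fun z hz => ?_)
      refine tendsto_const_nhds.congr' ?_
      filter_upwards [hχ3 z hz] with N hN
      simp [hN.2]
  have hlim2 := (ENNReal.Tendsto.const_mul hlim (a := oR (k1 + 4)) (Or.inr sM)).const_add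
    (oR (1 + ε) * ∫⁻ z in Ω, oR (eX (2 * ψ z - Φ z) * ‖g z‖ ^ 2))
  rw [lintegral_zero, mul_zero, add_zero] at hlim2
  have hfat : ∫⁻ z in Ω, oR (eX (-Φ z) * A z (fun j => β j z)) =
      ∫⁻ z in Ω, liminf (fun N => oR (eX (-Φ z) * A z (fun j => χ N z * β j z))) atTop := by
    refine setLIntegral_congr_fun mΩ fun z hz => ?_
    refine (Tendsto.liminf_eq (tendsto_const_nhds.congr' ?_)).symm
    filter_upwards [hχ3 z hz] with N hN
    simp [hN.1]
  rw [hfat]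
  refine (lintegral_liminf_le fun N => ?_).trans ?_
  · have : Measurable fun z => A z (fun j => χ N z * β j z) :=
      hAm (fun j z => χ N z * β j z) fun j => by have := mx N; fun_prop
    exact (mΦ.neg.exp.mul this).ennreal_ofReal
  · rw [← hlim2.liminf_eq]
    exact liminf_le_liminf (Eventually.of_forall step)
end

section
variable {n : ℕ} {Ω : Set (Cn n)} {Φ ψ p : Cn n → ℝ}

lemma Tst.mul_memLp {η f : Fc n} (hη : Tst Ω η) (hf : MemLp f 2) : MemLp (fun x => η x * f x) 2 := by
  obtain ⟨C, hC⟩ := tst_bdd hη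
  refine hf.of_le_mul (c := C) (hη.sm.continuous.aestronglyMeasurable.mul hf.1) (Eventually.of_forall fun z => ?_)
  rw [norm_mul]; exact mul_le_mul_of_nonneg_right (hC z) (norm_nonneg _)

lemma Tst.mul_int {η f : Fc n} (hη : Tst Ω η) (hf : MemLp f 2) : Integrable (fun x => η x * f x) :=
  hη.memLp.integrable_mul hf

lemma inner_lp {f g : Fc n} (hf : MemLp f 2) (hg : MemLp g 2) :
    inner ℂ (hf.toLp f) (hg.toLp g) = ∫ x, star (f x) * g x := by
  rw [L2.inner_def]
  refine integral_congr_ae ?_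
  filter_upwards [hf.coeFn_toLp, hg.coeFn_toLp] with x h1 h2
  rw [h1, h2, RCLike.inner_apply, mul_comm]; rfl

lemma Tst.div {η : Fc n} (hη : Tst Ω η) (hΩ : IsOpen Ω) (hp : ContDiffOn ℝ ∞ p Ω) (hp0 : ∀ z, p z ≠ 0) :
    Tst Ω (fun x => η x * ((p x)⁻¹ : ℝ)) :=
  hη.mul_smooth hΩ (ofRealCLM.contDiff.comp_contDiffOn (hp.inv fun z _ => hp0 z))

def wclosed (Ω : Set (Cn n)) (γ : Fin n → Fc n) : Prop :=
  ∀ η, Tst Ω η → ∀ j k, ∫ x, (γ k x * wd I j η x - γ j x * wd I k η x) = 0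

theorem pj (hΩ : IsOpen Ω) (hp : ContDiffOn ℝ ∞ p Ω) (hp0 : ∀ z, p z ≠ 0) (mp : Measurable p)
    {b : Fin n → Fc n} (hb : ∀ j, Tst Ω (b j)) :
    ∃ β : Fin n → Fc n, (∀ j, Measurable (β j)) ∧ (∀ j, MemLp (fun z => (p z : ℂ) * β j z) 2) ∧
      wclosed Ω β ∧ ∀ γ : Fin n → Fc n, (∀ j, MemLp (fun z => (p z : ℂ) * γ j z) 2) → wclosed Ω γ →
        ∑ j, ∫ x, star (b j x) * γ j x = ∑ j, ∫ x, star (β j x) * (p x : ℂ) ^ 2 * γ j x := by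
  classical
  let X := PiLp 2 (fun _ : Fin n => Lp ℂ 2 (volume : Measure (Cn n)))
  have hq : ∀ z, (p z : ℂ) ≠ 0 := fun z => by exact_mod_cast hp0 z
  have ht : ∀ η, Tst Ω η → ∀ j, MemLp (fun x => star (wd I j η x) * ((p x)⁻¹ : ℝ)) 2 :=
    fun η hη j => ((hη.wd I j).conj.div hΩ hp hp0).memLp
  let V : ∀ η, Tst Ω η → Fin n → Fin n → X := fun η hη j k => WithLp.toLp 2 fun i =>
    (if i = k then (ht η hη j).toLp _ else 0) - (if i = j then (ht η hη k).toLp _ else 0)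
  let M : Set X := {m | ∃ η hη j k, m = V η hη j k}
  have hV : ∀ {γ : Fin n → Fc n} (hγ : ∀ j, MemLp (fun z => (p z : ℂ) * γ j z) 2) η hη j k,
      inner ℂ (V η hη j k) (WithLp.toLp 2 fun i => (hγ i).toLp _ : X) =
        ∫ x, (γ k x * wd I j η x - γ j x * wd I k η x) := by
    intro γ hγ η hη j k
    have e : ∀ j k, inner ℂ ((ht η hη j).toLp _) ((hγ k).toLp _) = ∫ x, γ k x * wd I j η x := by
      intro j k
      rw [inner_lp]
      congr 1; ext x
      have := hq x
      simp; field_simp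
    have e1 : ∀ i, inner ℂ ((if i = k then (ht η hη j).toLp _ else 0) - (if i = j then (ht η hη k).toLp _ else 0))
       ((hγ i).toLp _) = (if i = k then (∫ x, γ i x * wd I j η x) else 0) - (if i = j then (∫ x, γ i x * wd I k η x) else 0) := by
      intro i
      rw [inner_sub_left, ← e, ← e]
      split_ifs <;> simp
    have hi : ∀ j k, Integrable fun x => γ k x * wd I j η x := fun j k => by
      have := ((hη.wd I j).div hΩ hp hp0).mul_int (hγ k)
      refine this.congr (Eventually.of_forall fun x => ?_)
      have := hq x
      simp; field_simp
    rw [PiLp.inner_apply]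
    refine (Finset.sum_congr rfl fun i _ => e1 i).trans ?_
    rw [Finset.sum_sub_distrib, Finset.sum_ite_eq' , Finset.sum_ite_eq']
    simp only [Finset.mem_univ, if_true]
    exact (integral_sub (hi j k) (hi k j)).symm
  let K : Submodule ℂ X := (Submodule.span ℂ M)ᗮ
  have hK : ∀ {γ : Fin n → Fc n} (hγ : ∀ j, MemLp (fun z => (p z : ℂ) * γ j z) 2),
      (WithLp.toLp 2 fun i => (hγ i).toLp _ : X) ∈ K ↔ wclosed Ω γ := by
    intro γ hγ
    constructor
    · intro h η hη j k
      rw [← hV hγ η hη j k]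
      exact (Submodule.mem_orthogonal _ _).1 h _ (Submodule.subset_span ⟨η, hη, j, k, rfl⟩)
    · intro h
      rw [Submodule.mem_orthogonal]
      intro u hu
      induction hu using Submodule.span_induction with
      | mem u hu => obtain ⟨η, hη, j, k, rfl⟩ := hu; exact (hV hγ η hη j k).trans (h η hη j k)
      | zero => exact inner_zero_left _
      | add x y _ _ hx hy => rw [inner_add_left, hx, hy, add_zero]
      | smul a x _ hx => rw [inner_smul_left, hx, mul_zero]
  have hbL : ∀ j, MemLp (fun x => b j x * ((p x)⁻¹ : ℝ)) 2 := fun j => ((hb j).div hΩ hp hp0).memLp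
  have : CompleteSpace K := (Submodule.isClosed_orthogonal _).completeSpace_coe
  have : K.HasOrthogonalProjection := Submodule.HasOrthogonalProjection.ofCompleteSpace K
  obtain ⟨y, hy, z, hz, hyz⟩ := Submodule.exists_add_mem_mem_orthogonal (K := K)
    (WithLp.toLp 2 fun i => (hbL i).toLp _ : X)
  let β : Fin n → Fc n := fun j x => ((p x)⁻¹ : ℝ) * (y.ofLp j : Fc n) x
  have hβe : ∀ j, (fun z => (p z : ℂ) * β j z) = (y.ofLp j : Fc n) := fun j => by
    ext z; have := hq z; simp [β]; field_simp
  have hβ : ∀ j, MemLp (fun z => (p z : ℂ) * β j z) 2 := fun j => by rw [hβe]; exact Lp.memLp _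
  have hβy : (WithLp.toLp 2 fun i => (hβ i).toLp _ : X) = y := by
    ext1 i
    show (hβ i).toLp _ = _
    have := Lp.toLp_coeFn (y.ofLp i) (Lp.memLp _)
    rw [← this]
    congr 1; exact hβe i
  refine ⟨β, fun j => ?_, hβ, ?_, fun γ hγ hc => ?_⟩
  · exact (mp.inv.complex_ofReal).mul (Lp.stronglyMeasurable _).measurable
  · rw [← hK hβ, hβy]; exact hy
  · have h1 := (Submodule.mem_orthogonal' _ _).1 hz _ ((hK hγ).2 hc)
    have h2 : inner ℂ (WithLp.toLp 2 fun i => (hbL i).toLp _ : X) (WithLp.toLp 2 fun i => (hγ i).toLp _ : X) =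
        inner ℂ y (WithLp.toLp 2 fun i => (hγ i).toLp _ : X) := by
      rw [hyz, inner_add_left, h1, add_zero]
    rw [← hβy, PiLp.inner_apply, PiLp.inner_apply] at h2
    simp only [inner_lp] at h2
    convert h2 using 4 with j _ j _
    · have := hq j; simp; field_simp
    · simp; ring

lemma wclosed_dbar {θ : Fc n} (hθ : Tst Ω θ) : wclosed Ω (fun j => wd I j θ) := by
  intro η hη j k
  have hu : Tst univ θ := hθ.mono (subset_univ _)
  have h : ∀ j k, ∫ x, wd I k θ x * wd I j η x = - ∫ x, wd I j (wd I k θ) x * η x := fun j k =>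
    wd_ibp (hu.wd I k) hη.sm
  refine (integral_sub ((hθ.wd I k).mul_int (hη.wd I j).memLp) ((hθ.wd I j).mul_int (hη.wd I k).memLp)).trans ?_
  rw [h, h, sub_eq_zero]
  congr 2; ext x
  rw [wd_comm hθ.sm]

lemma lint_cs {μ : Measure (Cn n)} {F G : Cn n → ℝ≥0∞} (hF : AEMeasurable F μ) (hG : AEMeasurable G μ) :
    (∫⁻ z, F z * G z ∂μ) ^ 2 ≤ (∫⁻ z, F z ^ 2 ∂μ) * ∫⁻ z, G z ^ 2 ∂μ := by
  have := ENNReal.lintegral_mul_le_Lp_mul_Lq μ Real.HolderConjugate.two_two hF hG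
  calc _ ≤ _ := pow_le_pow_left' this 2
    _ = _ := by
      rw [mul_pow, ← ENNReal.rpow_natCast, ← ENNReal.rpow_natCast, ← ENNReal.rpow_mul, ← ENNReal.rpow_mul]
      norm_num

lemma ha_abs {X : Type*} [NormedAddCommGroup X] [InnerProductSpace ℂ X] [CompleteSpace X] (T : Submodule ℂ X)
    (u0 : X) {C : ℝ} (h : ∀ x ∈ T, ‖inner ℂ x u0‖ ≤ C * ‖x‖) :
    ∃ v : X, ‖v‖ ≤ C ⊔ 0 ∧ ∀ x ∈ T, inner ℂ x u0 = inner ℂ x v := by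
  have : CompleteSpace T.topologicalClosure := T.isClosed_topologicalClosure.completeSpace_coe
  have : T.topologicalClosure.HasOrthogonalProjection := Submodule.HasOrthogonalProjection.ofCompleteSpace _
  obtain ⟨y, hy, z, hz, e⟩ := Submodule.exists_add_mem_mem_orthogonal (K := T.topologicalClosure) u0
  have hz' := (Submodule.mem_orthogonal _ _).1 hz
  have hcl : ∀ x ∈ T.topologicalClosure, ‖inner ℂ x u0‖ ≤ C * ‖x‖ :=
    closure_minimal (s := (T : Set X)) (t := {x | ‖inner ℂ x u0‖ ≤ C * ‖x‖}) h
      (isClosed_le fP fP)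
  refine ⟨y, ?_, fun x hx => by rw [e, inner_add_right, hz' x (T.le_topologicalClosure hx), add_zero]⟩
  have h1 := hcl y hy
  rw [e, inner_add_right, hz' y hy, add_zero, inner_self_eq_norm_sq_to_K, norm_pow] at h1
  simp at h1
  by_cases h0 : ‖y‖ = 0
  · rw [h0]; exact le_sup_right
  · refine le_sup_of_le_left ?_
    have : 0 < ‖y‖ := lt_of_le_of_ne (norm_nonneg _) (Ne.symm h0)
    nlinarith
end

section
variable {n : ℕ} {Ω : Set (Cn n)} {Φ ψ p : Cn n → ℝ}

theorem ht (hΩ : IsOpen Ω) (hΦ : ContDiffOn ℝ ∞ Φ Ω) (hψ : ContDiffOn ℝ ∞ ψ Ω)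
    (mΦ : Measurable Φ) (mψ : Measurable ψ) {χ : ℕ → Cn n → ℝ} (hχ : ∀ N, Tst Ω (cx (χ N)))
    (hχ1 : ∀ N z, χ N z ∈ Icc (0:ℝ) 1) {C0 : ℝ}
    (hχ2 : ∀ N, ∀ z ∈ Ω, ∑ j, ‖wm j (cx (χ N)) z‖ ^ 2 + ∑ j, ‖wd I j (cx (χ N)) z‖ ^ 2 ≤
      C0 * eX (ψ z))
    (hχ3 : ∀ z ∈ Ω, ∀ᶠ N in atTop, χ N z = 1 ∧ ∀ c j, wd c j (cx (χ N)) z = 0)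
    {ε : ℝ} (hε : 0 < ε) {A : Cn n → Cn n → ℝ} (hA0 : ∀ z ∈ Ω, ∀ ξ, 0 ≤ A z ξ)
    (hA : ∀ z ∈ Ω, ∀ ξ, A z ξ + 2 * (1 + 1 / ε) * (∑ j, ‖wm j (cx ψ) z‖ ^ 2) * ∑ j, ‖ξ j‖ ^ 2
      ≤ levi Φ z ξ)
    (hAm : ∀ b : Fin n → Fc n, (∀ j, Measurable (b j)) → Measurable fun z => A z fun j => b j z)
    {u0 : Fc n} {α : Fin n → Fc n}
    (hu0 : MemLp (Ω.indicator fun z => (eX (ψ z - Φ z / 2) : ℂ) * u0 z) 2)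
    (hα : ∀ j, MemLp (Ω.indicator fun z => (eX ((ψ z - Φ z) / 2) : ℂ) * α j z) 2)
    (hw : ∀ η, Tst Ω η → ∀ j, ∫ x, η x * α j x = - ∫ x, u0 x * wd I j η x)
    {a : Cn n → ℝ} (ma : Measurable a) (ha0 : ∀ z ∈ Ω, 0 ≤ a z)
    (ha : ∀ z ∈ Ω, ∀ ξ : Cn n, ‖∑ j, star (ξ j) * α j z‖ ^ 2 ≤ a z * A z ξ)
    (hfin : ∫⁻ z in Ω, oR (eX (2 * ψ z - Φ z) * a z) ≠ ⊤) :
    ∃ w : Fc n, Measurable w ∧ (∀ η, Tst Ω η → ∀ j, ∫ x, u0 x * wd I j η x = ∫ x, w x * wd I j η x) ∧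
      ∫⁻ z in Ω, oR (eX (2 * ψ z - Φ z) * ‖w z‖ ^ 2) ≤
        oR (1 + ε) * ∫⁻ z in Ω, oR (eX (2 * ψ z - Φ z) * a z) := by
  have mΩ := hΩ.measurableSet
  set p1 : Cn n → ℝ := fun z => eX (ψ z - Φ z / 2) with hp1
  set p2 : Cn n → ℝ := fun z => eX ((ψ z - Φ z) / 2) with hp2
  have p1s : ContDiffOn ℝ ∞ p1 Ω := (hψ.sub (hΦ.div_const 2)).exp
  have p2s : ContDiffOn ℝ ∞ p2 Ω := ((hψ.sub hΦ).div_const 2).exp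
  have p10 : ∀ z, p1 z ≠ 0 := fun z => (Real.exp_pos _).ne'
  have p20 : ∀ z, p2 z ≠ 0 := fun z => (Real.exp_pos _).ne'
  have p1c : ∀ z, (p1 z : ℂ) ≠ 0 := fun z => by exact_mod_cast p10 z
  have p2c : ∀ z, (p2 z : ℂ) ≠ 0 := fun z => by exact_mod_cast p20 z
  have mp1 : Measurable p1 := by fun_prop
  have mp2 : Measurable p2 := by fun_prop
  have e1 : ∀ z, eX (2 * ψ z - Φ z) = p1 z ^ 2 := fun z => by
    rw [hp1, ← Real.exp_nat_mul]; congr 1; push_cast; ring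
  have e2 : ∀ z, eX (ψ z - Φ z) = p2 z ^ 2 := fun z => by
    rw [hp2, ← Real.exp_nat_mul]; congr 1; push_cast; ring
  have e3 : ∀ z, p2 z ^ 2 = p1 z * eX (-Φ z / 2) := fun z => by
    rw [← e2, hp1, ← Real.exp_add]; congr 1; ring
  set Q := ∫⁻ z in Ω, oR (eX (2 * ψ z - Φ z) * a z) with hQ
  have iα : ∀ {η : Fc n}, Tst Ω η → ∀ j, Integrable fun x => η x * α j x := fun {η} hη j => by
    refine ((hη.div hΩ p2s p20).mul_int (hα j)).congr (Eventually.of_forall fun x => ?_)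
    by_cases hx : x ∈ Ω
    · have := p2c x
      beta_reduce; rw [indicator_of_mem hx]
      change η x * ((p2 x)⁻¹ : ℝ) * ((p2 x : ℂ) * α j x) = _
      push_cast; field_simp
    · have : η x = 0 := image_eq_zero_of_notMem_tsupport fun h => hx (hη.su h)
      simp [this]
  have iu : ∀ {η : Fc n}, Tst Ω η → Integrable fun x => u0 x * η x := fun {η} hη => by
    refine ((hη.div hΩ p1s p10).mul_int hu0).congr (Eventually.of_forall fun x => ?_)
    by_cases hx : x ∈ Ω
    · have := p1c x
      beta_reduce; rw [indicator_of_mem hx]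
      change η x * ((p1 x)⁻¹ : ℝ) * ((p1 x : ℂ) * u0 x) = _
      push_cast; field_simp
    · have : η x = 0 := image_eq_zero_of_notMem_tsupport fun h => hx (hη.su h)
      simp [this]
  have hαi : ∀ j, MemLp (fun z => (p2 z : ℂ) * Ω.indicator (α j) z) 2 := fun j => by
    convert hα j using 1; ext z; by_cases hz : z ∈ Ω <;> simp [hz, hp2]
  have ind : ∀ {η : Fc n}, Tst Ω η → ∀ j x, η x * Ω.indicator (α j) x = η x * α j x := by
    intro η hη j x
    by_cases hx : x ∈ Ω
    · simp [hx]
    · have : η x = 0 := image_eq_zero_of_notMem_tsupport fun h => hx (hη.su h)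
      simp [this]
  have hαc : wclosed Ω (fun j => Ω.indicator (α j)) := by
    intro η hη j k
    have : ∀ x, Ω.indicator (α k) x * wd I j η x - Ω.indicator (α j) x * wd I k η x =
        wd I j η x * α k x - wd I k η x * α j x := fun x => by
      rw [mul_comm, ind (hη.wd I j), mul_comm (Ω.indicator _ _), ind (hη.wd I k)]
    simp only [this]
    refine (integral_sub (iα (hη.wd I j) k) (iα (hη.wd I k) j)).trans ?_
    rw [hw _ (hη.wd I j), hw _ (hη.wd I k), sub_eq_zero]
    congr 2; ext x
    rw [wd_comm hη.sm]
  have main : ∀ b : Fin n → Fc n, (∀ j, Tst Ω (b j)) →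
      ‖∑ j, ∫ x, star (b j x) * α j x‖ₑ ^ 2 ≤ Q * (oR (1 + ε) *
        ∫⁻ z, ‖(∑ j, wm j (b j) z) * ((p1 z)⁻¹ : ℝ)‖ₑ ^ 2) := by
    intro b hb
    obtain ⟨β, mβ, hβL, hβc, hβo⟩ := pj hΩ p2s p20 mp2 hb
    let g : Fc n := fun z => (∑ j, wm j (b j) z) * (-(((p1 z) ^ 2)⁻¹ : ℝ) : ℂ)
    have hgT : Tst Ω g := by
      refine (Tst.sum fun j _ => (hb j).wd (-I) j).mul_smooth hΩ ?_
      exact (ofRealCLM.contDiff.comp_contDiffOn ((p1s.pow 2).inv fun z _ => pow_ne_zero 2 (p10 z))).neg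
    have H1 : ∀ η, Tst Ω η → ∑ j, ∫ x, β j x * (eX (ψ x - Φ x) : ℂ) * wm j η x =
      ∫ x, g x * (eX (2 * ψ x - Φ x) : ℂ) * η x := by
      intro η hη
      have h1 := hβo (fun j => wd I j fun x => star (η x)) (fun j => ?_) (wclosed_dbar hη.conj)
      swap
      · have := ((hη.conj.wd I j).mul_smooth hΩ (ofRealCLM.contDiff.comp_contDiffOn p2s)).memLp
        exact (memLp_congr_ae (Eventually.of_forall fun z => mul_comm _ _)).1 this
      have h2 := congrArg star h1
      have hst : ∀ j x, wd I j (fun x => star (η x)) x = star (wm j η x) := fun j x => by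
        rw [wd_conj (hη.sm.differentiable sM x)]; simp
      simp only [hst, star_sum] at h2
      have hci : ∀ f : Fc n, star (∫ x, f x) = ∫ x, star (f x) := fun f => integral_conj.symm
      simp only [hci, star_mul', star_star, star_pow] at h2
      have hpr : ∀ x, star (p2 x : ℂ) = p2 x := fun x => conj_ofReal _
      simp only [hpr] at h2
      have e2c : ∀ x, (eX (ψ x - Φ x) : ℂ) = (p2 x : ℂ) ^ 2 := fun x => by rw [e2]; push_cast; rfl
      have e1c : ∀ x, (eX (2 * ψ x - Φ x) : ℂ) = (p1 x : ℂ) ^ 2 := fun x => by rw [e1]; push_cast; rfl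
      simp only [e2c, e1c]
      rw [← h2]
      have h3 : ∀ j, ∫ x, b j x * wm j η x = - ∫ x, wm j (b j) x * η x := fun j =>
        wd_ibp ((hb j).mono (subset_univ _)) hη.sm
      rw [Finset.sum_congr rfl fun j _ => h3 j, Finset.sum_neg_distrib, ← integral_finsetSum _ fun j _ =>
        ((hb j).wd (-I) j).mul_int hη.memLp, ← integral_neg]
      congr 1; ext x
      have := p1c x
      simp only [g]; push_cast; rw [← Finset.sum_mul]; field_simp
    have hβT : ∀ j η, Tst Ω η → MemLp (fun x => η x * β j x) 2 := fun j η hη => by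
      refine (memLp_congr_ae (Eventually.of_forall fun x => ?_)).1 ((hη.div hΩ p2s p20).mul_memLp (hβL j))
      beta_reduce; have := p2c x; push_cast; field_simp
    have hβ2 : ∫⁻ z in Ω, oR (eX (ψ z - Φ z) * ∑ j, ‖β j z‖ ^ 2) ≠ ⊤ := by
      have : ∀ z, oR (eX (ψ z - Φ z) * ∑ j, ‖β j z‖ ^ 2) =
          ∑ j, ‖(p2 z : ℂ) * β j z‖ₑ ^ 2 := fun z => by
        simp only [← ofReal_sq]
        rw [← ENNReal.ofReal_sum_of_nonneg (fun i (_ : i ∈ Finset.univ) => sq_nonneg _), e2, Finset.mul_sum]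
        simp [mul_pow]
      simp only [this]
      rw [lintegral_finsetSum _ fun j _ => by have := mβ j; fun_prop]
      refine ENNReal.sum_ne_top.2 fun i _ => ne_top_of_le_ne_top ?_ (setLIntegral_le_lintegral _ _)
      rw [← eLp2]
      exact ENNReal.pow_ne_top (hβL i).2.ne
    have hkl := kl hΩ hΦ hψ mΦ mψ hχ hχ1 hχ2 hχ3 hε hA0 hA hAm mβ hgT.sm.continuous.measurable hβT
      (fun η hη => hη.mul_memLp hgT.memLp) hβ2 H1 hβc
    have hpair := hβo _ hαi hαc
    have hl : ∑ j, ∫ x, star (b j x) * α j x = ∑ j, ∫ x, star (b j x) * Ω.indicator (α j) x :=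
      Finset.sum_congr rfl fun j _ => integral_congr_ae (Eventually.of_forall fun x => (ind (hb j).conj j x).symm)
    have iβ : ∀ j, Integrable fun x => star (β j x) * (p2 x : ℂ) ^ 2 * Ω.indicator (α j) x := fun j => by
      have h1 : MemLp (fun x => star ((p2 x : ℂ) * β j x)) 2 := (hβL j).star
      refine (h1.integrable_mul (hαi j)).congr (Eventually.of_forall fun x => ?_)
      simp; ring
    have mA := hAm β mβ
    have hcs := lint_cs (μ := volume.restrict Ω) (F := fun z => oR (p1 z * √(a z)))
      (G := fun z => oR (eX (-Φ z / 2) * √(A z fun j => β j z)))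
      fP ((((mΦ.neg.div_const 2).exp).mul mA.sqrt).ennreal_ofReal.aemeasurable)
    rw [hl, hpair, ← integral_finsetSum _ fun j _ => iβ j]
    have hint : ‖∫ x, ∑ j, star (β j x) * (p2 x : ℂ) ^ 2 * Ω.indicator (α j) x‖ₑ ≤
        ∫⁻ z in Ω, oR (p1 z * √(a z)) * oR (eX (-Φ z / 2) * √(A z fun j => β j z)) := by
      refine (enorm_integral_le_lintegral_enorm _).trans ?_
      rw [lint_supp mΩ fun z hz => by simp [hz]]
      refine setLIntegral_mono' mΩ fun z hz => ?_
      have hA1 := hA0 z hz (fun j => β j z)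
      have ha1 := ha0 z hz
      rw [← ENNReal.ofReal_mul (mul_nonneg (Real.exp_pos _).le (Real.sqrt_nonneg _)), ← ofReal_norm]
      refine ENNReal.ofReal_le_ofReal ?_
      have h3 : ∑ j, star (β j z) * (p2 z : ℂ) ^ 2 * Ω.indicator (α j) z =
          (p2 z : ℂ) ^ 2 * ∑ j, star (β j z) * α j z := by
        rw [Finset.mul_sum]; refine Finset.sum_congr rfl fun j _ => ?_
        simp [hz]; ring
      have h4 : ‖∑ j, star (β j z) * α j z‖ ≤ √(a z) * √(A z fun j => β j z) := by
        rw [← Real.sqrt_mul ha1]; exact Real.le_sqrt_of_sq_le (ha z hz _)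
      rw [h3, norm_mul, norm_pow, norm_real, Real.norm_eq_abs, sq_abs]
      calc _ ≤ p2 z ^ 2 * _ := mul_le_mul_of_nonneg_left h4 (sq_nonneg _)
        _ = _ := by rw [e3]; ring
    refine (pow_le_pow_left' hint 2).trans (hcs.trans ?_)
    refine mul_le_mul' (le_of_eq ?_) (le_trans (le_of_eq ?_) (hkl.trans ?_))
    · refine setLIntegral_congr_fun mΩ fun z hz => ?_
      beta_reduce
      rw [← ENNReal.ofReal_pow (mul_nonneg (Real.exp_pos _).le (Real.sqrt_nonneg _)), mul_pow, Real.sq_sqrt (ha0 z hz), e1]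
    · refine setLIntegral_congr_fun mΩ fun z hz => ?_
      beta_reduce
      rw [← ENNReal.ofReal_pow (mul_nonneg (Real.exp_pos _).le (Real.sqrt_nonneg _)), mul_pow,
        Real.sq_sqrt (hA0 z hz _), ← Real.exp_nat_mul]
      congr 3; push_cast; ring
    · refine mul_le_mul' le_rfl ((setLIntegral_le_lintegral _ _).trans (lintegral_mono fun z => ?_))
      rw [← ofReal_sq]
      refine ENNReal.ofReal_le_ofReal (le_of_eq ?_)
      have := p10 z
      simp only [g, norm_mul, norm_neg, norm_real, mul_pow, e1, Real.norm_eq_abs, sq_abs]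
      field_simp
  let r : (Fin n → Fc n) → Fc n := fun b z => (∑ j, wm j (b j) z) * ((p1 z)⁻¹ : ℝ)
  let T : Submodule ℂ (Lp ℂ 2 (volume : Measure (Cn n))) :=
    { carrier := {x | ∃ b, (∀ j, Tst Ω (b j)) ∧ x =ᵐ[volume] r b}
      add_mem' := by
        rintro x y ⟨b, hb, hx⟩ ⟨c, hc, hy⟩
        refine ⟨fun j z => b j z + c j z, fun j => (hb j).add (hc j), ?_⟩
        filter_upwards [hx, hy, Lp.coeFn_add x y] with z h1 h2 h3
        rw [h3, Pi.add_apply, h1, h2]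
        simp only [r]
        simp only [wd_add ((hb _).sm.differentiable sM z) ((hc _).sm.differentiable sM z),
          Finset.sum_add_distrib]
        ring
      zero_mem' := by
        refine ⟨fun j z => 0, fun j => Tst.zero, ?_⟩
        filter_upwards [Lp.coeFn_zero ℂ 2 (volume : Measure (Cn n))] with z h
        rw [h]; simp [r, wd]
      smul_mem' := by
        rintro c x ⟨b, hb, hx⟩
        refine ⟨fun j z => b j z * c, fun j => (hb j).mul' contDiff_const, ?_⟩
        filter_upwards [hx, Lp.coeFn_smul c x] with z h1 h3
        rw [h3, Pi.smul_apply, h1]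
        have : ∀ j, wm j (fun z => b j z * c) z = wm j (b j) z * c := fun j => by
          rw [wd_mul ((hb _).sm.differentiable sM z) (differentiableAt_const _)]
          simp [wd]
        simp only [r, this, ← Finset.sum_mul, smul_eq_mul]; ring }
  have hr : ∀ b, (∀ j, Tst Ω (b j)) → MemLp (r b) 2 := fun b hb =>
    ((Tst.sum fun j _ => (hb j).wd (-I) j).div hΩ p1s p10).memLp
  have hTm : ∀ b (hb : ∀ j, Tst Ω (b j)), (hr b hb).toLp _ ∈ T := fun b hb => ⟨b, hb, (hr b hb).coeFn_toLp⟩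
  have hstar : ∀ b : Fin n → Fc n, (∀ j, Tst Ω (b j)) → ∀ x, star (r b x) =
      (∑ j, wd I j (fun y => star (b j y)) x) * ((p1 x)⁻¹ : ℝ) := fun b hb x => by
    have : ∀ j, wd I j (fun y => star (b j y)) x = star (wm j (b j) x) := fun j => by
      rw [wd_conj ((hb j).sm.differentiable sM x)]; simp
    simp only [this, r, star_mul', star_sum]
    congr 1; exact conj_ofReal _
  have hin : ∀ b (hb : ∀ j, Tst Ω (b j)), inner ℂ ((hr b hb).toLp _) (hu0.toLp _) =
      - ∑ j, ∫ x, star (b j x) * α j x := by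
    intro b hb
    rw [inner_lp]
    have h1 : ∀ x, star (r b x) * Ω.indicator (fun z => (p1 z : ℂ) * u0 z) x =
        ∑ j, u0 x * wd I j (fun y => star (b j y)) x := fun x => by
      rw [hstar b hb]
      by_cases hx : x ∈ Ω
      · have := p1c x
        simp only [hx, indicator_of_mem, ← Finset.mul_sum]; push_cast; field_simp
      · have : ∀ j, wd I j (fun y => star (b j y)) x = 0 := fun j =>
          image_eq_zero_of_notMem_tsupport fun h => hx (((hb j).conj.wd I j).su h)
        simp only [indicator_of_notMem hx, this, mul_zero, Finset.sum_const_zero]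
    refine (integral_congr_ae (Eventually.of_forall h1)).trans ?_
    rw [integral_finsetSum _ fun j _ => iu ((hb j).conj.wd I j), ← Finset.sum_neg_distrib]
    refine Finset.sum_congr rfl fun j _ => ?_
    rw [hw _ (hb j).conj, neg_neg]
  have hQe : Q = oR Q.toReal := (ENNReal.ofReal_toReal hfin).symm
  obtain ⟨v, hv1, hv2⟩ := ha_abs T (hu0.toLp _) (C := √(Q.toReal * (1 + ε))) (by
    rintro x ⟨b, hb, hx⟩
    have hxe : x = (hr b hb).toLp _ := Lp.ext (hx.trans (hr b hb).coeFn_toLp.symm)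
    have h1 := main b hb
    have h2 : ∫⁻ z, ‖(∑ j, wm j (b j) z) * ((p1 z)⁻¹ : ℝ)‖ₑ ^ 2 = oR (‖x‖ ^ 2) := by
      rw [← eLp2, ENNReal.ofReal_pow (norm_nonneg _), hxe, Lp.norm_toLp, ENNReal.ofReal_toReal (hr b hb).2.ne]
    rw [h2, hQe, ← ENNReal.ofReal_mul pS, ← ENNReal.ofReal_mul pS, ← ofReal_sq] at h1
    have h3 := (ENNReal.ofReal_le_ofReal_iff pS).1 h1
    rw [hxe, hin b hb, norm_neg, ← hxe]
    refine abs_le_of_sq_le_sq' ?_ pS |>.2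
    rw [mul_pow, Real.sq_sqrt pS]
    linarith)
  rw [sup_eq_left.2 (Real.sqrt_nonneg _)] at hv1
  refine ⟨fun z => ((p1 z)⁻¹ : ℝ) * v z, (mp1.inv.complex_ofReal).mul (Lp.stronglyMeasurable _).measurable, ?_, ?_⟩
  · intro η hη j
    classical
    let b : Fin n → Fc n := fun i => if i = j then fun x => star (η x) else fun _ => 0
    have hb : ∀ i, Tst Ω (b i) := fun i => by
      by_cases h : i = j
      · simp only [b, h, if_true]; exact hη.conj
      · simp only [b, h, if_false]; exact Tst.zero
    have h1 := hv2 _ (hTm b hb)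
    rw [hin b hb] at h1
    have hs : ∑ i, ∫ x, star (b i x) * α i x = ∫ x, η x * α j x := by
      rw [Finset.sum_eq_single j]
      · simp [b]
      · intro i _ hij; simp [b, hij]
      · simp
    rw [hs, hw η hη, neg_neg] at h1
    rw [h1, ← Lp.toLp_coeFn v (Lp.memLp v), inner_lp]
    refine integral_congr_ae (Eventually.of_forall fun x => ?_)
    have h2 : ∑ i, wd I i (fun y => star (b i y)) x = wd I j η x := by
      rw [Finset.sum_eq_single j]
      · simp [b]
      · intro i _ hij; simp [b, hij, wd]
      · simp
    beta_reduce
    rw [hstar b hb, h2, Lp.toLp_coeFn]; ring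
  · calc _ ≤ ∫⁻ z, ‖v z‖ₑ ^ 2 := by
          refine (setLIntegral_le_lintegral _ _).trans (lintegral_mono fun z => ?_)
          rw [← ofReal_sq]
          refine ENNReal.ofReal_le_ofReal (le_of_eq ?_)
          have := p10 z
          simp only [norm_mul, norm_real, mul_pow, e1, Real.norm_eq_abs, sq_abs]
          field_simp
      _ = oR (‖v‖ ^ 2) := by
          rw [← eLp2, ENNReal.ofReal_pow (norm_nonneg _), Lp.norm_def, ENNReal.ofReal_toReal (Lp.memLp v).2.ne]
      _ ≤ oR (Q.toReal * (1 + ε)) := ENNReal.ofReal_le_ofReal (by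
          rw [← Real.sq_sqrt (x := Q.toReal * (1 + ε)) pS]; gcongr)
      _ = _ := by rw [mul_comm, ENNReal.ofReal_mul pS, ← hQe]
end

section
variable {n : ℕ} {Ω : Set (Cn n)} {Φ ψ : Cn n → ℝ} {z : Cn n} {f : Fc n}

lemma wd_smoothOn {c : ℂ} {j : Fin n} (hΩ : IsOpen Ω) (hf : ContDiffOn ℝ ∞ f Ω) : ContDiffOn ℝ ∞ (wd c j f) Ω := by
  have h : ∀ v, ContDiffOn ℝ ∞ (fun z => fderiv ℝ f z v) Ω := fun v =>
    (hf.fderiv_of_isOpen hΩ (m := ∞) sM).clm_apply contDiffOn_const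
  unfold wd
  exact contDiffOn_const.mul ((h _).add (contDiffOn_const.mul (h _)))

lemma wd_cx_star {c : ℂ} {j : Fin n} (h : DifferentiableAt ℝ Φ z) :
    wd c j (cx Φ) z = star (wd (star c) j (cx Φ) z) := by
  have hd : DifferentiableAt ℝ (cx Φ) z := ofRealCLM.differentiableAt.comp z h
  rw [← wd_conj hd]
  congr 1; ext x; simp [cx]

lemma levi_comp {F F1 : ℝ → ℝ} {F2 : ℝ} (hΦ : ContDiff ℝ ∞ Φ) (hF : ∀ᶠ t in 𝓝 (Φ z), HasDerivAt F (F1 t) t)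
    (hF1 : HasDerivAt F1 F2 (Φ z)) (ξ : Cn n) :
    levi (fun x => F (Φ x)) z ξ = F1 (Φ z) * levi Φ z ξ + F2 * ‖∑ k, wm k (cx Φ) z * ξ k‖ ^ 2 := by
  have hd := hΦ.differentiable sM
  have h1 : ∀ j k, wm k (wd I j (cx fun x => F (Φ x))) z =
      F2 * wm k (cx Φ) z * star (wm j (cx Φ) z) + F1 (Φ z) * wm k (wd I j (cx Φ)) z := by
    intro j k
    have e : wd I j (cx fun x => F (Φ x)) =ᶠ[𝓝 z] fun x => cx (fun x => F1 (Φ x)) x * wd I j (cx Φ) x := by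
      filter_upwards [hΦ.continuous.continuousAt.eventually hF] with x hx
      rw [wd_real (hd x) hx]; rfl
    have hdF : DifferentiableAt ℝ (cx fun x => F1 (Φ x)) z :=
      ofRealCLM.differentiableAt.comp z (hF1.differentiableAt.comp z (hd z))
    rw [wd_congr e, wd_mul hdF ((wd_smooth (cx_smooth hΦ)).differentiable sM z), wd_real (hd z) hF1,
      wd_cx_star (c := I) (hd z)]
    simp [cx]
  have h2 : ∑ j, ∑ k, wm k (wd I j (cx fun x => F (Φ x))) z * ξ k * star (ξ j) =
      F2 * ((∑ k, wm k (cx Φ) z * ξ k) * star (∑ k, wm k (cx Φ) z * ξ k)) +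
      F1 (Φ z) * ∑ j, ∑ k, wm k (wd I j (cx Φ)) z * ξ k * star (ξ j) := by
    simp only [h1, star_sum, Finset.mul_sum, star_mul']
    rw [← Finset.sum_add_distrib]
    refine Finset.sum_congr rfl fun j _ => ?_
    rw [Finset.sum_mul, Finset.mul_sum, ← Finset.sum_add_distrib]
    refine Finset.sum_congr rfl fun k _ => ?_
    ring
  unfold levi
  rw [h2, add_re, re_ofReal_mul, re_ofReal_mul, add_comm]
  congr 2
  rw [← Complex.normSq_eq_norm_sq, ← Complex.ofReal_re (normSq _), ← Complex.mul_conj]; rfl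

lemma levi_add (hΩ : IsOpen Ω) (hz : z ∈ Ω) (hΦ : ContDiffOn ℝ ∞ Φ Ω) (hψ : ContDiffOn ℝ ∞ ψ Ω) (ξ : Cn n) :
    levi (fun x => Φ x + ψ x) z ξ = levi Φ z ξ + levi ψ z ξ := by
  have hc : ∀ {F : Cn n → ℝ}, ContDiffOn ℝ ∞ F Ω → ContDiffOn ℝ ∞ (cx F) Ω := fun hF =>
    ofRealCLM.contDiff.comp_contDiffOn hF
  have hd : ∀ {f : Fc n}, ContDiffOn ℝ ∞ f Ω → ∀ x ∈ Ω, DifferentiableAt ℝ f x := fun hf x hx =>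
    (hf.contDiffAt (hΩ.mem_nhds hx)).differentiableAt sM
  have h1 : ∀ j k, wm k (wd I j (cx fun x => Φ x + ψ x)) z =
      wm k (wd I j (cx Φ)) z + wm k (wd I j (cx ψ)) z := by
    intro j k
    rw [← wd_add (hd (wd_smoothOn hΩ (hc hΦ)) z hz) (hd (wd_smoothOn hΩ (hc hψ)) z hz)]
    refine wd_congr ?_
    filter_upwards [hΩ.mem_nhds hz] with x hx
    rw [← wd_add (hd (hc hΦ) x hx) (hd (hc hψ) x hx)]
    congr 1; ext y; simp [cx]
  unfold levi
  simp only [h1, add_mul, Finset.sum_add_distrib, add_re]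

lemma wd_dir {c : ℂ} (hc : c * c = -1) (f : Fc n) (z ξ : Cn n) :
    ∑ k, wd c k f z * (((ξ k).re : ℂ) - c * ((ξ k).im : ℂ)) =
      (1 / 2) * (fderiv ℝ f z ξ + c * fderiv ℝ f z (I • ξ)) := by
  set L := fderiv ℝ f z
  have hs : ∀ v : Cn n, L v = ∑ k, (((v k).re : ℂ) * L (Pi.single k 1) + ((v k).im : ℂ) * L (Pi.single k I)) := by
    intro v
    conv_lhs => rw [← Finset.univ_sum_single v, map_sum]
    refine Finset.sum_congr rfl fun k _ => ?_
    have : (Pi.single k (v k) : Cn n) = (v k).re • (Pi.single k (1:ℂ) : Cn n) + (v k).im • (Pi.single k I : Cn n) := by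
      rw [← Pi.single_smul, ← Pi.single_smul, ← Pi.single_add]
      congr 1; simp [re_add_im]
    rw [this, map_add, map_smul, map_smul]; simp
  rw [hs ξ, hs (I • ξ), Finset.mul_sum, ← Finset.sum_add_distrib, Finset.mul_sum]
  refine Finset.sum_congr rfl fun k _ => ?_
  simp only [wd, Pi.smul_apply, smul_eq_mul, I_mul_re, I_mul_im]
  push_cast
  linear_combination (-1/2) * L (Pi.single k I) * (ξ k).im * hc

lemma levi_dir (hΦ : ContDiff ℝ ∞ Φ) (z ξ : Cn n) : levi Φ z ξ =
    (1 / 4) * (fderiv ℝ (fderiv ℝ Φ) z ξ ξ + fderiv ℝ (fderiv ℝ Φ) z (I • ξ) (I • ξ)) := by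
  have hcx : ∀ x v, fderiv ℝ (cx Φ) x v = (fderiv ℝ Φ x v : ℂ) := fun x v => by
    have : HasFDerivAt (cx Φ) _ x := ofRealCLM.hasFDerivAt.comp x (hΦ.differentiable sM x).hasFDerivAt
    rw [this.fderiv]; simp
  have hc1 : I * I = -1 := I_mul_I
  have hc2 : (-I) * (-I) = -1 := by simp
  have s1 : ∀ k, ξ k = ((ξ k).re : ℂ) - (-I) * ((ξ k).im : ℂ) := fun k => by
    apply Complex.ext <;> simp
  have s2 : ∀ k, star (ξ k) = ((ξ k).re : ℂ) - I * ((ξ k).im : ℂ) := fun k => by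
    apply Complex.ext <;> simp
  let h : Fc n := fun x => ∑ j, wd I j (cx Φ) x * star (ξ j)
  have hh : ∀ x, h x = (1 / 2) * ((fderiv ℝ Φ x ξ : ℂ) + I * (fderiv ℝ Φ x (I • ξ) : ℂ)) := fun x => by
    simp only [h, s2]; rw [wd_dir hc1, hcx, hcx]
  have hD : ∀ v, fderiv ℝ h z v = (1 / 2) * ((fderiv ℝ (fderiv ℝ Φ) z v ξ : ℂ) +
      I * (fderiv ℝ (fderiv ℝ Φ) z v (I • ξ) : ℂ)) := fun v => by
    have hf : DifferentiableAt ℝ (fderiv ℝ Φ) z :=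
      (hΦ.fderiv_right (m := ∞) sM).differentiable sM z
    have hv : ∀ w : Cn n, HasFDerivAt (fun x => (fderiv ℝ Φ x w : ℂ))
      (ofRealCLM.comp ((fderiv ℝ (fderiv ℝ Φ) z).flip w)) z := fun w => by
        refine ofRealCLM.hasFDerivAt.comp z ?_
        simpa using hf.hasFDerivAt.clm_apply (hasFDerivAt_const w z)
    have := ((hv ξ).add ((hv (I • ξ)).const_mul I)).const_mul (1 / 2 : ℂ)
    have e : h = fun x => (1 / 2 : ℂ) * ((fderiv ℝ Φ x ξ : ℂ) + I * (fderiv ℝ Φ x (I • ξ) : ℂ)) := funext hh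
    rw [e]
    erw [this.fderiv]
    simp; ring
  have hsum : ∑ j, ∑ k, wm k (wd I j (cx Φ)) z * ξ k * star (ξ j) = ∑ k, wm k h z * ξ k := by
    rw [Finset.sum_comm]
    refine Finset.sum_congr rfl fun k _ => ?_
    have hd : ∀ j, DifferentiableAt ℝ (wd I j (cx Φ)) z := fun j =>
      (wd_smooth (cx_smooth hΦ)).differentiable sM z
    rw [wd_sum fun j _ => (hd j).mul_const _, Finset.sum_mul]
    refine Finset.sum_congr rfl fun j _ => ?_
    rw [wd_mul (hd j) (differentiableAt_const _)]
    simp [wd]; ring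
  unfold levi
  rw [hsum]
  have := wd_dir hc2 h z ξ
  rw [← Finset.sum_congr rfl fun k _ => by rw [← s1 k]] at this
  rw [this, hD, hD]
  simp; ring

lemma taylor2 (hΦ : ContDiff ℝ ∞ Φ) (z : Cn n) {ε : ℝ} (hε : 0 < ε) : ∃ r > 0, ∀ v, ‖v‖ < r →
    |Φ (z + v) - Φ z - fderiv ℝ Φ z v - (1 / 2) * fderiv ℝ (fderiv ℝ Φ) z v v| ≤ ε * ‖v‖ ^ 2 := by
  set B := fderiv ℝ (fderiv ℝ Φ) z
  have hf : DifferentiableAt ℝ (fderiv ℝ Φ) z :=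
      (hΦ.fderiv_right (m := ∞) sM).differentiable sM z
  have hsym : ∀ v w, B v w = B w v := fun v w =>
    (hΦ.contDiffAt (x := z)).isSymmSndFDerivAt (by simp; exact ENat.LEInfty.out) v w
  have h1 := hf.hasFDerivAt.isLittleO
  rw [Asymptotics.isLittleO_iff] at h1
  obtain ⟨r, hr, h2⟩ := Metric.eventually_nhds_iff.1 (h1 hε)
  refine ⟨r, hr, fun v hv => ?_⟩
  let g : Cn n → ℝ := fun w => Φ (z + w) - Φ z - fderiv ℝ Φ z w - (1 / 2) * B w w
  have hg : ∀ w, HasFDerivAt g (fderiv ℝ Φ (z + w) - fderiv ℝ Φ z - B w) w := by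
    intro w
    have a1 : HasFDerivAt (fun w => Φ (z + w)) (fderiv ℝ Φ (z + w)) w := by
      have := (hΦ.differentiable sM (z + w)).hasFDerivAt.comp w ((hasFDerivAt_id w).const_add z)
      exact this
    have a2 : HasFDerivAt (fun w => B w w) (B w + B.flip w) w := by
      have := B.hasFDerivAt.clm_apply (hasFDerivAt_id w)
      simpa using this
    have := ((a1.sub_const (Φ z)).sub (fderiv ℝ Φ z).hasFDerivAt).sub (a2.const_mul (1 / 2))
    refine this.congr_fderiv ?_
    ext u
    simp [hsym u w]; ring
  have h3 := Convex.norm_image_sub_le_of_norm_hasFDerivWithin_le (f := g) (s := closedBall 0 ‖v‖) (C := ε * ‖v‖)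
    (x := 0) (y := v)
    (fun w _ => (hg w).hasFDerivWithinAt) (fun w hw => ?_) (convex_closedBall _ _) sM sM
  · simp [g] at h3
    simp only [mul_assoc, ← pow_two] at h3
    simpa using h3
  · rw [mem_closedBall_zero_iff] at hw
    have := h2 (y := z + w) (by simpa using hw.trans_lt hv)
    simp at this
    exact this.trans (by gcongr)

lemma levi_nonneg (hΦ : ContDiff ℝ ∞ Φ) (z ξ : Cn n) {R0 : ℝ} (hR0 : 0 < R0)
    (h : ∀ R : ℝ, 0 < R → R < R0 → Φ z ≤ (2 * Real.pi)⁻¹ * ∫ θ in (0:ℝ)..(2 * Real.pi),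
      Φ (z + ((R : ℂ) * Complex.exp (θ * I)) • ξ)) : 0 ≤ levi Φ z ξ := by
  have key : ∀ ε : ℝ, 0 < ε → 0 ≤ levi Φ z ξ + ε * ‖ξ‖ ^ 2 := by
    intro ε hε
    obtain ⟨r, hr, ht⟩ := taylor2 hΦ z hε
    obtain ⟨R, hR, hR1⟩ : ∃ R : ℝ, 0 < R ∧ R < min R0 (r / (‖ξ‖ + 1)) := exists_between pS
    have hR2 := hR1.trans_le (min_le_right _ _)
    have hR3 : R * ‖ξ‖ < r := by
      rw [lt_div_iff₀ pS] at hR2; nlinarith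
    have h1 := h R hR (hR1.trans_le (min_le_left _ _))
    set B := fderiv ℝ (fderiv ℝ Φ) z with hB
    set L := fderiv ℝ Φ z
    have hdec : ∀ θ : ℝ, ((R : ℂ) * Complex.exp (θ * I)) • ξ = (R * Real.cos θ) • ξ + (R * Real.sin θ) • (I • ξ) := by
      intro θ
      ext k
      simp [Complex.exp_mul_I]; ring
    have hpt : ∀ θ : ℝ, Φ (z + ((R : ℂ) * Complex.exp (θ * I)) • ξ) ≤ (Φ z + ε * (R ^ 2 * ‖ξ‖ ^ 2)) +
        (R * L ξ * Real.cos θ + R * L (I • ξ) * Real.sin θ + (R ^ 2 / 2 * B ξ ξ) * Real.cos θ ^ 2 +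
        (R ^ 2 / 2 * B (I • ξ) (I • ξ)) * Real.sin θ ^ 2 +
        (R ^ 2 / 2 * (B ξ (I • ξ) + B (I • ξ) ξ)) * (Real.sin θ * Real.cos θ)) := by
      intro θ
      have hn : ‖((R : ℂ) * Complex.exp (θ * I)) • ξ‖ = R * ‖ξ‖ := by
        rw [norm_smul, norm_mul, norm_real, Complex.norm_exp_ofReal_mul_I, mul_one, Real.norm_of_nonneg hR.le]
      have h2 := (abs_le.1 (ht _ (hn.trans_lt hR3))).2
      rw [hn, hdec] at h2
      rw [hdec]
      simp only [map_add, map_smul, add_apply, smul_apply, smul_eq_mul] at h2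
      nlinarith [h2]
    have hint : ∫ θ in (0:ℝ)..(2 * Real.pi), Φ (z + ((R : ℂ) * Complex.exp (θ * I)) • ξ) ≤
        ∫ θ in (0:ℝ)..(2 * Real.pi), ((Φ z + ε * (R ^ 2 * ‖ξ‖ ^ 2)) +
        (R * L ξ * Real.cos θ + R * L (I • ξ) * Real.sin θ + (R ^ 2 / 2 * B ξ ξ) * Real.cos θ ^ 2 +
        (R ^ 2 / 2 * B (I • ξ) (I • ξ)) * Real.sin θ ^ 2 +
        (R ^ 2 / 2 * (B ξ (I • ξ) + B (I • ξ) ξ)) * (Real.sin θ * Real.cos θ))) := by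
      have hc := hΦ.continuous
      refine intervalIntegral.integral_mono_on pS ?_ ?_ fun θ _ => hpt θ
      · exact Continuous.intervalIntegrable fP _ _
      · exact Continuous.intervalIntegrable fP _ _
    have ii : ∀ {g : ℝ → ℝ}, Continuous g → IntervalIntegrable g volume 0 (2 * Real.pi) := fun hg =>
      hg.intervalIntegrable _ _
    rw [intervalIntegral.integral_add (ii fP) (ii fP),
      intervalIntegral.integral_add (ii fP) (ii fP),
      intervalIntegral.integral_add (ii fP) (ii fP),
      intervalIntegral.integral_add (ii fP) (ii fP),
      intervalIntegral.integral_add (ii fP) (ii fP)] at hint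
    simp only [intervalIntegral.integral_const_mul, integral_cos, integral_sin, integral_cos_sq, integral_sin_sq,
      integral_sin_mul_cos₁, intervalIntegral.integral_const] at hint
    simp at hint
    rw [levi_dir hΦ, ← hB]
    have hpi := Real.pi_pos
    have h3 : Φ z * (2 * Real.pi) ≤ ∫ θ in (0:ℝ)..(2 * Real.pi), Φ (z + ((R : ℂ) * Complex.exp (θ * I)) • ξ) := by
      rw [inv_mul_eq_div, le_div_iff₀ pS] at h1; exact h1
    have h4 := h3.trans hint
    have h5 : 0 ≤ 2 * Real.pi * R ^ 2 * ((1 / 4) * (B ξ ξ + B (I • ξ) (I • ξ)) + ε * ‖ξ‖ ^ 2) := by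
      nlinarith [h4]
    exact nonneg_of_mul_nonneg_right h5 pS
  refine le_of_forall_pos_le_add fun δ hδ => ?_
  refine (key (δ / (‖ξ‖ ^ 2 + 1)) pS).trans ?_
  gcongr
  rw [div_mul_eq_mul_div, div_le_iff₀ pS]; nlinarith [sq_nonneg ‖ξ‖]
end

section
variable {n : ℕ} {Ω : Set (Cn n)} {z b : Cn n} {f : Fc n} {c : ℂ}

lemma wd_coord (b : Cn n) (j k : Fin n) (z : Cn n) :
    wd c j (fun x => x k - b k) z = if j = k then (1 + c * I) / 2 else 0 := by
  have h : HasFDerivAt (fun x : Cn n => x k - b k) (ContinuousLinearMap.proj (R := ℝ) (φ := fun _ => ℂ) k) z :=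
    (ContinuousLinearMap.proj (R := ℝ) (φ := fun _ : Fin n => ℂ) k).hasFDerivAt.sub_const (b k)
  simp only [wd]; rw [h.fderiv]
  simp only [ContinuousLinearMap.proj_apply, Pi.single_apply, eq_comm (a := j)]
  split_ifs <;> ring

lemma coord_smooth (b : Cn n) (k : Fin n) : ContDiff ℝ ∞ (fun x : Cn n => x k - b k) :=
  (contDiff_apply ℝ ℂ k).sub contDiff_const

lemma coord_star_smooth (b : Cn n) (k : Fin n) : ContDiff ℝ ∞ (fun x : Cn n => star (x k - b k)) :=
  conjCLE.contDiff.comp (coord_smooth b k)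

lemma wd_coord_star (b : Cn n) (j k : Fin n) (z : Cn n) :
    wd c j (fun x => star (x k - b k)) z = if j = k then (1 - c * I) / 2 else 0 := by
  rw [wd_conj ((coord_smooth b k).differentiable sM z), wd_coord]
  split_ifs
  · simp
    ring
  · simp

noncomputable def nsq (b z : Cn n) : ℝ := ∑ j, ‖z j - b j‖ ^ 2

lemma nsq_nonneg (b z : Cn n) : 0 ≤ nsq b z := Finset.sum_nonneg fun _ _ => sq_nonneg _

lemma nsq_smooth (b : Cn n) : ContDiff ℝ ∞ (nsq b) :=
  ContDiff.sum fun k _ => (coord_smooth b k).norm_sq ℝ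

lemma nsq_cx (b : Cn n) : cx (nsq b) = fun z => ∑ k, (z k - b k) * star (z k - b k) := by
  ext z
  simp only [cx, nsq, ofReal_sum]
  refine Finset.sum_congr rfl fun k _ => ?_
  rw [← Complex.normSq_eq_norm_sq, ← Complex.mul_conj]; rfl

lemma wd_nsq (b : Cn n) (j : Fin n) (z : Cn n) : wd c j (cx (nsq b)) z =
    (1 + c * I) / 2 * star (z j - b j) + (z j - b j) * ((1 - c * I) / 2) := by
  have h1 := fun k => (coord_smooth b k).differentiable sM z
  have h2 := fun k => (coord_star_smooth b k).differentiable sM z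
  rw [nsq_cx, wd_sum fun k _ => (h1 k).fun_mul (h2 k)]
  simp only [wd_mul (h1 _) (h2 _), wd_coord, wd_coord_star, ite_mul, mul_ite, zero_mul, mul_zero,
    Finset.sum_add_distrib, Finset.sum_ite_eq, Finset.mem_univ, if_true]

lemma wd_nsq_bar (b : Cn n) (j : Fin n) (z : Cn n) : wd I j (cx (nsq b)) z = z j - b j := by
  rw [wd_nsq, I_mul_I]; norm_num

lemma wd_nsq_del (b : Cn n) (j : Fin n) (z : Cn n) : wm j (cx (nsq b)) z = star (z j - b j) := by
  rw [wd_nsq, neg_mul, I_mul_I]; norm_num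

lemma levi_nsq (b z ξ : Cn n) : levi (nsq b) z ξ = ∑ j, ‖ξ j‖ ^ 2 := by
  have h : ∀ j k, wm k (wd I j (cx (nsq b))) z = if k = j then 1 else 0 := fun j k => by
    rw [show wd I j (cx (nsq b)) = fun x => x j - b j from funext (wd_nsq_bar b j), wd_coord]
    split_ifs <;> norm_num
  unfold levi
  simp only [h, ite_mul, one_mul, zero_mul, Finset.sum_ite_eq', Finset.mem_univ, if_true, re_sum]
  refine Finset.sum_congr rfl fun k _ => ?_
  rw [← Complex.normSq_eq_norm_sq, ← Complex.ofReal_re (normSq _), ← Complex.mul_conj]; rfl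

noncomputable def LA (b : Cn n) (k e : ℝ) (z ξ : Cn n) : ℝ :=
  k * ((∑ j, ‖ξ j‖ ^ 2) / (nsq b z + e) - ‖∑ j, star (z j - b j) * ξ j‖ ^ 2 / (nsq b z + e) ^ 2)

lemma levi_log (b : Cn n) {k e : ℝ} (he : 0 < e) (z ξ : Cn n) :
    levi (fun x => k * lG (nsq b x + e)) z ξ = LA b k e z ξ := by
  have h0 := nsq_nonneg b z
  have h1 : ∀ t : ℝ, 0 < t + e → HasDerivAt (fun t => k * lG (t + e)) (k * (t + e)⁻¹) t := fun t ht => by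
    simpa using ((Real.hasDerivAt_log ht.ne').comp_add_const t e).const_mul k
  have h2 : HasDerivAt (fun t => k * (t + e)⁻¹) (k * (-((nsq b z + e) ^ 2)⁻¹)) (nsq b z) := by
    simpa using ((hasDerivAt_inv (x := nsq b z + e) pS).comp_add_const (nsq b z) e).const_mul k
  have := levi_comp (z := z) (nsq_smooth b) (F := fun t => k * lG (t + e)) (F1 := fun t => k * (t + e)⁻¹)
    ((isOpen_lt continuous_const (by fun_prop : Continuous fun t : ℝ => t + e)).mem_nhds
      (show 0 < nsq b z + e by positivity) |> fun h => Filter.mem_of_superset h fun t ht => h1 t ht) h2 ξ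
  rw [this, levi_nsq]
  simp only [wd_nsq_del, LA]
  field_simp
  ring

lemma h_psd (w ξ : Cn n) {e : ℝ} (he : 0 < e) :
    ‖∑ j, star (w j) * ξ j‖ ^ 2 / ((∑ j, ‖w j‖ ^ 2) + e) ≤ ∑ j, ‖ξ j‖ ^ 2 := by
  have h0 : 0 ≤ ∑ j, ‖w j‖ ^ 2 := Finset.sum_nonneg fun _ _ => sq_nonneg _
  have h1 : 0 ≤ ∑ j, ‖ξ j‖ ^ 2 := Finset.sum_nonneg fun _ _ => sq_nonneg _
  rw [div_le_iff₀ pS]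
  have := cs_sum (fun j => star (w j)) ξ
  simp only [norm_star] at this
  nlinarith

lemma LA_nonneg (b : Cn n) {k e : ℝ} (hk : 0 ≤ k) (he : 0 < e) (z ξ : Cn n) : 0 ≤ LA b k e z ξ := by
  have h0 := nsq_nonneg b z
  have := h_psd (fun j => z j - b j) ξ he
  refine mul_nonneg hk ?_
  rw [sub_nonneg, pow_two (nsq b z + e), ← div_div]
  exact div_le_div_of_nonneg_right this pS

lemma h_alg {R h : ℝ} (hR : R ≠ 0) {w C l ξ : ℂ} (hξ : ξ = h * l + w * C / R) (hh : ‖w‖ ^ 2 = R * (1 - h)) :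
    ‖ξ - l‖ ^ 2 - ‖ξ‖ ^ 2 - ‖C - star w * l‖ ^ 2 / R = -‖C‖ ^ 2 / R - h * ‖l‖ ^ 2 := by
  have er : ξ.re = h * l.re + (w * C).re / R := by rw [hξ, add_re, div_ofReal_re]; simp
  have ei : ξ.im = h * l.im + (w * C).im / R := by rw [hξ, add_im, div_ofReal_im]; simp
  simp only [← Complex.normSq_eq_norm_sq, normSq_apply] at hh ⊢
  simp only [sub_re, sub_im, er, ei, mul_re, mul_im, star_def, conj_re, conj_im]
  field_simp
  linear_combination (-R * (l.re ^ 2 + l.im ^ 2)) * hh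

lemma h_cs (w ξ : Cn n) (i : Fin n) {e : ℝ} (he : 0 < e) :
    ‖ξ i - w i * (∑ j, star (w j) * ξ j) / (((∑ j, ‖w j‖ ^ 2) + e : ℝ) : ℂ)‖ ^ 2 ≤
    (1 - ‖w i‖ ^ 2 / ((∑ j, ‖w j‖ ^ 2) + e)) *
      ((∑ j, ‖ξ j‖ ^ 2) - ‖∑ j, star (w j) * ξ j‖ ^ 2 / ((∑ j, ‖w j‖ ^ 2) + e)) := by
  have h0 : ‖w i‖ ^ 2 ≤ ∑ j, ‖w j‖ ^ 2 :=
    Finset.single_le_sum (f := fun j => ‖w j‖ ^ 2) (fun _ _ => sq_nonneg _) (Finset.mem_univ i)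
  have hps := fun η : Cn n => h_psd w η he
  set R := (∑ j, ‖w j‖ ^ 2) + e
  have hR : 0 < R := by have := sq_nonneg ‖w i‖; linarith
  set C := ∑ j, star (w j) * ξ j with hC
  set x := ξ i - w i * C / (R : ℂ) with hx
  set h := 1 - ‖w i‖ ^ 2 / R with hh
  have hpos : 0 < h := by rw [hh, sub_pos, div_lt_one hR]; linarith
  set l : ℂ := x / (h : ℂ) with hl
  have hlx : x = h * l := by rw [hl]; field_simp [hpos.ne']
  have key := hps (fun j => ξ j - if j = i then l else 0)
  have e1 : ∑ j, star (w j) * (ξ j - if j = i then l else 0) = C - star (w i) * l := by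
    simp [mul_sub, Finset.sum_sub_distrib, hC]
  have e2 : ∑ j, ‖ξ j - if j = i then l else 0‖ ^ 2 = ∑ j, ‖ξ j‖ ^ 2 + (‖ξ i - l‖ ^ 2 - ‖ξ i‖ ^ 2) := by
    rw [← sub_eq_iff_eq_add', ← Finset.sum_sub_distrib, Finset.sum_eq_single i]
    · simp
    · intro j _ hj; simp [hj]
    · simp
  rw [e1, e2] at key
  have e3 : ‖ξ i - l‖ ^ 2 - ‖ξ i‖ ^ 2 - ‖C - star (w i) * l‖ ^ 2 / R = -‖C‖ ^ 2 / R - h * ‖l‖ ^ 2 := by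
    refine h_alg hR.ne' (by rw [← hlx, hx]; ring) ?_
    rw [hh]; field_simp; ring
  have e4 : ‖x‖ ^ 2 = h * (h * ‖l‖ ^ 2) := by
    rw [hlx, norm_mul, norm_real, Real.norm_of_nonneg hpos.le]; ring
  rw [e4]
  refine mul_le_mul_of_nonneg_left ?_ hpos.le
  have : -‖C‖ ^ 2 / R = -(‖C‖ ^ 2 / R) := neg_div _ _
  linarith

noncomputable def gq (b : Cn n) (i : Fin n) (e : ℝ) (z : Cn n) : ℂ := star (z i - b i) * ((nsq b z + e)⁻¹ : ℝ)

lemma gq_smooth (b : Cn n) (i : Fin n) {e : ℝ} (he : 0 < e) : ContDiff ℝ ∞ (gq b i e) := by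
  refine (coord_star_smooth b i).mul (ofRealCLM.contDiff.comp (((nsq_smooth b).add contDiff_const).inv fun z => ?_))
  have := nsq_nonneg b z; positivity

lemma wd_gq (b : Cn n) (i j : Fin n) {e : ℝ} (he : 0 < e) (z : Cn n) :
    wd I j (gq b i e) z = (if j = i then 1 else 0) * ((nsq b z + e)⁻¹ : ℝ) -
      star (z i - b i) * (z j - b j) * (((nsq b z + e) ^ 2)⁻¹ : ℝ) := by
  have h0 : 0 < nsq b z + e := by have := nsq_nonneg b z; positivity
  have hd := (nsq_smooth b).differentiable sM z
  have h1 : HasDerivAt (fun t : ℝ => (t + e)⁻¹) (-((nsq b z + e) ^ 2)⁻¹) (nsq b z) := by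
    simpa using ((hasDerivAt_inv h0.ne').comp_add_const (nsq b z) e)
  have h2 : DifferentiableAt ℝ (cx fun x => (nsq b x + e)⁻¹) z :=
    ofRealCLM.differentiableAt.comp z ((hd.add_const e).inv h0.ne')
  have := wd_mul (c := I) (j := j) ((coord_star_smooth b i).differentiable sM z) h2
  rw [wd_coord_star, wd_real hd h1, wd_nsq_bar] at this
  refine this.trans ?_
  simp only [cx, I_mul_I]
  push_cast
  split_ifs <;> ring

lemma gq_cs (b : Cn n) (i : Fin n) {e k : ℝ} (he : 0 < e) (hk : 0 < k) (z ξ : Cn n) (t : ℂ) :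
    ‖∑ j, star (ξ j) * (t * wd I j (gq b i e) z)‖ ^ 2 ≤
      (‖t‖ ^ 2 * ((1 - ‖z i - b i‖ ^ 2 / (nsq b z + e)) / (k * (nsq b z + e)))) * LA b k e z ξ := by
  have h := h_cs (fun j => z j - b j) ξ i he
  have hR : 0 < nsq b z + e := by have := nsq_nonneg b z; positivity
  change _ ≤ (1 - ‖z i - b i‖ ^ 2 / (nsq b z + e)) * (_ - _ / (nsq b z + e)) at h
  change ‖ξ i - (z i - b i) * _ / ((nsq b z + e : ℝ) : ℂ)‖ ^ 2 ≤ _ at h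
  have e1 : ∑ j, star (ξ j) * (t * wd I j (gq b i e) z) = t * (((nsq b z + e)⁻¹ : ℝ) : ℂ) *
      star (ξ i - (z i - b i) * (∑ j, star (z j - b j) * ξ j) / ((nsq b z + e : ℝ) : ℂ)) := by
    simp only [wd_gq b i _ he, star_sub, star_div₀, star_mul', star_sum, star_star]
    have : star ((nsq b z + e : ℝ) : ℂ) = ((nsq b z + e : ℝ) : ℂ) := conj_ofReal _
    rw [this]
    have hR' : ((nsq b z + e : ℝ) : ℂ) ≠ 0 := by exact_mod_cast hR.ne'
    simp only [mul_sub, Finset.sum_sub_distrib, ite_mul, mul_ite, zero_mul, one_mul, mul_zero, Finset.sum_ite_eq',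
      Finset.mem_univ, if_true, Finset.mul_sum, Finset.sum_div]
    push_cast at hR' ⊢
    congr 1
    · ring
    · refine Finset.sum_congr rfl fun j _ => ?_
      field_simp
      try ring
  rw [e1, norm_mul, norm_mul, norm_star, norm_real, norm_inv, Real.norm_of_nonneg hR.le, mul_pow, mul_pow, LA]
  have : ‖t‖ ^ 2 * ((1 - ‖z i - b i‖ ^ 2 / (nsq b z + e)) / (k * (nsq b z + e))) *
    (k * ((∑ j, ‖ξ j‖ ^ 2) / (nsq b z + e) - ‖∑ j, star (z j - b j) * ξ j‖ ^ 2 / (nsq b z + e) ^ 2)) =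
    ‖t‖ ^ 2 * ((nsq b z + e)⁻¹) ^ 2 * ((1 - ‖z i - b i‖ ^ 2 / (nsq b z + e)) *
      ((∑ j, ‖ξ j‖ ^ 2) - ‖∑ j, star (z j - b j) * ξ j‖ ^ 2 / (nsq b z + e))) := by
    field_simp
  rw [this]
  exact mul_le_mul_of_nonneg_left h pS

lemma weak_hol (hΩ : IsOpen Ω) (hf : DifferentiableOn ℂ f Ω) {θ : Fc n} (hθ : Tst Ω θ) (j : Fin n) :
    ∫ x, f x * wd I j θ x = 0 := by
  have hfd : ∀ z ∈ Ω, DifferentiableAt ℂ f z := fun z hz => hf.differentiableAt (hΩ.mem_nhds hz)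
  have hoff : ∀ z, z ∉ tsupport θ → θ =ᶠ[𝓝 z] 0 := fun z hz => notMem_tsupport_iff_eventuallyEq.1 hz
  set F : Fc n := fun z => f z * θ z with hF
  have hFoff : ∀ z, z ∉ tsupport θ → F =ᶠ[𝓝 z] 0 := fun z hz => by
    filter_upwards [hoff z hz] with x hx; simp [hF, hx]
  have hθd := hθ.sm.differentiable sM
  have hFd : Differentiable ℝ F := fun z => by
    by_cases hz : z ∈ tsupport θ
    · exact ((hfd z (hθ.su hz)).restrictScalars ℝ).mul (hθd z)
    · exact (differentiableAt_const (0:ℂ)).congr_of_eventuallyEq (hFoff z hz)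
  have hFs : HasCompactSupport F := hθ.cp.mul_left
  obtain ⟨δ, hδ, hδK⟩ := hθ.cp.exists_cthickening_subset_open hΩ hθ.su
  have hKc := hθ.cp.cthickening (r := δ)
  obtain ⟨M, hM⟩ := hKc.exists_bound_of_continuousOn (hf.continuousOn.mono hδK)
  have hder : ∀ v : Cn n, ‖v‖ ≤ 1 → ∀ z ∈ tsupport θ, ‖fderiv ℝ f z v‖ ≤ M / δ := fun v hv z hz => by
    have hz' := hfd z (hθ.su hz)
    have e1 : fderiv ℝ f z v = deriv (fun t : ℂ => f (z + t • v)) 0 := by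
      have h1 : HasDerivAt (fun t : ℂ => z + t • v) v 0 := by
        simpa using ((hasDerivAt_id (0:ℂ)).smul_const v).const_add z
      have h2 : HasFDerivAt f (fderiv ℂ f z) (z + (0:ℂ) • v) := by simpa using hz'.hasFDerivAt
      erw [(h2.comp_hasDerivAt (0:ℂ) h1).deriv]
      rw [(hz'.hasFDerivAt.restrictScalars ℝ).fderiv]; rfl
    have hin : ∀ t : ℂ, ‖t‖ ≤ δ → z + t • v ∈ cthickening δ (tsupport θ) := fun t ht => by
      refine closedBall_subset_cthickening hz δ ?_
      rw [mem_closedBall, dist_self_add_left, norm_smul]; nlinarith [norm_nonneg t, norm_nonneg v]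
    rw [e1]
    refine norm_deriv_le_of_forall_mem_sphere_norm_le hδ ?_ fun t ht => hM _ (hin t (by simpa using ht.le))
    have hd : DifferentiableOn ℂ (fun t : ℂ => f (z + t • v)) (closedBall 0 δ) := fun t ht => by
      refine DifferentiableAt.differentiableWithinAt ?_
      exact (hfd _ (hδK (hin t (by simpa using ht)))).comp t fP
    exact (hd.mono closure_ball_subset_closedBall).diffContOnCl
  have hint : ∀ v : Cn n, ‖v‖ ≤ 1 → Integrable (fun x => fderiv ℝ F x v) ∧ ∫ x, fderiv ℝ F x v = 0 := fun v hv => by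
    obtain ⟨C1, hC1⟩ := hθ.cp.exists_bound_of_continuousOn hθ.sm.continuous.continuousOn
    have hθc : Continuous fun x => fderiv ℝ θ x v := (hθ.sm.continuous_fderiv sM).clm_apply continuous_const
    obtain ⟨C2, hC2⟩ := hθ.cp.exists_bound_of_continuousOn hθc.continuousOn
    have hi : Integrable fun x => fderiv ℝ F x v := by
      have : IntegrableOn (fun x => fderiv ℝ F x v) (tsupport θ) := by
        refine Measure.integrableOn_of_bounded (M := M * C2 + C1 * (M / δ)) hθ.cp.measure_lt_top.ne
          (measurable_fderiv_apply_const ℝ F v).aestronglyMeasurable ?_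
        refine (ae_restrict_iff' hθ.cp.measurableSet).2 (Eventually.of_forall fun x hx => ?_)
        rw [hF, fderiv_fun_mul ((hfd x (hθ.su hx)).restrictScalars ℝ) (hθd x)]
        simp only [add_apply, smul_apply, smul_eq_mul]
        refine (norm_add_le _ _).trans ?_
        rw [norm_mul, norm_mul]
        have a1 := hM x (self_subset_cthickening _ hx)
        have a2 := hC2 x hx
        have a3 := hC1 x hx
        have a4 := hder v hv x hx
        have := norm_nonneg (f x)
        have := norm_nonneg (θ x)
        gcongr
        · linarith
        · linarith
      rwa [integrableOn_iff_integrable_of_support_subset] at this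
      intro x hx
      by_contra h
      exact hx (by beta_reduce; rw [(hFoff x h).fderiv_eq]; simp)
    have hFi : Integrable F := hFd.continuous.integrable_of_hasCompactSupport hFs
    have := integral_bilinear_fderiv_right_eq_neg_left_of_integrable (μ := (volume : Measure (Cn n)))
      (f := fun _ : Cn n => (1:ℂ)) (g := F) (v := v) (B := ContinuousLinearMap.mul ℝ ℂ) sM (by simpa using hi)
      (by simpa using hFi) (fun x _ => differentiableAt_const _) (fun x _ => hFd x)
    exact ⟨hi, by simpa using this⟩
  have hi2 : ∀ x, f x * wd I j θ x = wd I j F x := fun x => by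
    by_cases hx : x ∈ tsupport θ
    · rw [hF, wd_mul ((hfd x (hθ.su hx)).restrictScalars ℝ) (hθd x), wd_of_hol (hfd x (hθ.su hx))]; simp
    · rw [wd_congr (hFoff x hx), wd_congr (hoff x hx)]
      simp [wd]
  obtain ⟨i1, i2⟩ := hint (Pi.single j 1) (by rw [Pi.norm_single]; simp)
  obtain ⟨i3, i4⟩ := hint (Pi.single j I) (by rw [Pi.norm_single]; simp)
  simp only [hi2]
  simp only [wd]
  rw [integral_const_mul]
  rw [integral_add i1 (i3.const_mul I), integral_const_mul, i2, i4]
  simp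
end

section
variable {n : ℕ} {D : Set (Cn n)}

lemma dist_bdd (hbd : Bornology.IsBounded D) (hne : Dᶜ.Nonempty) : ∃ M, 0 < M ∧ ∀ z, infDist z Dᶜ ≤ M := by
  obtain ⟨p, hp⟩ := hne
  obtain ⟨M, hM⟩ := hbd.subset_closedBall p
  refine ⟨M ⊔ 1, by positivity, fun z => ?_⟩
  by_cases hz : z ∈ D
  · exact (infDist_le_dist_of_mem hp).trans ((hM hz).trans (le_max_left _ _))
  · rw [infDist_zero_of_mem (show z ∈ Dᶜ from hz)]; positivity

lemma idist_pos (hopen : IsOpen D) (hne : Dᶜ.Nonempty) {z : Cn n} (hz : z ∈ D) : 0 < infDist z Dᶜ :=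
  (hopen.isClosed_compl.notMem_iff_infDist_pos hne).1 fun h => h hz

lemma mem_of_dist {z : Cn n} (h : 0 < infDist z Dᶜ) : z ∈ D := by
  by_contra h1
  rw [infDist_zero_of_mem (show z ∈ Dᶜ from h1)] at h
  exact lt_irrefl _ h

lemma psc_mean (hopen : IsOpen D) (hbd : Bornology.IsBounded D) (hpsc : IsPseudoconvex D) (hne : Dᶜ.Nonempty)
    (z ξ : Cn n) {R : ℝ} (hR : 0 < R) (hball : ∀ l : ℂ, ‖l‖ ≤ R → z + l • ξ ∈ D) :
    -lG (infDist z Dᶜ) ≤ (2 * Real.pi)⁻¹ * ∫ θ in (0:ℝ)..(2 * Real.pi),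
      -lG (infDist (z + ((R : ℂ) * Complex.exp (θ * I)) • ξ) Dᶜ) := by
  obtain ⟨M, hM0, hM⟩ := dist_bdd hbd hne
  obtain ⟨N, hN⟩ := exists_nat_ge (lG M)
  have h := (hpsc.2.2 z ξ).2.2 0 (by simpa using hball 0 (by simpa using hR.le)) R hR
    (fun l hl => hball l (by simpa using hl))
  have h1 := h.trans (iInf_le _ N)
  rw [EReal.coe_le_coe_iff, zero_smul, add_zero] at h1
  refine h1.trans (le_of_eq ?_)
  unfold circleAvgTrunc
  congr 1
  refine intervalIntegral.integral_congr fun θ _ => ?_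
  simp only [zero_add]
  have hd : 0 < infDist (z + ((R : ℂ) * Complex.exp (θ * I)) • ξ) Dᶜ := idist_pos hopen hne (hball _ (by
    rw [norm_mul, norm_real, Complex.norm_exp_ofReal_mul_I, mul_one, Real.norm_of_nonneg hR.le]))
  have h2 : -(N:ℝ) ≤ -lG (infDist (z + ((R : ℂ) * Complex.exp (θ * I)) • ξ) Dᶜ) :=
    neg_le_neg ((Real.log_le_log hd (hM _)).trans hN)
  rw [max_eq_left, EReal.toReal_coe]
  exact_mod_cast h2

lemma exhaust (hopen : IsOpen D) (hbd : Bornology.IsBounded D) (hpsc : IsPseudoconvex D) (hne : Dᶜ.Nonempty)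
    {L : Set (Cn n)} (hL : IsCompact L) (hLD : L ⊆ D) :
    ∃ (s : Cn n → ℝ) (Ω : Set (Cn n)) (S G : ℝ), ContDiff ℝ ∞ s ∧ IsOpen Ω ∧ L ⊆ Ω ∧ Ω ⊆ D ∧
      (∀ z ∈ Ω, 0 < s z) ∧ (∀ z ∈ L, 1 ≤ s z) ∧ (∀ c' > 0, IsCompact {z | z ∈ Ω ∧ c' ≤ s z}) ∧
      (∀ z ∈ Ω, ∀ ξ, levi s z ξ ≤ -∑ j, ‖ξ j‖ ^ 2) ∧ (∀ z ∈ Ω, s z ≤ S) ∧ 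
      ∀ z ∈ Ω, ∑ j, ‖wm j (cx s) z‖ ^ 2 ≤ G := by
  set d : Cn n → ℝ := fun z => infDist z Dᶜ with hd
  have dc : Continuous d := continuous_infDist_pt _
  have dl : ∀ x y, d x ≤ d y + dist x y := fun x y => infDist_le_infDist_add_dist
  have dD : ∀ z ∈ D, 0 < d z := fun z hz => idist_pos hopen hne hz
  obtain ⟨M1, hM10, hM1⟩ := dist_bdd hbd hne
  obtain ⟨d0, hd0, hd0L⟩ : ∃ d0, 0 < d0 ∧ ∀ z ∈ L, d0 ≤ d z := by
    rcases L.eq_empty_or_nonempty with rfl | hLn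
    · exact ⟨1, one_pos, by simp⟩
    · obtain ⟨x, hx, hx2⟩ := hL.exists_isMinOn hLn dc.continuousOn
      exact ⟨d x, dD x (hLD hx), fun z hz => hx2 hz⟩
  have hq : ContDiff ℝ ∞ (nsq (0 : Cn n)) := nsq_smooth 0
  obtain ⟨M, hM⟩ := hL.exists_bound_of_continuousOn hq.continuous.continuousOn
  set c : ℝ := 1 + lG 2 + M - lG d0 with hc
  set d1 : ℝ := eX (-c) / 2 with hd1
  have hd1p : 0 < d1 := by positivity
  obtain ⟨η, hη, hη1⟩ : ∃ η : ℝ, 0 < η ∧ η < min d0 d1 / 2 := exists_between pS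
  have hη0 : 2 * η < d0 := by have := min_le_left d0 d1; linarith
  have hη2 : 2 * η < d1 := by have := min_le_right d0 d1; linarith
  obtain ⟨m, hm⟩ := exists_nat_one_div_lt hη
  set v : Cn n → ℝ := fun z => -lG (max (d z) η) with hv
  have hmx : ∀ z, 0 < max (d z) η := fun z => lt_max_of_lt_right hη
  have vc : Continuous v := ((dc.max continuous_const).log fun z => (hmx z).ne').neg
  have vb : ∀ z, ‖v z‖ ≤ |lG η| + |lG (max M1 η)| := fun z => by
    have h1 : lG η ≤ lG (max (d z) η) := Real.log_le_log hη (le_max_right _ _)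
    have h2 : lG (max (d z) η) ≤ lG (max M1 η) :=
      Real.log_le_log (hmx z) (max_le_max_right _ (hM1 z))
    rw [Real.norm_eq_abs, hv, abs_neg, abs_le]
    have := neg_abs_le (lG η)
    have := le_abs_self (lG (max M1 η))
    have := abs_nonneg (lG η)
    have := abs_nonneg (lG (max M1 η))
    constructor <;> linarith
  have vl : LocallyIntegrable v := vc.locallyIntegrable
  set V : Cn n → ℝ := moll m v with hV
  have Vs : ContDiff ℝ ∞ V := moll_smooth m vl
  have hrs : ∀ y, rho n m y ≠ 0 → ‖y‖ < η := fun y hy => by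
    have : y ∈ ball (0 : Cn n) (1 / ((m:ℝ) + 1)) := by rw [← rho_supp]; exact hy
    exact (mem_ball_zero_iff.1 this).trans hm
  have hcmp : ∀ z, 2 * η < d z → ∀ y, ‖y‖ < η → |v (z - y) + lG (d z)| ≤ lG 2 := fun z hz y hy => by
    have h1 := dl z (z - y)
    have h2 := dl (z - y) z
    have e1 : dist z (z - y) = ‖y‖ := by simp
    rw [dist_comm (z - y), e1] at h2
    rw [e1] at h1
    have h3 : max (d (z - y)) η = d (z - y) := max_eq_left lA
    have hp : 0 < d (z - y) := by linarith
    have hp2 : 0 < d z := by linarith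
    simp only [hv, h3]
    have a1 : lG (d z) ≤ lG 2 + lG (d (z - y)) := by
      rw [← Real.log_mul nN hp.ne']; exact Real.log_le_log hp2 lA
    have a2 : lG (d (z - y)) ≤ lG 2 + lG (d z) := by
      rw [← Real.log_mul nN hp2.ne']; exact Real.log_le_log hp lA
    rw [abs_le]; constructor <;> linarith
  have hVd : ∀ z, 2 * η < d z → |V z + lG (d z)| ≤ lG 2 := fun z hz => by
    have e1 : V z + lG (d z) = ∫ y, rho n m y * (v (z - y) + lG (d z)) := by
      simp only [mul_add, ← smul_eq_mul (rho n m _) (v _)]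
      rw [integral_add (moll_integrable m vl z) ((rho_integrable m).mul_const _), integral_mul_const, rho_int,
        one_mul, hV, moll_apply']
    rw [e1, ← Real.norm_eq_abs]
    have := norm_integral_le_of_norm_le (μ := (volume : Measure (Cn n)))
      (f := fun y => rho n m y * (v (z - y) + lG (d z)))
      (g := fun y => rho n m y * lG 2) ((rho_integrable m).mul_const _) (Eventually.of_forall fun y => by
        rw [norm_mul, Real.norm_of_nonneg (rho_nonneg m y)]
        by_cases hy : rho n m y = 0
        · simp [hy]
        · exact mul_le_mul_of_nonneg_left (hcmp z hz y (hrs y hy)) (rho_nonneg m y))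
    rwa [integral_mul_const, rho_int, one_mul] at this
  have hVl : ∀ z, 2 * η < d z → ∀ ξ, 0 ≤ levi V z ξ := fun z hz ξ => by
    refine levi_nonneg Vs z ξ (R0 := (d z - 2 * η) / (‖ξ‖ + 1)) (div_pos lA pS) fun R hR hR0 => ?_
    rw [lt_div_iff₀ pS] at hR0
    have hnb : ∀ y : Cn n, ‖y‖ < η → ∀ l : ℂ, ‖l‖ ≤ R → η < d (z - y + l • ξ) := fun y hy l hl => by
      have h1 := dl z (z - y + l • ξ)
      have h2 : dist z (z - y + l • ξ) ≤ ‖y‖ + R * ‖ξ‖ := by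
        rw [dist_eq_norm, show z - (z - y + l • ξ) = y - l • ξ by abel]
        refine (norm_sub_le _ _).trans ?_
        rw [norm_smul]; gcongr
      nlinarith
    have hvd : ∀ y : Cn n, ‖y‖ < η → ∀ l : ℂ, ‖l‖ ≤ R → v (z - y + l • ξ) = -lG (d (z - y + l • ξ)) :=
      fun y hy l hl => by simp only [hv]; rw [max_eq_left (hnb y hy l hl).le]
    have hsub : ∀ y : Cn n, ‖y‖ < η → v (z - y) ≤ (2 * Real.pi)⁻¹ * ∫ θ in (0:ℝ)..(2 * Real.pi),
        v (z - y + ((R : ℂ) * Complex.exp (θ * I)) • ξ) := fun y hy => by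
      have h1 := psc_mean hopen hbd hpsc hne (z - y) ξ hR fun l hl =>
        mem_of_dist (hη.trans (hnb y hy l hl))
      have h2 := hvd y hy 0 (by simpa using hR.le)
      rw [zero_smul, add_zero] at h2
      rw [h2]
      refine h1.trans (le_of_eq ?_)
      congr 1
      refine intervalIntegral.integral_congr fun θ _ => ?_
      beta_reduce
      rw [hvd y hy _ (by
        rw [norm_mul, norm_real, Complex.norm_exp_ofReal_mul_I, mul_one, Real.norm_of_nonneg hR.le])]
    have hI : Integrable (Function.uncurry fun (θ : ℝ) (y : Cn n) =>
        rho n m y * v (z - y + ((R : ℂ) * Complex.exp (θ * I)) • ξ))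
        ((volume.restrict (Set.uIoc 0 (2 * Real.pi))).prod volume) := by
      have : IsFiniteMeasure (volume.restrict (Set.uIoc 0 (2 * Real.pi))) := by
        constructor; rw [Measure.restrict_apply_univ]; simp [Set.uIoc]
      refine ((rho_integrable m).comp_snd (volume.restrict (Set.uIoc 0 (2 * Real.pi)))).mul_bdd
        (c := |lG η| + |lG (max M1 η)|) ?_ (Eventually.of_forall fun p => vb _)
      exact (vc.comp fP).aestronglyMeasurable
    have hsw : ∫ θ in (0:ℝ)..(2 * Real.pi), V (z + ((R : ℂ) * Complex.exp (θ * I)) • ξ) =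
        ∫ y, rho n m y * ∫ θ in (0:ℝ)..(2 * Real.pi), v (z - y + ((R : ℂ) * Complex.exp (θ * I)) • ξ) := by
      simp only [← intervalIntegral.integral_const_mul]
      rw [← intervalIntegral_integral_swap hI]
      refine intervalIntegral.integral_congr fun θ _ => ?_
      beta_reduce
      rw [hV, moll_apply']
      refine integral_congr_ae (Eventually.of_forall fun y => ?_)
      beta_reduce
      rw [smul_eq_mul, add_sub_right_comm]
    rw [hsw, ← integral_const_mul, hV, moll_apply']
    refine integral_mono (moll_integrable m vl z) ?_ fun y => ?_
    · refine Integrable.const_mul ?_ _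
      refine (rho_integrable m).mul_bdd (c := (|lG η| + |lG (max M1 η)|) * (2 * Real.pi)) ?_ ?_
      · refine Continuous.aestronglyMeasurable ?_
        exact intervalIntegral.continuous_parametric_intervalIntegral_of_continuous' (by
          refine vc.comp (f := fun p : Cn n × ℝ => z - p.1 + ((R : ℂ) * Complex.exp (p.2 * I)) • ξ) fP) _ _
      · refine Eventually.of_forall fun y => ?_
        refine (intervalIntegral.norm_integral_le_of_norm_le_const fun θ _ => vb _).trans (le_of_eq ?_)
        rw [sub_zero, abs_of_pos (show (0:ℝ) < 2 * Real.pi by positivity)]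
    · beta_reduce
      by_cases hy : rho n m y = 0
      · simp [hy]
      · rw [smul_eq_mul, mul_left_comm]
        exact mul_le_mul_of_nonneg_left (hsub y (hrs y hy)) (rho_nonneg m y)
  set s : Cn n → ℝ := fun z => c - V z - nsq 0 z with hs
  have ss : ContDiff ℝ ∞ s := (contDiff_const.sub Vs).sub hq
  set Ω : Set (Cn n) := {z | 2 * η < d z} ∩ {z | 0 < s z} with hΩ
  have hΩo : IsOpen Ω := (isOpen_lt continuous_const dc).inter (isOpen_lt continuous_const ss.continuous)
  have hΩD : Ω ⊆ D := fun z hz => mem_of_dist (lt_trans pS hz.1)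
  have hk : ∀ z ∈ Ω, d1 ≤ d z := fun z hz => by
    have h1 := abs_le.1 (hVd z hz.1)
    have h2 : 0 < c - V z - nsq 0 z := hz.2
    have h3 := nsq_nonneg 0 z
    have hdz : 0 < d z := lt_trans pS hz.1
    have h4 : -c - lG 2 ≤ lG (d z) := by linarith [h1.1]
    rw [hd1, div_le_iff₀ nN, ← Real.exp_log hdz, ← Real.exp_log (show (0:ℝ) < 2 by norm_num), ← Real.exp_add]
    exact Real.exp_le_exp.2 lA
  have hLs : ∀ z ∈ L, 1 ≤ s z := fun z hz => by
    have h0 := hd0L z hz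
    have h1 := abs_le.1 (hVd z lA)
    have h2 := Real.log_le_log hd0 h0
    have h3 := (le_abs_self _).trans (hM z hz)
    simp only [hs, hc]; linarith [h1.2]
  have hbc : IsCompact (closure Ω) := (hbd.subset hΩD).isCompact_closure
  obtain ⟨S, hS⟩ := hbc.exists_bound_of_continuousOn ss.continuous.continuousOn
  have hgc : Continuous fun z => ∑ j, ‖wm j (cx s) z‖ ^ 2 :=
    continuous_finsetSum _ fun j _ => (wd_smooth (cx_smooth ss)).continuous.norm.pow 2
  obtain ⟨G, hG⟩ := hbc.exists_bound_of_continuousOn hgc.continuousOn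
  refine ⟨s, Ω, S, G, ss, hΩo, fun z hz => ⟨lt_of_lt_of_le hη0 (hd0L z hz), lt_of_lt_of_le one_pos (hLs z hz)⟩, hΩD,
    fun z hz => hz.2, hLs, fun c' hc' => ?_, fun z hz ξ => ?_, fun z hz => (le_abs_self _).trans (hS z (subset_closure hz)),
    fun z hz => (le_abs_self _).trans (hG z (subset_closure hz))⟩
  · have e : {z | z ∈ Ω ∧ c' ≤ s z} = {z | d1 ≤ d z} ∩ {z | c' ≤ s z} := by
      ext z
      exact ⟨fun h => ⟨hk z h.1, h.2⟩, fun h => ⟨⟨lt_of_lt_of_le hη2 h.1, lt_of_lt_of_le hc' h.2⟩, h.2⟩⟩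
    refine Metric.isCompact_of_isClosed_isBounded ?_ (hbd.subset fun z hz => hΩD hz.1)
    rw [e]
    exact (isClosed_le continuous_const dc).inter (isClosed_le continuous_const ss.continuous)
  · have h1 := levi_add (z := z) isOpen_univ (mem_univ z) ss.contDiffOn (Vs.add hq).contDiffOn ξ
    have h2 := levi_add (z := z) isOpen_univ (mem_univ z) Vs.contDiffOn hq.contDiffOn ξ
    have e : (fun x => s x + (V x + nsq 0 x)) = fun _ => c := by ext x; simp only [hs]; ring
    have h3 : levi (fun _ : Cn n => c) z ξ = 0 := by
      have : ∀ j, wd I j (cx fun _ : Cn n => c) = fun _ => 0 := fun j => by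
        ext x
        rw [show (cx fun _ : Cn n => c) = fun _ => (c : ℂ) from rfl]; simp [wd]
      simp only [levi, this]; simp [wd]
    rw [e, h3] at h1
    have h4 := hVl z hz.1 ξ
    rw [levi_nsq] at h2
    change 0 = levi s z ξ + levi (fun x => V x + nsq 0 x) z ξ at h1
    linarith
end

section
variable {n : ℕ} {D Ω : Set (Cn n)}

lemma st_deriv : ∃ C, 0 ≤ C ∧ ∀ t, |deriv Real.smoothTransition t| ≤ C ∧ (2 < t + 1 → deriv Real.smoothTransition t = 0) := by
  have hc : Continuous (deriv Real.smoothTransition) :=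
    (Real.smoothTransition.contDiff (n := 1)).continuous_deriv le_rfl
  have h1 : ∀ t, 2 < t + 1 → deriv Real.smoothTransition t = 0 := fun t ht => by
    have : Real.smoothTransition =ᶠ[𝓝 t] fun _ => 1 := by
      filter_upwards [lt_mem_nhds (show 1 < t by linarith)] with x hx
      exact Real.smoothTransition.one_of_one_le hx.le
    rw [this.deriv_eq]; simp
  have h2 : ∀ t, t < 0 → deriv Real.smoothTransition t = 0 := fun t ht => by
    have : Real.smoothTransition =ᶠ[𝓝 t] fun _ => 0 := by
      filter_upwards [gt_mem_nhds ht] with x hx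
      exact Real.smoothTransition.zero_of_nonpos hx.le
    rw [this.deriv_eq]; simp
  obtain ⟨C, hC⟩ := (isCompact_Icc (a := (0:ℝ)) (b := 1)).exists_bound_of_continuousOn hc.continuousOn
  refine ⟨C ⊔ 0, le_sup_right, fun t => ⟨?_, h1 t⟩⟩
  by_cases ht : t ∈ Icc (0:ℝ) 1
  · exact (hC t ht).trans le_sup_left
  · rw [mem_Icc, not_and_or, not_le, not_le] at ht
    rcases ht with ht | ht
    · rw [h2 t ht]; simp
    · rw [h1 t lA]; simp

lemma cutoffs {s : Cn n → ℝ} (ss : ContDiff ℝ ∞ s) (hΩ : IsOpen Ω) (hs : ∀ z ∈ Ω, 0 < s z)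
    (hK : ∀ c' > 0, IsCompact {z | z ∈ Ω ∧ c' ≤ s z}) {G : ℝ} (hG : ∀ z ∈ Ω, ∑ j, ‖wm j (cx s) z‖ ^ 2 ≤ G) :
    ∃ (χ : ℕ → Cn n → ℝ) (C : ℝ), (∀ N, Tst Ω (cx (χ N))) ∧ (∀ N z, χ N z ∈ Icc (0:ℝ) 1) ∧ 
      (∀ N, ∀ z ∈ Ω, ∑ j, ‖wm j (cx (χ N)) z‖ ^ 2 + ∑ j, ‖wd I j (cx (χ N)) z‖ ^ 2 ≤ C / s z ^ 2) ∧
      (∀ z ∈ Ω, ∀ᶠ N in atTop, χ N z = 1 ∧ ∀ c j, wd c j (cx (χ N)) z = 0) := by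
  obtain ⟨C, hC0, hC⟩ := st_deriv
  set u : ℕ → Cn n → ℝ := fun N z => Real.smoothTransition (((N:ℝ) + 1) * s z - 1) with hu
  have us : ∀ N, ContDiff ℝ ∞ (u N) := fun N =>
    Real.smoothTransition.contDiff.comp ((contDiff_const.mul ss).sub contDiff_const)
  set χ : ℕ → Cn n → ℝ := fun N => Ω.indicator (u N) with hχ
  have e1 : ∀ N, ∀ z ∈ Ω, χ N =ᶠ[𝓝 z] u N := fun N z hz => by
    filter_upwards [hΩ.mem_nhds hz] with x hx; exact indicator_of_mem hx _
  have e1c : ∀ N, ∀ z ∈ Ω, cx (χ N) =ᶠ[𝓝 z] cx (u N) := fun N z hz => by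
    filter_upwards [e1 N z hz] with x hx; simp [cx, hx]
  set K : ℕ → Set (Cn n) := fun N => {z | z ∈ Ω ∧ 1 / ((N:ℝ) + 1) ≤ s z} with hKd
  have hKN : ∀ N, IsCompact (K N) := fun N => hK _ pS
  have h0 : ∀ N, ∀ z ∉ K N, χ N z = 0 := fun N z hz => by
    by_cases hzΩ : z ∈ Ω
    · have : s z < 1 / ((N:ℝ) + 1) := by by_contra h; exact hz ⟨hzΩ, not_lt.1 h⟩
      rw [lt_div_iff₀ pS] at this
      rw [hχ]; simp only [indicator_of_mem hzΩ]
      exact Real.smoothTransition.zero_of_nonpos lA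
    · exact indicator_of_notMem hzΩ _
  have hts : ∀ N, tsupport (cx (χ N)) ⊆ K N := fun N => closure_minimal (fun z hz => by
    by_contra h; exact hz (by simp [cx, h0 N z h])) (hKN N).isClosed
  have hsm : ∀ N, ContDiff ℝ ∞ (χ N) := fun N => contDiff_iff_contDiffAt.2 fun z => by
    by_cases hz : z ∈ Ω
    · exact (us N).contDiffAt.congr_of_eventuallyEq (e1 N z hz)
    · refine (contDiffAt_const (c := (0:ℝ))).congr_of_eventuallyEq ?_
      filter_upwards [(hKN N).isClosed.isOpen_compl.mem_nhds (show z ∈ (K N)ᶜ from fun h => hz h.1)] with x hx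
      exact h0 N x hx
  have hw : ∀ N, ∀ z ∈ Ω, ∀ c j, wd c j (cx (χ N)) z =
      ((deriv Real.smoothTransition (((N:ℝ) + 1) * s z - 1) * ((N:ℝ) + 1) : ℝ) : ℂ) * wd c j (cx s) z := fun N z hz c j => by
    rw [wd_congr (e1c N z hz)]
    have h1 : HasDerivAt (fun t : ℝ => Real.smoothTransition (((N:ℝ) + 1) * t - 1))
        (deriv Real.smoothTransition (((N:ℝ) + 1) * s z - 1) * ((N:ℝ) + 1)) (s z) := by
      have a : HasDerivAt (fun t : ℝ => ((N:ℝ) + 1) * t - 1) ((N:ℝ) + 1) (s z) := by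
        simpa using ((hasDerivAt_id (s z)).const_mul ((N:ℝ) + 1)).sub_const 1
      exact ((Real.smoothTransition.contDiff (n := 1)).differentiable sM _).hasDerivAt.comp (s z) a
    exact wd_real (ss.differentiable sM z) h1
  refine ⟨χ, 8 * C ^ 2 * G, fun N => ⟨cx_smooth (hsm N), (hKN N).of_isClosed_subset (isClosed_tsupport _) (hts N),
    (hts N).trans fun z hz => hz.1⟩, fun N z => ?_, fun N z hz => ?_, fun z hz => ?_⟩
  · by_cases hz : z ∈ Ω
    · simp only [hχ, indicator_of_mem hz]
      exact ⟨Real.smoothTransition.nonneg _, Real.smoothTransition.le_one _⟩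
    · simp only [hχ, indicator_of_notMem hz]; simp
  · have hn : ∀ j, ‖wd I j (cx s) z‖ = ‖wm j (cx s) z‖ := fun j => by
      rw [wd_cx_star (c := I) (ss.differentiable sM z), norm_star]; simp
    simp only [hw N z hz, norm_mul, mul_pow, hn, ← Finset.mul_sum]
    have hsz := hs z hz
    have hq : ‖((deriv Real.smoothTransition (((N:ℝ) + 1) * s z - 1) * ((N:ℝ) + 1) : ℝ) : ℂ)‖ ^ 2 ≤ 4 * C ^ 2 / s z ^ 2 := by
      rw [norm_real, Real.norm_eq_abs, sq_abs]
      have hN : (0:ℝ) < (N:ℝ) + 1 := by positivity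
      rw [le_div_iff₀ pS]
      by_cases hh : 2 < ((N:ℝ) + 1) * s z - 1 + 1
      · rw [(hC _).2 hh]; simp; positivity
      · have a1 := (hC (((N:ℝ) + 1) * s z - 1)).1
        have a2 : ((N:ℝ) + 1) * s z ≤ 2 := by linarith
        have a3 : (deriv Real.smoothTransition (((N:ℝ) + 1) * s z - 1)) ^ 2 ≤ C ^ 2 := by
          rw [← sq_abs]; gcongr
        have a4 : (((N:ℝ) + 1) * s z) ^ 2 ≤ 2 ^ 2 := by gcongr
        calc _ = (deriv Real.smoothTransition (((N:ℝ) + 1) * s z - 1)) ^ 2 * (((N:ℝ) + 1) * s z) ^ 2 := by ring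
          _ ≤ C ^ 2 * 2 ^ 2 := by gcongr
          _ = _ := by ring
    have hg := hG z hz
    have hg0 : 0 ≤ ∑ j, ‖wm j (cx s) z‖ ^ 2 := Finset.sum_nonneg fun _ _ => sq_nonneg _
    calc _ = 2 * (‖((deriv Real.smoothTransition (((N:ℝ) + 1) * s z - 1) * ((N:ℝ) + 1) : ℝ) : ℂ)‖ ^ 2 *
          ∑ j, ‖wm j (cx s) z‖ ^ 2) := by ring
      _ ≤ 2 * (4 * C ^ 2 / s z ^ 2 * G) := by gcongr
      _ = _ := by ring
  · have ht : Tendsto (fun N : ℕ => ((N:ℝ) + 1) * s z) atTop atTop :=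
      (tendsto_atTop_add_const_right _ _ tendsto_natCast_atTop_atTop).atTop_mul_const (hs z hz)
    filter_upwards [ht.eventually_gt_atTop 2] with N hN
    refine ⟨?_, fun c j => ?_⟩
    · simp only [hχ, indicator_of_mem hz]
      exact Real.smoothTransition.one_of_one_le lA
    · rw [hw N z hz, (hC _).2 lA]; simp
end

section
variable {n : ℕ} {D Ω : Set (Cn n)} {f : Fc n}

noncomputable def pw (b : Cn n) (k e : ℝ) (z : Cn n) : ℝ := eX (k * lG (nsq b z + e))

lemma pw_pos (b : Cn n) (k e : ℝ) (z : Cn n) : 0 < pw b k e z := Real.exp_pos _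

lemma pw_meas (b : Cn n) (k e : ℝ) : Measurable (pw b k e) := by
  have : Measurable (nsq b) := (nsq_smooth b).continuous.measurable
  unfold pw; fun_prop

noncomputable def ah (b : Cn n) (i : Fin n) (k e : ℝ) (f : Fc n) (z : Cn n) : ℝ :=
  ‖f z‖ ^ 2 * ((1 - ‖z i - b i‖ ^ 2 / (nsq b z + e)) / (k * (nsq b z + e)))

lemma ah_meas (b : Cn n) (i : Fin n) (k e : ℝ) (hf : Measurable f) : Measurable (ah b i k e f) := by
  have : Measurable (nsq b) := (nsq_smooth b).continuous.measurable
  unfold ah; fun_prop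

lemma ci_le (b z : Cn n) (i : Fin n) : ‖z i - b i‖ ^ 2 ≤ nsq b z :=
  Finset.single_le_sum (f := fun j => ‖z j - b j‖ ^ 2) (fun _ _ => sq_nonneg _) (Finset.mem_univ i)

lemma ah_nonneg (b : Cn n) (i : Fin n) {k e : ℝ} (hk : 0 ≤ k) (he : 0 ≤ e) (f : Fc n) (z : Cn n) :
    0 ≤ ah b i k e f z := by
  have h0 := nsq_nonneg b z
  have h1 : ‖z i - b i‖ ^ 2 / (nsq b z + e) ≤ 1 := div_le_one_of_le₀ (by linarith [ci_le b z i]) pS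
  exact mul_nonneg (sq_nonneg _) (div_nonneg lA pS)

lemma ah_le (b : Cn n) (i : Fin n) {k e : ℝ} (hk : 0 < k) (he : 0 ≤ e) (f : Fc n) (z : Cn n) :
    ah b i k e f z ≤ ‖f z‖ ^ 2 * (1 / (k * (nsq b z + e))) := by
  have h0 := nsq_nonneg b z
  have h1 : 0 ≤ ‖z i - b i‖ ^ 2 / (nsq b z + e) := by positivity
  unfold ah; gcongr; linarith

lemma memLp_cut (hD : IsOpen D) (hfm : Measurable f) (hf2 : ∫⁻ z in D, ‖f z‖ₑ ^ 2 < ⊤) :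
    MemLp (D.indicator f) 2 := by
  refine ⟨(hfm.indicator hD.measurableSet).aestronglyMeasurable, ?_⟩
  have h : eLpNorm (D.indicator f) 2 volume ^ 2 < ⊤ := by
    rw [eLp2, lint_supp hD.measurableSet (fun z hz => by rw [indicator_of_notMem hz]; simp)]
    refine lt_of_le_of_lt (le_of_eq (setLIntegral_congr_fun hD.measurableSet fun z hz => ?_)) hf2
    rw [indicator_of_mem hz]
  exact (ENNReal.pow_lt_top_iff.1 h).resolve_right nN

lemma tst_hol_int (hD : IsOpen D) (hfm : Measurable f) (hf2 : ∫⁻ z in D, ‖f z‖ₑ ^ 2 < ⊤) {η : Fc n} (hη : Tst D η) :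
    Integrable fun x => f x * η x := by
  refine (hη.mul_int (memLp_cut hD hfm hf2)).congr (Eventually.of_forall fun x => ?_)
  beta_reduce
  by_cases hx : x ∈ D
  · rw [indicator_of_mem hx, mul_comm]
  · rw [image_eq_zero_of_notMem_tsupport (fun h => hx (hη.su h))]; simp

lemma memLp_bdd (hD : IsOpen D) (hbd : Bornology.IsBounded D) (hΩ : MeasurableSet Ω) (hΩD : Ω ⊆ D) (hfm : Measurable f)
    (hf2 : ∫⁻ z in D, ‖f z‖ₑ ^ 2 < ⊤) {p : Cn n → ℝ} (mp : Measurable p) {C : ℝ} (hC : ∀ z ∈ Ω, |p z| ≤ C)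
    {q : Fc n} (hq : Continuous q) : MemLp (Ω.indicator fun z => (p z : ℂ) * (f z * q z)) 2 := by
  obtain ⟨M, hM⟩ := hbd.isCompact_closure.exists_bound_of_continuousOn hq.continuousOn
  have : Measurable fun z => (p z : ℂ) := by fun_prop
  have := hq.measurable
  refine (memLp_cut hD hfm hf2).of_le_mul (c := |C| * |M|) (Measurable.aestronglyMeasurable
    (Measurable.indicator fP hΩ)) (Eventually.of_forall fun z => ?_)
  by_cases hz : z ∈ Ω
  · rw [indicator_of_mem hz, indicator_of_mem (hΩD hz), norm_mul, norm_mul, norm_real, Real.norm_eq_abs]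
    have h1 := hC z hz
    have h2 := hM z (subset_closure (hΩD hz))
    calc |p z| * (‖f z‖ * ‖q z‖) ≤ |C| * (‖f z‖ * |M|) := 
          mul_le_mul (h1.trans (le_abs_self _)) (mul_le_mul_of_nonneg_left (h2.trans (le_abs_self _)) (norm_nonneg _))
            pS (abs_nonneg _)
      _ = _ := by ring
  · rw [indicator_of_notMem hz, norm_zero]
    positivity

lemma hA_aux {s : Cn n → ℝ} (ss : ContDiff ℝ ∞ s) {z : Cn n} (hz : 0 < s z) {ξ : Cn n} (sl : levi s z ξ ≤ -∑ j, ‖ξ j‖ ^ 2)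
    {G B κ ε : ℝ} (sG : ∑ j, ‖wm j (cx s) z‖ ^ 2 ≤ G) (hκ : 0 < κ) (hB : 0 < B) (hε : 0 < ε)
    (hB2 : 8 * (1 + 1 / ε) * G ≤ 3 * B) :
    2 * (1 + 1 / ε) * (∑ j, ‖wm j (cx fun z => lG (1 + κ / s z ^ 2)) z‖ ^ 2) * ∑ j, ‖ξ j‖ ^ 2 ≤
      levi (fun z => B * κ * (s z ^ 3)⁻¹) z ξ := by
  have d1 : HasDerivAt (fun t : ℝ => lG (1 + κ / t ^ 2)) (-(2 * κ) / (s z * (s z ^ 2 + κ))) (s z) := by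
    have a := ((hasDerivAt_pow 2 (s z)).fun_inv pS).const_mul κ
    have b' := (a.const_add 1).log pS
    refine (HasDerivAt.congr_deriv b' ?_).congr_of_eventuallyEq (Eventually.of_forall fun t => by simp [div_eq_mul_inv])
    field_simp; ring
  have d2 : ∀ t : ℝ, 0 < t → HasDerivAt (fun t : ℝ => B * κ * (t ^ 3)⁻¹) (-(3 * B * κ) * (t ^ 4)⁻¹) t := fun t ht => by
    have a := ((hasDerivAt_pow 3 t).fun_inv pS).const_mul (B * κ)
    refine HasDerivAt.congr_deriv a ?_
    field_simp; norm_num; ring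
  have d3 : HasDerivAt (fun t : ℝ => -(3 * B * κ) * (t ^ 4)⁻¹) (12 * B * κ * (s z ^ 5)⁻¹) (s z) := by
    have a := ((hasDerivAt_pow 4 (s z)).fun_inv pS).const_mul (-(3 * B * κ))
    refine HasDerivAt.congr_deriv a ?_
    field_simp; norm_num; ring
  rw [levi_comp ss ((lt_mem_nhds hz).mono d2) d3]
  simp only [wd_real (ss.differentiable sM z) d1, norm_mul, mul_pow, ← Finset.mul_sum, norm_real, Real.norm_eq_abs, sq_abs]
  have h1 : (-(2 * κ) / (s z * (s z ^ 2 + κ))) ^ 2 ≤ 4 * κ * (s z ^ 4)⁻¹ := by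
    rw [div_pow, ← div_eq_mul_inv, div_le_div_iff₀ pS pS]
    have : 0 ≤ 4 * κ * s z ^ 2 * (s z ^ 4 + κ * s z ^ 2 + κ ^ 2) := by positivity
    nlinarith
  have hX : 0 ≤ ∑ j, ‖ξ j‖ ^ 2 := Finset.sum_nonneg fun _ _ => sq_nonneg _
  have hY : 0 ≤ ∑ j, ‖wm j (cx s) z‖ ^ 2 := Finset.sum_nonneg fun _ _ => sq_nonneg _
  have h5 : 0 ≤ 12 * B * κ * (s z ^ 5)⁻¹ * ‖∑ k, wm k (cx s) z * ξ k‖ ^ 2 := by positivity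
  have h6 : 3 * B * κ * (s z ^ 4)⁻¹ * (∑ j, ‖ξ j‖ ^ 2) ≤ -(3 * B * κ) * (s z ^ 4)⁻¹ * levi s z ξ := by
    have : 0 ≤ 3 * B * κ * (s z ^ 4)⁻¹ := by positivity
    nlinarith
  calc _ ≤ 2 * (1 + 1 / ε) * (4 * κ * (s z ^ 4)⁻¹ * G) * ∑ j, ‖ξ j‖ ^ 2 := by gcongr
    _ = (8 * (1 + 1 / ε) * G) * (κ * (s z ^ 4)⁻¹ * ∑ j, ‖ξ j‖ ^ 2) := by ring
    _ ≤ (3 * B) * (κ * (s z ^ 4)⁻¹ * ∑ j, ‖ξ j‖ ^ 2) := by gcongr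
    _ ≤ _ := by linarith

lemma propC (hopen : IsOpen D) (hbd : Bornology.IsBounded D) (hpsc : IsPseudoconvex D) (hne : Dᶜ.Nonempty)
    (hf : DifferentiableOn ℂ f D) (hfm : Measurable f) (hf2 : ∫⁻ z in D, ‖f z‖ₑ ^ 2 < ⊤) (b : Cn n) (i : Fin n)
    {k e : ℝ} (hk : 0 < k) (he : 0 < e) {η : Fin n → Fc n} (hη : ∀ j, Tst D (η j)) {ε : ℝ} (hε : 0 < ε) :
    ‖∫ x, f x * gq b i e x * ∑ j, wd I j (η j) x‖ₑ ^ 2 ≤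
      oR ((1 + ε) ^ 2) * (∫⁻ z in D, oR (pw b (-k) e z * ah b i k e f z)) *
      ∫⁻ z, oR (pw b k e z) * ‖∑ j, wd I j (η j) z‖ₑ ^ 2 := by
  set L : Set (Cn n) := ⋃ j, tsupport (η j) with hLd
  have hL : IsCompact L := isCompact_iUnion fun j => (hη j).cp
  have hLD : L ⊆ D := iUnion_subset fun j => (hη j).su
  obtain ⟨s, Ω, S, G, ss, hΩ, hLΩ, hΩD, s0, s1, hK, sl, sS, sG⟩ := exhaust hopen hbd hpsc hne hL hLD
  obtain ⟨χ, Cχ, χ1, χ2, χ3, χ4⟩ := cutoffs ss hΩ s0 hK sG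
  have mΩ := hΩ.measurableSet
  have hR : ∀ z, 0 < nsq b z + e := fun z => by have := nsq_nonneg b z; positivity
  have mn : Measurable (nsq b) := (nsq_smooth b).continuous.measurable
  have ms : Measurable s := ss.continuous.measurable
  obtain ⟨B, hB0, hB1, hB2⟩ : ∃ B : ℝ, 0 < B ∧ 2 * S ≤ B ∧ 8 * (1 + 1 / ε) * G ≤ 3 * B := by
    refine ⟨max 1 (max (2 * S) (8 * (1 + 1 / ε) * G)), by positivity,
      (le_max_left _ _).trans (le_max_right _ _), ?_⟩
    have := (le_max_right (2 * S) (8 * (1 + 1 / ε) * G)).trans (le_max_right 1 _)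
    have h1 := le_max_left 1 (max (2 * S) (8 * (1 + 1 / ε) * G))
    linarith
  set κ := lG (1 + ε) / B with hκ
  have hκ0 : 0 < κ := div_pos (Real.log_pos lA) hB0
  have hBκ : B * κ = lG (1 + ε) := by rw [hκ]; field_simp
  set ψ : Cn n → ℝ := fun z => lG (1 + κ / s z ^ 2) with hψ
  set Φ : Cn n → ℝ := fun z => k * lG (nsq b z + e) + B * κ * (s z ^ 3)⁻¹ with hΦ
  have ψ1 : ∀ z, eX (ψ z) = 1 + κ / s z ^ 2 := fun z => Real.exp_log pS
  have ψ0 : ∀ z, 0 ≤ ψ z := fun z => Real.log_nonneg (by have : 0 ≤ κ / s z ^ 2 := by positivity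
                                                         linarith)
  have ψs : ContDiffOn ℝ ∞ ψ Ω := ContDiffOn.log (contDiffOn_const.add
    (contDiffOn_const.div (ss.contDiffOn.pow 2) fun z hz => (pow_pos (s0 z hz) 2).ne')) fun z hz => by positivity
  have Φ1s : ContDiff ℝ ∞ fun z => k * lG (nsq b z + e) :=
    contDiff_const.mul (((nsq_smooth b).add contDiff_const).log fun z => (hR z).ne')
  have Φ2s : ContDiffOn ℝ ∞ (fun z => B * κ * (s z ^ 3)⁻¹) Ω :=
    contDiffOn_const.mul ((ss.contDiffOn.pow 3).inv fun z hz => (pow_pos (s0 z hz) 3).ne')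
  have hW : ∀ z ∈ Ω, 2 * ψ z ≤ B * κ * (s z ^ 3)⁻¹ := fun z hz => by
    have hz0 := s0 z hz
    have h1 : ψ z ≤ κ / s z ^ 2 := by
      have := Real.log_le_sub_one_of_pos (show 0 < 1 + κ / s z ^ 2 by positivity)
      linarith
    have h2 : 2 * (κ / s z ^ 2) ≤ B * κ * (s z ^ 3)⁻¹ := by
      rw [show 2 * (κ / s z ^ 2) = (2 * s z * κ) * (s z ^ 3)⁻¹ by field_simp]
      gcongr
      linarith [sS z hz]
    linarith
  have hW1 : ∀ z ∈ Ω, eX (2 * ψ z - Φ z) ≤ pw b (-k) e z := fun z hz => by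
    refine Real.exp_le_exp.2 ?_
    have := hW z hz
    simp only [hΦ]; linarith
  have hW2 : ∀ z ∈ L, pw b (-k) e z ≤ (1 + ε) * eX (2 * ψ z - Φ z) := fun z hz => by
    have h1 : (1 + ε) = eX (B * κ) := by rw [hBκ, Real.exp_log lA]
    rw [h1, ← Real.exp_add]
    refine Real.exp_le_exp.2 ?_
    have h2 : (s z ^ 3)⁻¹ ≤ 1 := inv_le_one_of_one_le₀ (one_le_pow₀ (s1 z hz))
    have h3 : B * κ * (s z ^ 3)⁻¹ ≤ B * κ := mul_le_of_le_one_right pS h2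
    have := ψ0 z
    simp only [hΦ]; linarith
  have hpe : ∀ z, pw b (-k) e z ≤ eX (-(k * lG e)) := fun z => by
    refine Real.exp_le_exp.2 ?_
    have := Real.log_le_log he (show e ≤ nsq b z + e by linarith [nsq_nonneg b z])
    nlinarith
  set Ce := eX (-(k * lG e)) / (k * e) with hCe
  have hfinD : ∫⁻ z in D, oR (pw b (-k) e z * ah b i k e f z) < ⊤ := by
    refine lt_of_le_of_lt (lintegral_mono (g := fun z => oR Ce * ‖f z‖ₑ ^ 2) fun z => ?_) ?_
    · beta_reduce
      rw [← ofReal_sq, ← ENNReal.ofReal_mul pS]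
      refine ENNReal.ofReal_le_ofReal ?_
      have h1 := ah_le b i hk he.le f z
      have h2 : 1 / (k * (nsq b z + e)) ≤ 1 / (k * e) := by
        gcongr; linarith [nsq_nonneg b z]
      have h3 := ah_nonneg b i hk.le he.le f z
      calc _ ≤ eX (-(k * lG e)) * (‖f z‖ ^ 2 * (1 / (k * e))) :=
            mul_le_mul (hpe z) (h1.trans (by gcongr)) h3 (Real.exp_pos _).le
        _ = _ := by rw [hCe]; ring
    · rw [lintegral_const_mul _ fP]
      exact ENNReal.mul_lt_top ENNReal.ofReal_lt_top hf2
  have hle : ∫⁻ z in Ω, oR (eX (2 * ψ z - Φ z) * ah b i k e f z) ≤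
      ∫⁻ z in D, oR (pw b (-k) e z * ah b i k e f z) := by
    refine (setLIntegral_mono' mΩ fun z hz => ?_).trans (lintegral_mono_set hΩD)
    exact ENNReal.ofReal_le_ofReal (mul_le_mul_of_nonneg_right (hW1 z hz) (ah_nonneg b i hk.le he.le f z))
  have hgs := gq_smooth b i he
  have hp2 : ∀ z ∈ Ω, |eX (ψ z - Φ z / 2)| ≤ eX (-(k * lG e) / 2) := fun z hz => by
    rw [abs_of_pos (Real.exp_pos _)]
    refine Real.exp_le_exp.2 ?_
    have := Real.exp_le_exp.1 ((hW1 z hz).trans (hpe z))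
    linarith
  have hp3 : ∀ z ∈ Ω, |eX ((ψ z - Φ z) / 2)| ≤ eX (-(k * lG e) / 2) := fun z hz => by
    refine le_trans ?_ (hp2 z hz)
    rw [abs_of_pos (Real.exp_pos _), abs_of_pos (Real.exp_pos _)]
    exact Real.exp_le_exp.2 (by linarith [ψ0 z])
  have mψ : Measurable ψ := by fun_prop
  have mΦ : Measurable Φ := by fun_prop
  have hA : ∀ z ∈ Ω, ∀ ξ, LA b k e z ξ + 2 * (1 + 1 / ε) * (∑ j, ‖wm j (cx ψ) z‖ ^ 2) * ∑ j, ‖ξ j‖ ^ 2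
      ≤ levi Φ z ξ := fun z hz ξ => by
    have h1 := hA_aux ss (s0 z hz) (sl z hz ξ) (sG z hz) hκ0 hB0 hε hB2
    rw [hΦ, levi_add hΩ hz Φ1s.contDiffOn Φ2s, levi_log b he]
    linarith
  obtain ⟨w, mw, hw1, hw2⟩ := ht (ε := ε) (C0 := Cχ / κ) (A := LA b k e) (u0 := fun z => f z * gq b i e z)
    (α := fun j z => f z * wd I j (gq b i e) z) (a := ah b i k e f)
    hΩ (Φ1s.contDiffOn.add Φ2s) ψs mΦ mψ χ1 χ2 
    (fun N z hz => (χ3 N z hz).trans (by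
      have h0 := (add_nonneg (Finset.sum_nonneg fun _ _ => sq_nonneg _) (Finset.sum_nonneg fun _ _ => sq_nonneg _)).trans (χ3 N z hz)
      have h1 := s0 z hz
      have h2 : 0 ≤ Cχ := by
        by_contra h
        exact absurd h0 (not_le.2 (div_neg_of_neg_of_pos (not_le.1 h) pS))
      rw [ψ1, mul_add, show Cχ / κ * (κ / s z ^ 2) = Cχ / s z ^ 2 by field_simp]
      have : 0 ≤ Cχ / κ := by positivity
      linarith)) χ4 hε
    (fun z _ ξ => LA_nonneg b hk.le he z ξ) hA
    (fun β hβ => by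
      unfold LA
      have : ∀ j, Measurable fun z : Cn n => star (z j - b j) := fun j => (coord_star_smooth b j).continuous.measurable
      fun_prop)
    (memLp_bdd hopen hbd mΩ hΩD hfm hf2 fP hp2 hgs.continuous)
    (fun j => memLp_bdd hopen hbd mΩ hΩD hfm hf2 fP hp3 (wd_smooth hgs).continuous)
    (fun θ hθ j => by
      have h1 := weak_hol hopen hf ((hθ.mul' hgs).mono hΩD) j
      have i1 : Integrable fun x => f x * (wd I j θ x * gq b i e x) :=
        tst_hol_int hopen hfm hf2 (((hθ.wd I j).mul' hgs).mono hΩD)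
      have i2 : Integrable fun x => f x * (θ x * wd I j (gq b i e) x) :=
        tst_hol_int hopen hfm hf2 ((hθ.mul' (wd_smooth hgs)).mono hΩD)
      have h2 : ∫ x, f x * wd I j (fun x => θ x * gq b i e x) x =
          (∫ x, f x * (wd I j θ x * gq b i e x)) + ∫ x, f x * (θ x * wd I j (gq b i e) x) := by
        rw [← integral_add i1 i2]
        refine integral_congr_ae (Eventually.of_forall fun x => ?_)
        beta_reduce
        rw [wd_mul (hθ.sm.differentiable sM x) (hgs.differentiable sM x)]; ring
      rw [h1] at h2
      rw [eq_neg_iff_add_eq_zero, add_comm, h2]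
      congr 1
      · refine integral_congr_ae (Eventually.of_forall fun x => ?_); beta_reduce; ring
      · refine integral_congr_ae (Eventually.of_forall fun x => ?_); beta_reduce; ring)
    (ah_meas b i k e hfm) (fun z _ => ah_nonneg b i hk.le he.le f z)
    (fun z _ ξ => gq_cs b i he hk z ξ (f z)) (hle.trans_lt hfinD).ne
  set P : Fc n := fun z => ∑ j, wd I j (η j) z with hP
  have hηΩ : ∀ j, Tst Ω (η j) := fun j => ⟨(hη j).sm, (hη j).cp, (subset_iUnion _ j).trans hLΩ⟩
  have hP0 : ∀ z ∉ L, P z = 0 := fun z hz => by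
    refine Finset.sum_eq_zero fun j _ => image_eq_zero_of_notMem_tsupport fun h => hz (mem_iUnion.2 ⟨j, wd_support h⟩)
  have mP : Measurable P := by
    have : ∀ j, Measurable (wd I j (η j)) := fun j => ((hη j).wd I j).sm.continuous.measurable
    rw [hP]; fun_prop
  have mL := hL.measurableSet
  have hY : ∫⁻ z in L, oR (pw b (-k) e z) * ‖w z‖ₑ ^ 2 ≤
      oR ((1 + ε) ^ 2) * ∫⁻ z in D, oR (pw b (-k) e z * ah b i k e f z) := by
    calc _ ≤ ∫⁻ z in L, oR (1 + ε) * oR (eX (2 * ψ z - Φ z) * ‖w z‖ ^ 2) := by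
          refine setLIntegral_mono' mL fun z hz => ?_
          rw [← ofReal_sq, ← ENNReal.ofReal_mul (pw_pos _ _ _ _).le, ← ENNReal.ofReal_mul pS]
          refine ENNReal.ofReal_le_ofReal ?_
          rw [← mul_assoc]
          exact mul_le_mul_of_nonneg_right (hW2 z hz) pS
      _ = oR (1 + ε) * ∫⁻ z in L, oR (eX (2 * ψ z - Φ z) * ‖w z‖ ^ 2) :=
          lintegral_const_mul _ fP
      _ ≤ oR (1 + ε) * (oR (1 + ε) * ∫⁻ z in D, oR (pw b (-k) e z * ah b i k e f z)) := by
          gcongr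
          exact (lintegral_mono_set hLΩ).trans (hw2.trans (by gcongr))
      _ = _ := by rw [← mul_assoc, ← ENNReal.ofReal_mul pS, sq]
  have hwL : MemLp (L.indicator w) 2 := by
    obtain ⟨M, hM⟩ := hL.exists_bound_of_continuousOn (f := pw b k e) (by
      refine Continuous.continuousOn ?_
      unfold pw
      exact Real.continuous_exp.comp (continuous_const.mul (((nsq_smooth b).continuous.add continuous_const).log fun z => (hR z).ne')))
    refine ⟨(mw.indicator mL).aestronglyMeasurable, ?_⟩
    have h : eLpNorm (L.indicator w) 2 volume ^ 2 < ⊤ := by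
      rw [eLp2, lint_supp mL (fun z hz => by rw [indicator_of_notMem hz]; simp)]
      calc _ ≤ ∫⁻ z in L, oR M * (oR (pw b (-k) e z) * ‖w z‖ₑ ^ 2) := by
            refine setLIntegral_mono' mL fun z hz => ?_
            rw [indicator_of_mem hz, ← mul_assoc, ← ENNReal.ofReal_mul ((norm_nonneg _).trans (hM z hz))]
            refine le_mul_of_one_le_left' ?_
            rw [← ENNReal.ofReal_one]
            refine ENNReal.ofReal_le_ofReal ?_
            have h1 : pw b k e z * pw b (-k) e z = 1 := by
              rw [pw, pw, ← Real.exp_add, neg_mul, add_neg_cancel, Real.exp_zero]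
            rw [← h1]
            exact mul_le_mul_of_nonneg_right ((le_abs_self _).trans (hM z hz)) (pw_pos _ _ _ _).le
        _ = oR M * ∫⁻ z in L, oR (pw b (-k) e z) * ‖w z‖ₑ ^ 2 :=
            lintegral_const_mul _ (by have := pw_meas b (-k) e; fun_prop)
        _ < ⊤ := ENNReal.mul_lt_top ENNReal.ofReal_lt_top (hY.trans_lt (ENNReal.mul_lt_top ENNReal.ofReal_lt_top hfinD))
    exact (ENNReal.pow_lt_top_iff.1 h).resolve_right nN
  have e1 : ∫ x, f x * gq b i e x * P x = ∫ x, w x * P x := by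
    have i1 : ∀ j, Integrable fun x => f x * gq b i e x * wd I j (η j) x := fun j =>
      (tst_hol_int hopen hfm hf2 (((hη j).wd I j).mul' hgs)).congr (Eventually.of_forall fun x => by beta_reduce; ring)
    have i2 : ∀ j, Integrable fun x => w x * wd I j (η j) x := fun j =>
      (((hη j).wd I j).mul_int hwL).congr (Eventually.of_forall fun x => by
        beta_reduce
        by_cases hx : x ∈ L
        · rw [indicator_of_mem hx, mul_comm]
        · rw [image_eq_zero_of_notMem_tsupport (f := wd I j (η j)) fun h => hx (mem_iUnion.2 ⟨j, wd_support h⟩)]; simp)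
    simp only [hP, Finset.mul_sum]
    rw [integral_finsetSum _ fun j _ => i1 j, integral_finsetSum _ fun j _ => i2 j]
    exact Finset.sum_congr rfl fun j _ => hw1 _ (hηΩ j) j
  have hpp : ∀ z, oR (pw b (-k/2) e z) * oR (pw b (k/2) e z) = 1 := fun z => by
    rw [← ENNReal.ofReal_mul (pw_pos _ _ _ _).le, pw, pw, ← Real.exp_add]
    ring_nf; simp
  have hps : ∀ t z, oR (pw b (t/2) e z) ^ 2 = oR (pw b t e z) := fun t z => by
    rw [← ENNReal.ofReal_pow (pw_pos _ _ _ _).le, pw, pw, ← Real.exp_nat_mul]; congr 2; push_cast; ring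
  have m1 := pw_meas b (-k/2) e
  have m2 := pw_meas b (k/2) e
  calc ‖∫ x, f x * gq b i e x * P x‖ₑ ^ 2 = ‖∫ x, w x * P x‖ₑ ^ 2 := by rw [e1]
    _ ≤ (∫⁻ x, ‖w x * P x‖ₑ) ^ 2 := by gcongr; exact enorm_integral_le_lintegral_enorm _
    _ = (∫⁻ x in L, (oR (pw b (-k/2) e x) * ‖w x‖ₑ) * (oR (pw b (k/2) e x) * ‖P x‖ₑ)) ^ 2 := by
        rw [lint_supp mL (fun z hz => by rw [hP0 z hz]; simp)]
        congr 2; ext z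
        rw [enorm_mul, mul_mul_mul_comm, hpp, one_mul]
    _ ≤ _ := lint_cs fP fP
    _ ≤ _ := by
        simp only [mul_pow, hps]
        exact mul_le_mul' hY (setLIntegral_le_lintegral _ _)

lemma nsq_pos {b z : Cn n} (h : z ≠ b) : 0 < nsq b z := by
  obtain ⟨j, hj⟩ := Function.ne_iff.1 h
  have h1 : 0 < ‖z j - b j‖ := norm_pos_iff.2 (sub_ne_zero.2 hj)
  exact lt_of_lt_of_le pS (ci_le b z j)

lemma pw_mul (b : Cn n) (s t e : ℝ) (z : Cn n) : pw b s e z * pw b t e z = pw b (s + t) e z := by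
  rw [pw, pw, pw, ← Real.exp_add, add_mul]

lemma pw_zero (b : Cn n) (e : ℝ) (z : Cn n) : pw b 0 e z = 1 := by simp [pw]

lemma pw_neg_one {b z : Cn n} {e : ℝ} (h : 0 < nsq b z + e) : pw b (-1) e z = (nsq b z + e)⁻¹ := by
  rw [pw, neg_one_mul, Real.exp_neg, Real.exp_log h]

lemma pw_bdd {b z : Cn n} {t R : ℝ} (ht : 0 ≤ t) (hR : 1 ≤ R) (h : nsq b z ≤ R) : pw b t 0 z ≤ eX (t * lG R) := by
  refine Real.exp_le_exp.2 (mul_le_mul_of_nonneg_left ?_ ht)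
  rcases (nsq_nonneg b z).eq_or_lt with h0 | h0
  · rw [← h0]; simp; exact Real.log_nonneg hR
  · exact Real.log_le_log lA lA

lemma pw_inv (b : Cn n) (t e : ℝ) (z : Cn n) : pw b t e z * pw b (-t) e z = 1 := by
  rw [pw_mul, add_neg_cancel, pw_zero]

lemma nsq_bdd (hbd : Bornology.IsBounded D) : ∃ R : ℝ, 1 ≤ R ∧ ∀ z ∈ D, ∀ b ∈ D, nsq b z ≤ R := by
  obtain ⟨M, hM⟩ := hbd.exists_norm_le
  refine ⟨1 + ∑ j : Fin n, (M + M) ^ 2, by simp; positivity, fun z hz b hb => ?_⟩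
  have : nsq b z ≤ ∑ j : Fin n, (M + M) ^ 2 := Finset.sum_le_sum fun j _ => by
    gcongr
    exact (norm_sub_le _ _).trans (add_le_add ((norm_le_pi_norm z j).trans (hM z hz)) ((norm_le_pi_norm b j).trans (hM b hb)))
  linarith

lemma ae_ne (i : Fin n) (b : Cn n) : ∀ᵐ z : Cn n, z ≠ b := by
  have : Nonempty (Fin n) := ⟨i⟩
  exact compl_mem_ae_iff.2 (measure_singleton b)

noncomputable def NN (D : Set (Cn n)) (b : Cn n) (k : ℝ) (f : Fc n) : ℝ≥0∞ :=
  ∫⁻ z in D, oR (pw b (-k - 1) 0 z) * ‖f z‖ₑ ^ 2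

lemma norm_gq_le {b z : Cn n} {i : Fin n} {e : ℝ} (he : 0 ≤ e) : ‖gq b i e z‖ ^ 2 ≤ (nsq b z)⁻¹ := by
  have h0 := nsq_nonneg b z
  rcases h0.eq_or_lt with h | h
  · have h1 := ci_le b z i
    have : ‖z i - b i‖ ^ 2 = 0 := le_antisymm (h1.trans h.symm.le) (sq_nonneg _)
    have h2 : ‖z i - b i‖ = 0 := by simpa using this
    rw [gq, norm_mul, norm_star, h2]; simp [← h]
  · rw [gq, norm_mul, norm_star, mul_pow, norm_real, Real.norm_eq_abs, sq_abs]
    calc _ ≤ nsq b z * ((nsq b z)⁻¹) ^ 2 := by gcongr; exact ci_le b z i; linarith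
      _ = _ := by field_simp

lemma pw_ge {b z : Cn n} {t R : ℝ} (ht : 0 ≤ t) (hR : 1 ≤ R) (h : nsq b z ≤ R) :
    1 ≤ eX (t * lG R) * pw b (-t) 0 z := by
  rw [← pw_inv b t 0 z]
  exact mul_le_mul_of_nonneg_right (pw_bdd ht hR h) (pw_pos _ _ _ _).le

lemma NN_L2 (hD : IsOpen D) (hfm : Measurable f) {b : Cn n} {R k : ℝ} (hk : 0 ≤ k) (hR : 1 ≤ R) (h : ∀ z ∈ D, nsq b z ≤ R) :
    ∫⁻ z in D, ‖f z‖ₑ ^ 2 ≤ oR (eX ((k + 1) * lG R)) * NN D b k f := by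
  have := pw_meas b (-k - 1) 0
  rw [NN, ← lintegral_const_mul _ fP]
  refine setLIntegral_mono' hD.measurableSet fun z hz => ?_
  rw [← mul_assoc, ← ENNReal.ofReal_mul (Real.exp_pos _).le]
  refine le_mul_of_one_le_left' ?_
  rw [← ENNReal.ofReal_one]
  refine ENNReal.ofReal_le_ofReal ((pw_ge (by positivity : 0 ≤ k + 1) hR (h z hz)).trans (le_of_eq ?_))
  congr 2; ring

lemma gq_meas (b : Cn n) (i : Fin n) (e : ℝ) : Measurable (gq b i e) := by
  have : Measurable (nsq b) := (nsq_smooth b).continuous.measurable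
  have : Measurable fun z : Cn n => star (z i - b i) := (coord_star_smooth b i).continuous.measurable
  unfold gq; fun_prop

lemma fgq_le {b z : Cn n} (hz : z ≠ b) (i : Fin n) (k : ℝ) :
    oR (pw b (-k) 0 z) * ‖f z * gq b i 0 z‖ₑ ^ 2 ≤ oR (pw b (-k - 1) 0 z) * ‖f z‖ₑ ^ 2 := by
  rw [← ofReal_sq, ← ofReal_sq, ← ENNReal.ofReal_mul (pw_pos _ _ _ _).le, ← ENNReal.ofReal_mul (pw_pos _ _ _ _).le]
  refine ENNReal.ofReal_le_ofReal ?_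
  rw [sub_eq_add_neg, ← pw_mul, norm_mul, mul_pow, pw_neg_one (by simpa using nsq_pos hz), add_zero, mul_assoc, mul_comm _ (‖f z‖ ^ 2)]
  have := norm_gq_le (b := b) (z := z) (i := i) (le_refl 0)
  have := pw_pos b (-k) 0 z
  gcongr

lemma ah0_le {b z : Cn n} (hz : z ≠ b) (i : Fin n) {k e : ℝ} (hk : 0 < k) (he : 0 ≤ e) :
    oR (pw b (-k) e z * ah b i k e f z) ≤ 
      oR (1 / k) * (oR (pw b (-k - 1) 0 z) * ‖f z‖ₑ ^ 2) := by
  rw [← ofReal_sq, ← ENNReal.ofReal_mul (pw_pos _ _ _ _).le, ← ENNReal.ofReal_mul pS]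
  refine ENNReal.ofReal_le_ofReal ?_
  have h0 := nsq_pos hz
  have h1 := ah_le b i hk he f z
  have h2 : pw b (-k - 1) e z ≤ pw b (-k - 1) 0 z := by
    refine Real.exp_le_exp.2 ?_
    have := Real.log_le_log (by linarith : 0 < nsq b z + 0) (by linarith : nsq b z + 0 ≤ nsq b z + e)
    nlinarith
  calc _ ≤ pw b (-k) e z * (‖f z‖ ^ 2 * (1 / (k * (nsq b z + e)))) := by
        have := pw_pos b (-k) e z
        gcongr
    _ = 1 / k * (pw b (-k - 1) e z * ‖f z‖ ^ 2) := by
        rw [sub_eq_add_neg, ← pw_mul, pw_neg_one lA]; field_simp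
    _ ≤ _ := by gcongr

lemma pw_tendsto {b z : Cn n} (hz : z ≠ b) (t : ℝ) {e : ℕ → ℝ} (he : Tendsto e atTop (𝓝 0)) :
    Tendsto (fun m => pw b t (e m) z) atTop (𝓝 (pw b t 0 z)) := by
  have h0 := nsq_pos hz
  unfold pw
  refine (Real.continuous_exp.tendsto _).comp (Tendsto.const_mul _ (((Real.continuousAt_log lA).tendsto).comp ?_))
  exact tendsto_const_nhds.add he

lemma propD (hopen : IsOpen D) (hbd : Bornology.IsBounded D) (hpsc : IsPseudoconvex D) (hne : Dᶜ.Nonempty)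
    (hf : DifferentiableOn ℂ f D) (hfm : Measurable f) {b : Cn n} (hb : b ∈ D) (i : Fin n)
    {k : ℝ} (hk : 0 < k) (hN : NN D b k f < ⊤) {η : Fin n → Fc n} (hη : ∀ j, Tst D (η j)) :
    ‖∫ x, f x * gq b i 0 x * ∑ j, wd I j (η j) x‖ₑ ^ 2 ≤
      (∫⁻ z in D, oR (pw b (-k) 0 z * ah b i k 0 f z)) *
      ∫⁻ z, oR (pw b k 0 z) * ‖∑ j, wd I j (η j) z‖ₑ ^ 2 := by
  obtain ⟨R, hR1, hR⟩ := nsq_bdd hbd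
  have hf2 : ∫⁻ z in D, ‖f z‖ₑ ^ 2 < ⊤ := (NN_L2 hopen hfm hk.le hR1 fun z hz => hR z hz b hb).trans_lt
    (ENNReal.mul_lt_top ENNReal.ofReal_lt_top hN)
  set P : Fc n := fun z => ∑ j, wd I j (η j) z with hP
  have tP : Tst D P := Tst.sum fun j _ => (hη j).wd I j
  have mP : Measurable P := tP.sm.continuous.measurable
  have mf0 : Measurable fun z => f z * gq b i 0 z := hfm.mul (gq_meas b i 0)
  have hfg : ∫⁻ z in D, ‖f z * gq b i 0 z‖ₑ ^ 2 < ⊤ := by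
    refine lt_of_le_of_lt ?_ (ENNReal.mul_lt_top (ENNReal.ofReal_lt_top (r := eX (k * lG R))) hN)
    have := pw_meas b (-k - 1) 0
    rw [NN, ← lintegral_const_mul _ fP]
    refine lintegral_mono_ae ?_
    filter_upwards [ae_restrict_of_ae (ae_ne i b), ae_restrict_mem hopen.measurableSet] with z hz hzD
    refine le_trans ?_ (mul_le_mul_right (fgq_le hz i k) _)
    rw [← mul_assoc, ← ENNReal.ofReal_mul (Real.exp_pos _).le]
    refine le_mul_of_one_le_left' ?_
    rw [← ENNReal.ofReal_one]
    exact ENNReal.ofReal_le_ofReal (pw_ge hk.le hR1 (hR z hzD b hb))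
  set e : ℕ → ℝ := fun m => 1 / ((m:ℝ) + 1) with he
  have e0 : ∀ m, 0 < e m := fun m => by positivity
  have e1 : ∀ m, e m ≤ 1 := fun m => by
    rw [he]; simp only; rw [div_le_one pS]; linarith [m.cast_nonneg (α := ℝ)]
  have et : Tendsto e atTop (𝓝 0) := tendsto_one_div_add_atTop_nhds_zero_nat
  have T1 : Tendsto (fun m => ∫ x, f x * gq b i (e m) x * P x) atTop (𝓝 (∫ x, f x * gq b i 0 x * P x)) := by
    have mg := fun m => gq_meas b i (e m)
    refine tendsto_integral_of_dominated_convergence (fun x => ‖f x * gq b i 0 x * P x‖) (fun m => by fun_prop)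
      (tst_hol_int hopen mf0 hfg tP).norm (fun m => Eventually.of_forall fun x => ?_) ?_
    · rw [norm_mul, norm_mul, norm_mul, norm_mul]
      by_cases hx : x = b
      · simp [gq, hx]
      · gcongr
        rw [gq, gq, norm_mul, norm_mul, norm_real, norm_real, Real.norm_eq_abs, Real.norm_eq_abs]
        have := nsq_pos hx
        have := e0 m
        rw [abs_of_pos pS, abs_of_pos pS]
        gcongr
    · filter_upwards [ae_ne i b] with z hz
      have := nsq_pos hz
      refine (Tendsto.const_mul _ ?_).mul_const _
      unfold gq
      refine Tendsto.const_mul _ ((continuous_ofReal.tendsto _).comp (Tendsto.inv₀ (tendsto_const_nhds.add et) lA))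
  have T2 : Tendsto (fun m => ∫⁻ z in D, oR (pw b (-k) (e m) z * ah b i k (e m) f z)) atTop
      (𝓝 (∫⁻ z in D, oR (pw b (-k) 0 z * ah b i k 0 f z))) := by
    have m1 := fun m => pw_meas b (-k) (e m)
    have m2 := fun m => ah_meas b i k (e m) hfm
    have m3 := pw_meas b (-k - 1) 0
    refine tendsto_lintegral_of_dominated_convergence 
      (fun z => oR (1 / k) * (oR (pw b (-k - 1) 0 z) * ‖f z‖ₑ ^ 2)) (fun m => by fun_prop)
      (fun m => ?_) ?_ ?_
    · filter_upwards [ae_restrict_of_ae (ae_ne i b)] with z hz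
      exact ah0_le hz i hk (e0 m).le
    · rw [lintegral_const_mul _ fP]
      exact (ENNReal.mul_lt_top ENNReal.ofReal_lt_top hN).ne
    · filter_upwards [ae_restrict_of_ae (ae_ne i b)] with z hz
      have h0 := nsq_pos hz
      refine (ENNReal.continuous_ofReal.tendsto _).comp ((pw_tendsto hz _ et).mul (Tendsto.const_mul _ ?_))
      have h1 : Tendsto (fun m => nsq b z + e m) atTop (𝓝 (nsq b z + 0)) := tendsto_const_nhds.add et
      exact (tendsto_const_nhds.sub (tendsto_const_nhds.div h1 lA)).div (h1.const_mul k) (by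
        rw [add_zero]; positivity)
  obtain ⟨M, hM⟩ := tP.cp.isCompact.exists_bound_of_continuousOn (f := pw b k 1) (by
      refine Continuous.continuousOn ?_
      unfold pw
      exact Real.continuous_exp.comp (continuous_const.mul (((nsq_smooth b).continuous.add continuous_const).log fun z =>
        (add_pos_of_nonneg_of_pos (nsq_nonneg b z) one_pos).ne')))
  have hPf : ∫⁻ z, oR |M| * ‖P z‖ₑ ^ 2 < ⊤ := by
    rw [lintegral_const_mul _ fP, ← eLp2]
    exact ENNReal.mul_lt_top ENNReal.ofReal_lt_top (ENNReal.pow_lt_top tP.memLp.2)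
  have hle3 : ∀ z ≠ b, ∀ t, 0 ≤ t → t ≤ 1 → oR (pw b k t z) * ‖P z‖ₑ ^ 2 ≤ oR |M| * ‖P z‖ₑ ^ 2 := by
    intro z hz t ht ht1
    by_cases hzP : z ∈ tsupport P
    · gcongr
      refine le_trans ?_ (((le_abs_self _).trans (hM z hzP)).trans (le_abs_self _))
      have := nsq_pos hz
      exact Real.exp_le_exp.2 (mul_le_mul_of_nonneg_left (Real.log_le_log lA lA) hk.le)
    · rw [image_eq_zero_of_notMem_tsupport hzP]; simp
  have T3 : Tendsto (fun m => ∫⁻ z, oR (pw b k (e m) z) * ‖P z‖ₑ ^ 2) atTop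
      (𝓝 (∫⁻ z, oR (pw b k 0 z) * ‖P z‖ₑ ^ 2)) := by
    have m1 := fun m => pw_meas b k (e m)
    refine tendsto_lintegral_of_dominated_convergence 
      (fun z => oR |M| * ‖P z‖ₑ ^ 2) (fun m => by fun_prop) (fun m => ?_) hPf.ne ?_
    · filter_upwards [ae_ne i b] with z hz
      exact hle3 z hz _ (e0 m).le (e1 m)
    · filter_upwards [ae_ne i b] with z hz
      refine ENNReal.Tendsto.mul_const ((ENNReal.continuous_ofReal.tendsto _).comp (pw_tendsto hz _ et)) (Or.inr ?_)
      exact (ENNReal.pow_lt_top enorm_lt_top).ne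
  have T4 : Tendsto (fun m => oR ((1 + e m) ^ 2)) atTop (𝓝 1) := by
    have : Tendsto (fun m => (1 + e m) ^ 2) atTop (𝓝 ((1 + 0) ^ 2)) := (tendsto_const_nhds.add et).pow 2
    simpa [Function.comp_def] using (ENNReal.continuous_ofReal.tendsto _).comp this
  have f2 : ∫⁻ z in D, oR (pw b (-k) 0 z * ah b i k 0 f z) ≠ ⊤ := by
    refine (lt_of_le_of_lt (lintegral_mono_ae (g := fun z => oR (1 / k) * (oR (pw b (-k - 1) 0 z) * ‖f z‖ₑ ^ 2)) ?_) ?_).ne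
    · filter_upwards [ae_restrict_of_ae (ae_ne i b)] with z hz
      exact ah0_le hz i hk le_rfl
    · have m3 := pw_meas b (-k - 1) 0
      rw [lintegral_const_mul _ fP]
      exact (ENNReal.mul_lt_top ENNReal.ofReal_lt_top hN)
  have f3 : ∫⁻ z, oR (pw b k 0 z) * ‖P z‖ₑ ^ 2 ≠ ⊤ := by
    refine (lt_of_le_of_lt (lintegral_mono_ae ?_) hPf).ne
    filter_upwards [ae_ne i b] with z hz
    exact hle3 z hz _ le_rfl zero_le_one
  have T5 := ENNReal.Tendsto.mul (ENNReal.Tendsto.mul T4 (Or.inl one_ne_zero) T2 (Or.inr ENNReal.one_ne_top)) (Or.inr f3) T3 (Or.inr (by simpa using f2))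
  rw [one_mul] at T5
  refine le_of_tendsto_of_tendsto' (ENNReal.Tendsto.pow (T1.enorm)) T5 fun m => ?_
  exact propC hopen hbd hpsc hne hf hfm hf2 b i hk (e0 m) hη (e0 m)

lemma pw_sq (b : Cn n) (t e : ℝ) (z : Cn n) : oR (pw b (t/2) e z) ^ 2 = oR (pw b t e z) := by
  rw [← ENNReal.ofReal_pow (pw_pos _ _ _ _).le, sq, pw_mul, add_halves]

lemma enorm_pw (b : Cn n) (t e : ℝ) (z : Cn n) : ‖((pw b t e z : ℝ) : ℂ)‖ₑ = oR (pw b t e z) := by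
  rw [← ofReal_norm, norm_real, Real.norm_eq_abs, abs_of_pos (pw_pos _ _ _ _)]

lemma solve (hopen : IsOpen D) (hbd : Bornology.IsBounded D) (hpsc : IsPseudoconvex D) (hne : Dᶜ.Nonempty)
    (hf : DifferentiableOn ℂ f D) (hfm : Measurable f) {b : Cn n} (hb : b ∈ D) (i : Fin n)
    {k : ℝ} (hk : 0 < k) (hN : NN D b k f < ⊤) : ∃ G V : Fc n, DifferentiableOn ℂ G D ∧ Measurable V ∧
    (∀ᵐ z, z ∈ D → G z = f z * gq b i 0 z - V z) ∧
    ∫⁻ z in D, oR (pw b (-k) 0 z) * ‖V z‖ₑ ^ 2 ≤ ∫⁻ z in D, oR (pw b (-k) 0 z * ah b i k 0 f z) := by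
  obtain ⟨R, hR1, hR⟩ := nsq_bdd hbd
  have mD := hopen.measurableSet
  have mg := gq_meas b i 0
  have mp := fun t => pw_meas b t 0
  set q : ℝ → Fc n := fun t z => ((pw b t 0 z : ℝ) : ℂ) with hq
  have mq : ∀ t, Measurable (q t) := fun t => by have := mp t; rw [hq]; fun_prop
  have qq : ∀ z, q (k/2) z * q (-k/2) z = 1 := fun z => by
    simp only [hq]; rw [← ofReal_mul, pw_mul, neg_div, add_neg_cancel, pw_zero, ofReal_one]
  set Q := ∫⁻ z in D, oR (pw b (-k) 0 z * ah b i k 0 f z) with hQ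
  have hfin : Q ≠ ⊤ := by
    refine (lt_of_le_of_lt (lintegral_mono_ae (g := fun z => oR (1 / k) * (oR (pw b (-k - 1) 0 z) * ‖f z‖ₑ ^ 2)) ?_) ?_).ne
    · filter_upwards [ae_restrict_of_ae (ae_ne i b)] with z hz
      exact ah0_le hz i hk le_rfl
    · have m3 := mp (-k - 1)
      rw [lintegral_const_mul _ fP]
      exact (ENNReal.mul_lt_top ENNReal.ofReal_lt_top hN)
  have hQe : Q = oR Q.toReal := (ENNReal.ofReal_toReal hfin).symm
  set u : Fc n := fun z => f z * gq b i 0 z * q (-k/2) z with hu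
  have mu : Measurable u := by have := mq (-k/2); rw [hu]; fun_prop
  have hu2 : ∫⁻ z in D, ‖u z‖ₑ ^ 2 < ⊤ := by
    refine lt_of_le_of_lt (lintegral_mono_ae ?_) hN
    filter_upwards [ae_restrict_of_ae (ae_ne i b)] with z hz
    refine le_trans (le_of_eq ?_) (fgq_le hz i k)
    rw [hu]; simp only; rw [enorm_mul, mul_pow, enorm_pw, pw_sq, mul_comm]
  have hU := memLp_cut hopen mu hu2
  have hr : ∀ η : Fin n → Fc n, (∀ j, Tst D (η j)) → MemLp (fun z => star (∑ j, wd I j (η j) z) * q (k/2) z) 2 := fun η hη => by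
    have tP : Tst D (fun z => star (∑ j, wd I j (η j) z)) := (Tst.sum fun j _ => (hη j).wd I j).conj
    have m1 := tP.sm.continuous.measurable
    have m2 := mq (k/2)
    refine tP.memLp.of_le_mul (c := eX (k/2 * lG R)) fP (Eventually.of_forall fun z => ?_)
    rw [norm_mul, mul_comm]
    by_cases hz : z ∈ D
    · gcongr
      simp only [hq]
      rw [norm_real, Real.norm_eq_abs, abs_of_pos (pw_pos _ _ _ _)]
      exact pw_bdd pS hR1 (hR z hz b hb)
    · rw [image_eq_zero_of_notMem_tsupport (f := fun z => star (∑ j, wd I j (η j) z)) fun h => hz (tP.su h)]; simp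
  let T : Submodule ℂ (Lp ℂ 2 (volume : Measure (Cn n))) :=
    { carrier := {x | ∃ η : Fin n → Fc n, (∀ j, Tst D (η j)) ∧ x =ᵐ[volume] fun z => star (∑ j, wd I j (η j) z) * q (k/2) z}
      add_mem' := by
        rintro x y ⟨η, hη, hx⟩ ⟨θ, hθ, hy⟩
        refine ⟨fun j z => η j z + θ j z, fun j => (hη j).add (hθ j), ?_⟩
        filter_upwards [Lp.coeFn_add x y, hx, hy] with z h1 h2 h3
        rw [h1, Pi.add_apply, h2, h3, ← add_mul, ← star_add, ← Finset.sum_add_distrib]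
        congr 2
        exact Finset.sum_congr rfl fun j _ => (wd_add ((hη j).sm.differentiable sM z) ((hθ j).sm.differentiable sM z)).symm
      zero_mem' := by
        refine ⟨fun j _ => 0, fun j => Tst.zero, ?_⟩
        filter_upwards [Lp.coeFn_zero ℂ 2 (volume : Measure (Cn n))] with z h1
        rw [h1]; simp [wd]
      smul_mem' := by
        rintro c x ⟨η, hη, hx⟩
        refine ⟨fun j z => η j z * star c, fun j => (hη j).mul' contDiff_const, ?_⟩
        filter_upwards [Lp.coeFn_smul c x, hx] with z h1 h2
        have : ∀ j, wd I j (fun z => η j z * star c) z = wd I j (η j) z * star c := fun j => by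
          rw [wd_mul ((hη j).sm.differentiable sM z) fP]; simp [wd]
        rw [h1, Pi.smul_apply, h2]
        simp only [this, ← Finset.sum_mul]
        rw [star_mul, star_star, smul_eq_mul, mul_assoc] }
  have hqs : ∀ t z, star (q t z) = q t z := fun t z => by simp [hq]
  have hin : ∀ η : Fin n → Fc n, ∀ hη : (∀ j, Tst D (η j)), inner ℂ ((hr η hη).toLp _) (hU.toLp _) =
      ∫ x, f x * gq b i 0 x * ∑ j, wd I j (η j) x := fun η hη => by
    rw [inner_lp]
    refine integral_congr_ae (Eventually.of_forall fun x => ?_)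
    beta_reduce
    by_cases hx : x ∈ D
    · rw [star_mul, star_star, hqs, indicator_of_mem hx]
      linear_combination (f x * gq b i 0 x * ∑ j, wd I j (η j) x) * qq x
    · have tP : Tst D (fun z => ∑ j, wd I j (η j) z) := Tst.sum fun j _ => (hη j).wd I j
      rw [image_eq_zero_of_notMem_tsupport (f := fun z => ∑ j, wd I j (η j) z) fun h => hx (tP.su h)]; simp
  obtain ⟨v, hv1, hv2⟩ := ha_abs T (hU.toLp _) (C := √Q.toReal) (by
    rintro x ⟨η, hη, hx⟩
    have hxe : x = (hr η hη).toLp _ := Lp.ext (hx.trans (hr η hη).coeFn_toLp.symm)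
    have h1 := propD hopen hbd hpsc hne hf hfm hb i hk hN hη
    have h2 : ∫⁻ z, oR (pw b k 0 z) * ‖∑ j, wd I j (η j) z‖ₑ ^ 2 = oR (‖x‖ ^ 2) := by
      rw [ENNReal.ofReal_pow (norm_nonneg _), hxe, Lp.norm_toLp, ENNReal.ofReal_toReal (hr η hη).2.ne, eLp2]
      congr 1; ext z
      rw [enorm_mul, mul_pow, enorm_pw, pw_sq, mul_comm, ← ofReal_sq, ← ofReal_sq, norm_star]
    rw [h2, ← hQ, hQe, ← ENNReal.ofReal_mul pS, ← ofReal_sq] at h1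
    have h3 := (ENNReal.ofReal_le_ofReal_iff pS).1 h1
    rw [hxe, hin η hη, ← hxe]
    refine abs_le_of_sq_le_sq' ?_ pS |>.2
    rw [mul_pow, Real.sq_sqrt pS]
    linarith)
  rw [sup_eq_left.2 (Real.sqrt_nonneg _)] at hv1
  have mv : Measurable v := (Lp.stronglyMeasurable v).measurable
  set V : Fc n := fun z => q (k/2) z * v z with hV
  have mV : Measurable V := by have := mq (k/2); rw [hV]; fun_prop
  have hvn : ∫⁻ z, ‖v z‖ₑ ^ 2 ≤ Q := by
    rw [← eLp2, ← ENNReal.ofReal_toReal (Lp.memLp v).2.ne, ← ENNReal.ofReal_pow ENNReal.toReal_nonneg, ← Lp.norm_def, hQe]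
    refine ENNReal.ofReal_le_ofReal ?_
    calc ‖v‖ ^ 2 ≤ √Q.toReal ^ 2 := by gcongr
      _ = _ := Real.sq_sqrt ENNReal.toReal_nonneg
  have hVn : ∫⁻ z in D, oR (pw b (-k) 0 z) * ‖V z‖ₑ ^ 2 ≤ Q := by
    refine ((setLIntegral_le_lintegral _ _).trans (le_of_eq ?_)).trans hvn
    congr 1; ext z
    rw [hV]; simp only; rw [enorm_mul, mul_pow, enorm_pw, pw_sq, ← mul_assoc, ← ENNReal.ofReal_mul (pw_pos _ _ _ _).le, pw_mul, neg_add_cancel, pw_zero]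
    simp
  have mfg : Measurable fun z => f z * gq b i 0 z := by fun_prop
  have bd : ∀ {F : Fc n}, Measurable F → ∫⁻ z in D, oR (pw b (-k) 0 z) * ‖F z‖ₑ ^ 2 < ⊤ → ∫⁻ z in D, ‖F z‖ₑ ^ 2 < ⊤ := by
    intro F mF hF
    refine lt_of_le_of_lt ?_ (ENNReal.mul_lt_top (ENNReal.ofReal_lt_top (r := eX (k * lG R))) hF)
    have := mp (-k)
    rw [← lintegral_const_mul _ fP]
    refine setLIntegral_mono' mD fun z hzD => ?_
    rw [← mul_assoc, ← ENNReal.ofReal_mul (Real.exp_pos _).le]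
    refine le_mul_of_one_le_left' ?_
    rw [← ENNReal.ofReal_one]
    exact ENNReal.ofReal_le_ofReal (pw_ge hk.le hR1 (hR z hzD b hb))
  have M1 := memLp_cut hopen mV (bd mV (hVn.trans_lt hfin.lt_top))
  have M2 := memLp_cut hopen mfg (bd mfg (lt_of_le_of_lt (lintegral_mono_ae (by
    filter_upwards [ae_restrict_of_ae (ae_ne i b)] with z hz
    exact fgq_le hz i k)) hN))
  have key : ∀ η : Fc n, Tst D η → ∀ j, ∫ x, f x * gq b i 0 x * wd I j η x = ∫ x, V x * wd I j η x := by
    intro η hη j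
    classical
    let b' : Fin n → Fc n := fun i => if i = j then η else fun _ => 0
    have hb' : ∀ i, Tst D (b' i) := fun i => by
      by_cases h : i = j
      · simp only [b', h, if_true]; exact hη
      · simp only [b', h, if_false]; exact Tst.zero
    have h1 := hv2 _ ⟨b', hb', (hr b' hb').coeFn_toLp⟩
    have h2 : ∀ x, ∑ i, wd I i (b' i) x = wd I j η x := fun x => by
      rw [Finset.sum_eq_single j]
      · simp [b']
      · intro i _ hij; simp [b', hij, wd]
      · simp
    rw [hin b' hb', ← Lp.toLp_coeFn v (Lp.memLp v), inner_lp] at h1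
    simp only [h2] at h1
    rw [h1]
    refine integral_congr_ae (Eventually.of_forall fun x => ?_)
    beta_reduce
    rw [star_mul, star_star, hqs]; simp only [hV]; ring
  obtain ⟨G, hG1, hG2⟩ := weyl hopen (M2.sub M1) (fun η hη j => by
    have i1 := (hη.wd I j).mul_int M2
    have i2 := (hη.wd I j).mul_int M1
    have : ∀ {F : Fc n}, ∫ x, wd I j η x * D.indicator F x = ∫ x, F x * wd I j η x := fun {F} => by
      refine integral_congr_ae (Eventually.of_forall fun x => ?_)
      beta_reduce
      by_cases hx : x ∈ D
      · rw [indicator_of_mem hx, mul_comm]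
      · rw [image_eq_zero_of_notMem_tsupport (f := wd I j η) fun h => hx ((hη.wd I j).su h)]; simp
    calc _ = (∫ x, wd I j η x * D.indicator (fun z => f z * gq b i 0 z) x) - ∫ x, wd I j η x * D.indicator V x := by
          rw [← integral_sub i1 i2]
          refine integral_congr_ae (Eventually.of_forall fun x => ?_)
          simp only [Pi.sub_apply]; ring
      _ = 0 := by rw [this, this, key η hη j, sub_self])
  refine ⟨G, V, hG1, mV, ?_, hVn⟩
  filter_upwards [hG2] with z hz hzD
  rw [hz hzD, Pi.sub_apply, indicator_of_mem hzD, indicator_of_mem hzD]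

lemma hol_meas (hD : IsOpen D) (hf : DifferentiableOn ℂ f D) : Measurable (D.indicator f) := by
  classical
  rw [← piecewise_eq_indicator]
  exact hf.continuousOn.measurable_piecewise continuousOn_const hD.measurableSet

lemma gq_sum {b z : Cn n} (hz : z ≠ b) : ∑ i, (z i - b i) * gq b i 0 z = 1 := by
  have h0 := nsq_pos hz
  have : ∀ i, (z i - b i) * gq b i 0 z = ((‖z i - b i‖ ^ 2 * (nsq b z)⁻¹ : ℝ) : ℂ) := fun i => by
    have := Complex.mul_conj' (z i - b i)
    rw [gq, add_zero, ← mul_assoc, star_def, this]; push_cast; rfl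
  simp only [this]
  rw [← ofReal_sum, ← Finset.sum_mul]
  change ((nsq b z * (nsq b z)⁻¹ : ℝ) : ℂ) = 1
  rw [mul_inv_cancel₀ h0.ne', ofReal_one]

lemma ah_sum {b z : Cn n} (hz : z ≠ b) {k : ℝ} (hk : 0 < k) :
    ∑ i, ah b i k 0 f z = (n - 1) / k * (‖f z‖ ^ 2 * (nsq b z)⁻¹) := by
  have h0 := nsq_pos hz
  simp only [ah, add_zero]
  rw [← Finset.mul_sum, ← Finset.sum_div, Finset.sum_sub_distrib, ← Finset.sum_div]
  change ‖f z‖ ^ 2 * ((∑ i : Fin n, 1 - nsq b z / nsq b z) / (k * nsq b z)) = _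
  rw [div_self h0.ne']; simp; field_simp

lemma step (hopen : IsOpen D) (hbd : Bornology.IsBounded D) (hpsc : IsPseudoconvex D) (hne : Dᶜ.Nonempty) (hn : 1 ≤ n)
    {k R : ℝ} (hk : 0 < k) (hR1 : 1 ≤ R) (hR : ∀ z ∈ D, ∀ b ∈ D, nsq b z ≤ R) {b : Cn n} (hb : b ∈ D)
    (hf : DifferentiableOn ℂ f D) (hfm : Measurable f)  (hN : NN D b k f < ⊤) :
    ∃ G : Fin n → Fc n, (∀ i, DifferentiableOn ℂ (G i) D ∧ Measurable (G i)) ∧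
    (∀ i, ∫⁻ z in D, ‖G i z‖ₑ ^ 2 ≤ oR (eX (k * lG R) * (2 * (1 + 1 / k))) * NN D b k f) ∧
    NN D b k (fun z => f z - ∑ i, (z i - b i) * G i z) ≤ oR ((n - 1) / k) * NN D b k f := by
  have i0 : Fin n := ⟨0, hn⟩
  have mD := hopen.measurableSet
  have mp := fun t => pw_meas b t 0
  choose G V hG mV hGV hVn using fun i => solve hopen hbd hpsc hne hf hfm hb i hk hN
  have nn : (0:ℝ) ≤ n - 1 := by simp; exact_mod_cast hn
  have ae1 : ∀ᵐ z ∂volume.restrict D, z ∈ D ∧ z ≠ b ∧ ∀ i, G i z = f z * gq b i 0 z - V i z := by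
    filter_upwards [ae_restrict_of_ae (ae_ne i0 b), ae_restrict_mem mD, ae_restrict_of_ae (ae_all_iff.2 hGV)] with z h1 h2 h3
    exact ⟨h2, h1, fun i => h3 i h2⟩
  refine ⟨fun i => D.indicator (G i), fun i => ⟨(hG i).congr fun z hz => indicator_of_mem hz _, hol_meas hopen (hG i)⟩, fun i => ?_, ?_⟩
  · have hV1 : ∫⁻ z in D, oR (pw b (-k) 0 z) * ‖V i z‖ₑ ^ 2 ≤ oR (1 / k) * NN D b k f := by
      have := mp (-k - 1)
      rw [NN, ← lintegral_const_mul _ fP]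
      refine (hVn i).trans (lintegral_mono_ae ?_)
      filter_upwards [ae1] with z hz
      exact ah0_le hz.2.1 i hk le_rfl
    calc _ ≤ ∫⁻ z in D, oR (eX (k * lG R)) * (2 * (oR (pw b (-k - 1) 0 z) * ‖f z‖ₑ ^ 2 +
            oR (pw b (-k) 0 z) * ‖V i z‖ₑ ^ 2)) := by
          refine lintegral_mono_ae ?_
          filter_upwards [ae1] with z hz
          refine le_trans ?_ (mul_le_mul_right (mul_le_mul_right (add_le_add_left (fgq_le hz.2.1 i k) _) _) _)
          have h1 : ‖G i z‖ₑ ^ 2 ≤ 2 * (‖f z * gq b i 0 z‖ₑ ^ 2 + ‖V i z‖ₑ ^ 2) := by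
            rw [hz.2.2 i, ← ofReal_sq, ← ofReal_sq, ← ofReal_sq, ← ENNReal.ofReal_add pS pS,
              ← ENNReal.ofReal_ofNat, ← ENNReal.ofReal_mul pS]
            refine ENNReal.ofReal_le_ofReal ?_
            have := norm_sub_le (f z * gq b i 0 z) (V i z)
            nlinarith [norm_nonneg (f z * gq b i 0 z - V i z), sq_nonneg (‖f z * gq b i 0 z‖ - ‖V i z‖)]
          rw [indicator_of_mem hz.1]
          refine h1.trans ?_
          rw [← mul_add, mul_left_comm 2, ← mul_assoc, ← ENNReal.ofReal_mul (Real.exp_pos _).le]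
          refine le_mul_of_one_le_left' ?_
          rw [← ENNReal.ofReal_one]
          exact ENNReal.ofReal_le_ofReal (pw_ge hk.le hR1 (hR z hz.1 b hb))
      _ = oR (eX (k * lG R)) * (2 * (NN D b k f + ∫⁻ z in D, oR (pw b (-k) 0 z) * ‖V i z‖ₑ ^ 2)) := by
          have m1 := mp (-k - 1)
          have m2 := mp (-k)
          have m3 := mV i
          rw [lintegral_const_mul _ fP, lintegral_const_mul _ fP, lintegral_add_left fP]; rfl
      _ ≤ oR (eX (k * lG R)) * (2 * (NN D b k f + oR (1 / k) * NN D b k f)) := by gcongr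
      _ = _ := by
          rw [ENNReal.ofReal_mul (Real.exp_pos _).le, ENNReal.ofReal_mul nN, ENNReal.ofReal_add nN pS,
            ENNReal.ofReal_one, ENNReal.ofReal_ofNat]
          ring
  · calc _ ≤ ∫⁻ z in D, ∑ i, oR (pw b (-k) 0 z) * ‖V i z‖ₑ ^ 2 := by
          rw [NN]
          refine lintegral_mono_ae ?_
          filter_upwards [ae1] with z hz
          have h0 := nsq_pos hz.2.1
          have e1 : f z - ∑ i, (z i - b i) * D.indicator (G i) z = ∑ i, (z i - b i) * V i z := by
            simp only [indicator_of_mem hz.1, hz.2.2, mul_sub, Finset.sum_sub_distrib]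
            have := gq_sum hz.2.1
            have h2 : ∑ i, (z i - b i) * (f z * gq b i 0 z) = f z := by
              calc _ = f z * ∑ i, (z i - b i) * gq b i 0 z := by
                    rw [Finset.mul_sum]; exact Finset.sum_congr rfl fun i _ => by ring
                _ = f z := by rw [this, mul_one]
            rw [h2]; ring
          rw [e1, ← Finset.mul_sum]
          simp only [← ofReal_sq]
          rw [← ENNReal.ofReal_sum_of_nonneg (fun _ _ => sq_nonneg _), ← ENNReal.ofReal_mul (pw_pos _ _ _ _).le, ← ENNReal.ofReal_mul (pw_pos _ _ _ _).le]
          refine ENNReal.ofReal_le_ofReal ?_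
          have h3 : ‖∑ i, (z i - b i) * V i z‖ ^ 2 ≤ nsq b z * ∑ i, ‖V i z‖ ^ 2 :=
            cs_sum (fun i => z i - b i) fun i => V i z
          calc _ ≤ pw b (-k - 1) 0 z * (nsq b z * ∑ i, ‖V i z‖ ^ 2) := mul_le_mul_of_nonneg_left h3 (pw_pos _ _ _ _).le
            _ = _ := by
              rw [sub_eq_add_neg, ← pw_mul, pw_neg_one lA, add_zero]; field_simp
      _ = ∑ i, ∫⁻ z in D, oR (pw b (-k) 0 z) * ‖V i z‖ₑ ^ 2 := 
          lintegral_finsetSum _ fun i _ => by have := mp (-k); have := mV i; fun_prop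
      _ ≤ ∑ i, ∫⁻ z in D, oR (pw b (-k) 0 z * ah b i k 0 f z) := Finset.sum_le_sum fun i _ => hVn i
      _ = ∫⁻ z in D, ∑ i, oR (pw b (-k) 0 z * ah b i k 0 f z) := by
          refine (lintegral_finsetSum _ fun i _ => ?_).symm
          have := mp (-k); have := ah_meas b i k 0 hfm; fun_prop
      _ = ∫⁻ z in D, oR ((n - 1) / k) * (oR (pw b (-k - 1) 0 z) * ‖f z‖ₑ ^ 2) := by
          refine lintegral_congr_ae ?_
          filter_upwards [ae1] with z hz
          have h0 := nsq_pos hz.2.1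
          rw [← ENNReal.ofReal_sum_of_nonneg (fun i _ => mul_nonneg (pw_pos _ _ _ _).le (ah_nonneg b i hk.le le_rfl f z)),
            ← Finset.mul_sum, ah_sum hz.2.1 hk, ← ofReal_sq, ← ENNReal.ofReal_mul (pw_pos _ _ _ _).le, ← ENNReal.ofReal_mul pS,
            sub_eq_add_neg (-k), ← pw_mul, pw_neg_one lA, add_zero]
          congr 1; ring
      _ = _ := by
          have := mp (-k - 1)
          rw [lintegral_const_mul _ fP]; rfl

lemma geo_bound {x : ℂ} {v A : ℝ≥0∞} {θ : ℝ} {m : ℕ} (hv : v ≠ 0) (hv' : v ≠ ⊤) (hA : A ≠ ⊤) (hθ : 0 ≤ θ)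
    (h : ‖x‖ₑ ^ 2 * v ≤ A * oR θ ^ m) : ‖x‖ ≤ √((A / v).toReal) * √θ ^ m := by
  have h1 : ‖x‖ₑ ^ 2 ≤ A / v * oR θ ^ m := by
    rw [mul_comm, ← mul_div_assoc, ENNReal.le_div_iff_mul_le (Or.inl hv) (Or.inl hv')]
    rwa [mul_comm A] at h
  rw [← ENNReal.ofReal_toReal (ENNReal.div_ne_top hA hv), ← ENNReal.ofReal_pow hθ, ← ENNReal.ofReal_mul ENNReal.toReal_nonneg, ← ofReal_sq] at h1
  have h2 := (ENNReal.ofReal_le_ofReal_iff pS).1 h1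
  refine abs_le_of_sq_le_sq' ?_ pS |>.2
  rw [mul_pow, Real.sq_sqrt ENNReal.toReal_nonneg, ← pow_mul, mul_comm m 2, pow_mul, Real.sq_sqrt hθ]
  exact h2

lemma vol_ball {r : ℝ} (hr : 0 < r) (z : Cn n) : volume (ball z r) ≠ 0 ∧ volume (ball z r) ≠ ⊤ :=
  ⟨(measure_ball_pos _ _ hr).ne', measure_ball_lt_top.ne⟩

lemma exists_ball (hD : IsOpen D) {z : Cn n} (hz : z ∈ D) : ∃ r > 0, ball z (2 * r) ⊆ D := by
  obtain ⟨r, hr, h⟩ := Metric.isOpen_iff.1 hD z hz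
  exact ⟨r / 2, by positivity, by rwa [mul_div_cancel₀ r two_ne_zero]⟩

lemma hol_unif (hD : IsOpen D) {G : ℕ → Fc n} (hG : ∀ m, DifferentiableOn ℂ (G m) D) {A : ℝ≥0∞} (hA : A ≠ ⊤) {θ : ℝ}
    (hθ : 0 ≤ θ) (h : ∀ m, ∫⁻ z in D, ‖G m z‖ₑ ^ 2 ≤ A * oR θ ^ m) {z : Cn n} (hz : z ∈ D) :
    ∃ r > 0, ball z r ⊆ D ∧ ∃ B : ℝ, ∀ m, ∀ x ∈ ball z r, ‖G m x‖ ≤ B * √θ ^ m := by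
  obtain ⟨r, hr, hrD⟩ := exists_ball hD hz
  refine ⟨r, hr, (ball_subset_ball lA).trans hrD, √((A / volume (ball (0 : Cn n) r)).toReal), fun m x hx => ?_⟩
  refine geo_bound (vol_ball hr 0).1 (vol_ball hr 0).2 hA hθ ?_
  exact (bergman_unif hx ((hG m).mono hrD)).trans ((lintegral_mono_set hrD).trans (h m))

lemma sqrt_lt {θ : ℝ} (hθ : 0 ≤ θ) (hθ1 : θ < 1) : √θ < 1 := by
  rw [Real.sqrt_lt' one_pos]; simpa

lemma hol_series (hD : IsOpen D) {G : ℕ → Fc n} (hG : ∀ m, DifferentiableOn ℂ (G m) D) {A : ℝ≥0∞} (hA : A ≠ ⊤) {θ : ℝ}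
    (hθ : 0 ≤ θ) (hθ1 : θ < 1) (h : ∀ m, ∫⁻ z in D, ‖G m z‖ₑ ^ 2 ≤ A * oR θ ^ m) :
    DifferentiableOn ℂ (fun z => ∑' m, G m z) D ∧
    (∀ z ∈ D, Tendsto (fun M => ∑ m ∈ Finset.range M, G m z) atTop (𝓝 (∑' m, G m z))) ∧
    (∀ z ∈ D, Tendsto (fun m => G m z) atTop (𝓝 0)) ∧
    ∫⁻ z in D, ‖∑' m, G m z‖ₑ ^ 2 ≤ A * ((1 - oR √θ)⁻¹) ^ 2 := by
  have hs := summable_geometric_of_lt_one (Real.sqrt_nonneg θ) (sqrt_lt hθ hθ1)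
  have key : ∀ z ∈ D, ∃ r > 0, ball z r ⊆ D ∧ TendstoUniformlyOn (fun M x => ∑ m ∈ Finset.range M, G m x) (fun x => ∑' m, G m x) atTop (ball z r) := by
    intro z hz
    obtain ⟨r, hr, hrD, B, hB⟩ := hol_unif hD hG hA hθ h hz
    exact ⟨r, hr, hrD, tendstoUniformlyOn_tsum_nat (hs.mul_left B) hB⟩
  have h1 : DifferentiableOn ℂ (fun z => ∑' m, G m z) D := fun z hz => by
    obtain ⟨r, hr, hrD, ht⟩ := key z hz
    refine (hol_lim hr 0 (fun m _ => ?_) ht).differentiableWithinAt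
    exact DifferentiableOn.fun_sum fun m _ => (hG m).mono hrD
  have h2 : ∀ z ∈ D, Tendsto (fun M => ∑ m ∈ Finset.range M, G m z) atTop (𝓝 (∑' m, G m z)) := fun z hz => by
    obtain ⟨r, hr, hrD, ht⟩ := key z hz
    exact ht.tendsto_at (mem_ball_self hr)
  refine ⟨h1, h2, fun z hz => ?_, ?_⟩
  · obtain ⟨r, hr, hrD, B, hB⟩ := hol_unif hD hG hA hθ h hz
    refine squeeze_zero_norm (fun m => hB m z (mem_ball_self hr)) ?_
    simpa using (tendsto_pow_atTop_nhds_zero_of_lt_one (Real.sqrt_nonneg θ) (sqrt_lt hθ hθ1)).const_mul B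
  · set μ := (volume : Measure (Cn n)).restrict D
    have mG : ∀ m, AEStronglyMeasurable (G m) μ := fun m => (hG m).continuousOn.aestronglyMeasurable hD.measurableSet
    set a := A ^ (1/2 : ℝ) with ha
    have haa : a ^ 2 = A := by rw [ha, ← ENNReal.rpow_natCast, ← ENNReal.rpow_mul]; norm_num
    have hn : ∀ m, eLpNorm (G m) 2 μ ≤ a * oR √θ ^ m := fun m => by
      rw [← ENNReal.pow_le_pow_left_iff two_ne_zero, eLp2, mul_pow, haa, ← pow_mul, mul_comm m 2, pow_mul,
        ← ENNReal.ofReal_pow (Real.sqrt_nonneg _), Real.sq_sqrt hθ]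
      exact h m
    rw [← eLp2 (fun z => ∑' m, G m z), ← haa, ← mul_pow]
    refine pow_le_pow_left' ?_ 2
    refine (Lp.eLpNorm_lim_le_liminf_eLpNorm (f := fun M z => ∑ m ∈ Finset.range M, G m z) (fun M => by fun_prop) _ ?_).trans ?_
    · filter_upwards [ae_restrict_mem hD.measurableSet] with z hz using h2 z hz
    · refine liminf_le_of_le (by isBoundedDefault) fun c hc => ?_
      obtain ⟨M, hM⟩ := hc.exists
      refine hM.trans ?_
      have e1 : (fun z => ∑ m ∈ Finset.range M, G m z) = ∑ m ∈ Finset.range M, G m := by ext z; simp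
      rw [e1]
      refine (eLpNorm_sum_le (fun m _ => mG m) nN).trans ((Finset.sum_le_sum fun m _ => hn m).trans ?_)
      rw [← Finset.mul_sum, ← ENNReal.tsum_geometric]
      gcongr
      exact ENNReal.sum_le_tsum _

theorem thmS (hopen : IsOpen D) (hbd : Bornology.IsBounded D) (hpsc : IsPseudoconvex D) (hne : Dᶜ.Nonempty) (hn : 1 ≤ n) :
    ∃ C : ℝ≥0, ∀ b ∈ D, ∀ f : Fc n, DifferentiableOn ℂ f D → Measurable f → NN D b (n - 1/2) f < ⊤ →
      ∃ g : Fin n → Fc n, (∀ i, DifferentiableOn ℂ (g i) D ∧ ∫⁻ z in D, ‖g i z‖ₑ ^ 2 ≤ C * NN D b (n - 1/2) f) ∧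
        ∀ z ∈ D, f z = ∑ i, (z i - b i) * g i z := by
  obtain ⟨R, hR1, hR⟩ := nsq_bdd hbd
  set k : ℝ := n - 1/2 with hkd
  have hn' : (1:ℝ) ≤ n := by exact_mod_cast hn
  have hk : 0 < k := by rw [hkd]; linarith
  set θ : ℝ := (n - 1) / k with hθd
  have hθ : 0 ≤ θ := div_nonneg lA hk.le
  have hθ1 : θ < 1 := by rw [hθd, div_lt_one hk]; linarith
  set C1 : ℝ≥0∞ := oR (eX (k * lG R) * (2 * (1 + 1 / k))) with hC1
  set Q : ℝ≥0∞ := ((1 - oR √θ)⁻¹) ^ 2 with hQ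
  have hQt : Q ≠ ⊤ := by
    refine ENNReal.pow_ne_top (ENNReal.inv_ne_top.2 (tsub_pos_of_lt ?_).ne')
    rw [← ENNReal.ofReal_one]; exact (ENNReal.ofReal_lt_ofReal_iff one_pos).2 (sqrt_lt hθ hθ1)
  refine ⟨(C1 * Q).toNNReal, fun b hb f hf hfm hN => ?_⟩
  rw [ENNReal.coe_toNNReal (ENNReal.mul_ne_top ENNReal.ofReal_ne_top hQt)]
  let X := {f : Fc n // DifferentiableOn ℂ f D ∧ Measurable f ∧ NN D b k f < ⊤}
  choose G hG1 hG2 hG3 using fun x : X => step hopen hbd hpsc hne hn hk hR1 hR hb x.2.1 x.2.2.1 x.2.2.2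
  let nxt : X → X := fun x => ⟨fun z => x.1 z - ∑ i, (z i - b i) * G x i z,
    x.2.1.sub (DifferentiableOn.fun_sum fun i _ => DifferentiableOn.mul fP (hG1 x i).1),
    x.2.2.1.sub (Finset.measurable_fun_sum _ fun i _ => Measurable.mul fP (hG1 x i).2),
    (hG3 x).trans_lt (ENNReal.mul_lt_top ENNReal.ofReal_lt_top x.2.2.2)⟩
  let F : ℕ → X := fun m => nxt^[m] ⟨f, hf, hfm, hN⟩
  have hFs : ∀ m, F (m + 1) = nxt (F m) := fun m => Function.iterate_succ_apply' _ _ _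
  have hFN : ∀ m, NN D b k (F m).1 ≤ NN D b k f * oR θ ^ m := by
    intro m
    induction m with
    | zero => simp [F]
    | succ m ih =>
      rw [hFs]
      refine (hG3 (F m)).trans ?_
      calc _ ≤ oR θ * (NN D b k f * oR θ ^ m) := by gcongr
        _ = _ := by ring
  have hFt : ∀ m z, (F m).1 z = f z - ∑ i, (z i - b i) * ∑ l ∈ Finset.range m, G (F l) i z := by
    intro m z
    induction m with
    | zero => simp [F]
    | succ m ih =>
      rw [hFs]
      change (F m).1 z - ∑ i, (z i - b i) * G (F m) i z = _
      rw [ih]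
      simp only [Finset.sum_range_succ, mul_add, Finset.sum_add_distrib]; ring
  have hGL : ∀ i m, ∫⁻ z in D, ‖G (F m) i z‖ₑ ^ 2 ≤ C1 * NN D b k f * oR θ ^ m := fun i m => by
    refine (hG2 (F m) i).trans ?_
    rw [mul_assoc]
    gcongr
    exact hFN m
  have hs := fun i => hol_series hopen (fun m => (hG1 (F m) i).1) (ENNReal.mul_ne_top ENNReal.ofReal_ne_top hN.ne) hθ hθ1 (hGL i)
  have hF0 := hol_series hopen (fun m => (F m).2.1) (A := oR (eX ((k + 1) * lG R)) * NN D b k f)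
    (ENNReal.mul_ne_top ENNReal.ofReal_ne_top hN.ne) hθ hθ1 (fun m => by
      refine (NN_L2 hopen (F m).2.2.1 hk.le hR1 fun z hz => hR z hz b hb).trans ?_
      rw [mul_assoc]
      gcongr
      exact hFN m)
  refine ⟨fun i z => ∑' m, G (F m) i z, fun i => ⟨(hs i).1, ?_⟩, fun z hz => ?_⟩
  · refine (hs i).2.2.2.trans (le_of_eq ?_); ring
  · have h1 := hF0.2.2.1 z hz
    have h2 : Tendsto (fun m => (F m).1 z) atTop (𝓝 (f z - ∑ i, (z i - b i) * ∑' m, G (F m) i z)) := by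
      simp only [hFt]
      exact tendsto_const_nhds.sub (tendsto_finsetSum _ fun i _ => ((hs i).2.1 z hz).const_mul _)
    exact sub_eq_zero.1 (tendsto_nhds_unique h2 h1)

lemma norm_sq_le_nsq (b z : Cn n) : ‖z - b‖ ^ 2 ≤ nsq b z := by
  have : ‖z - b‖ ≤ √(nsq b z) := (pi_norm_le_iff_of_nonneg (Real.sqrt_nonneg _)).2 fun i =>
    Real.le_sqrt_of_sq_le (ci_le b z i)
  calc _ ≤ √(nsq b z) ^ 2 := by gcongr
    _ = _ := Real.sq_sqrt (nsq_nonneg b z)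

lemma pw_le_norm {b z : Cn n} (h : z ≠ b) : pw b (-(n - 1/2 : ℝ) - 1) 0 z ≤ (‖z - b‖ ^ (2 * n + 1))⁻¹ := by
  have h0 : 0 < ‖z - b‖ := norm_pos_iff.2 (sub_ne_zero.2 h)
  have h1 := norm_sq_le_nsq b z
  have h2 : (‖z - b‖ ^ (2 * n + 1))⁻¹ = eX ((-(n - 1/2 : ℝ) - 1) * lG (‖z - b‖ ^ 2)) := by
    rw [← Real.exp_log h0, ← Real.exp_nat_mul, ← Real.exp_neg, Real.exp_log h0, Real.log_pow]
    congr 1; push_cast; ring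
  rw [h2, pw, add_zero]
  refine Real.exp_le_exp.2 (mul_le_mul_of_nonpos_left (Real.log_le_log pS h1) ?_)
  have : (0:ℝ) ≤ n := by positivity
  linarith

noncomputable def JJ (n : ℕ) (r : ℝ) : ℝ≥0∞ := ∫⁻ z in ball (0 : Cn n) r, oR ((‖z‖ ^ (2 * n - 1))⁻¹)

lemma NN_bound (hn : 1 ≤ n) {b : Cn n} {r M : ℝ} (hr : 0 < r) (hM : 0 ≤ M)
    (h : ∀ z ∈ D, z ∈ ball b r → ‖f z‖ ≤ M * ‖z - b‖) (hD : IsOpen D) :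
    NN D b (n - 1/2) f ≤ oR (M ^ 2) * JJ n r + oR ((r ^ (2 * n + 1))⁻¹) * ∫⁻ z in D, ‖f z‖ₑ ^ 2 := by
  set w : Cn n → ℝ≥0∞ := (ball (0 : Cn n) r).indicator fun z => oR ((‖z‖ ^ (2 * n - 1))⁻¹) with hw
  have hwm : Measurable w := (by fun_prop : Measurable fun z : Cn n => oR ((‖z‖ ^ (2 * n - 1))⁻¹)).indicator measurableSet_ball
  have hJ : ∫⁻ z, w (z - b) = JJ n r := by
    rw [lintegral_sub_right_eq_self w b, hw, lintegral_indicator measurableSet_ball]; rfl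
  have key : NN D b (n - 1/2) f ≤ ∫⁻ z in D, (oR (M ^ 2) * w (z - b) + oR ((r ^ (2 * n + 1))⁻¹) * ‖f z‖ₑ ^ 2) := by
    refine lintegral_mono_ae ?_
    filter_upwards [ae_restrict_mem hD.measurableSet, ae_restrict_of_ae (ae_ne ⟨0, hn⟩ b)] with z hz hzb
    have h0 : 0 < ‖z - b‖ := norm_pos_iff.2 (sub_ne_zero.2 hzb)
    have hp := pw_le_norm hzb
    by_cases hzr : z ∈ ball b r
    · have h1 : w (z - b) = oR ((‖z - b‖ ^ (2 * n - 1))⁻¹) := by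
        rw [hw, indicator_of_mem]; simpa [dist_eq_norm] using hzr
      refine le_trans ?_ le_self_add
      rw [h1, ← ofReal_sq, ← ENNReal.ofReal_mul (pw_pos _ _ _ _).le, ← ENNReal.ofReal_mul pS]
      refine ENNReal.ofReal_le_ofReal ?_
      calc _ ≤ (‖z - b‖ ^ (2 * n + 1))⁻¹ * (M * ‖z - b‖) ^ 2 := by
            gcongr; exact h z hz hzr
        _ = _ := by
          have : 2 * n + 1 = 2 * n - 1 + 2 := by omega
          rw [this, pow_add]; field_simp
    · refine le_trans ?_ le_add_self
      gcongr
      refine hp.trans ?_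
      have : r ≤ ‖z - b‖ := by simpa [dist_eq_norm] using hzr
      gcongr
  refine key.trans ?_
  have hwm2 : Measurable fun z => oR (M ^ 2) * w (z - b) := (hwm.comp (measurable_id.sub_const b)).const_mul _
  rw [lintegral_add_left hwm2, lintegral_const_mul' _ _ ENNReal.ofReal_ne_top, lintegral_const_mul' _ _ ENNReal.ofReal_ne_top, ← hJ]
  gcongr
  exact Measure.restrict_le_self

lemma JJ_fin (hn : 1 ≤ n) : JJ n 1 ≠ ⊤ := by
  have : Nonempty (Fin n) := ⟨⟨0, hn⟩⟩
  have hfr : Module.finrank ℝ (Cn n) = 2 * n := by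
    rw [Module.finrank_pi_fintype]; simp [Complex.finrank_real_complex]; ring
  have h := (MeasureTheory.integrableOn_fun_norm_addHaar (volume : Measure (Cn n)) (f := fun y : ℝ => (y ^ (2 * n - 1))⁻¹) (r := 1)).2 (by
    rw [hfr]
    refine (integrableOn_congr_fun (g := fun _ => (1:ℝ)) (fun y hy => ?_) measurableSet_Ioo).2 ?_
    · have : y ^ (2 * n - 1) ≠ 0 := pow_ne_zero _ hy.1.ne'
      simp [this]
    · exact integrableOn_const sM )
  have h2 := h.2
  rw [hasFiniteIntegral_iff_norm] at h2
  refine (lt_of_le_of_lt (lintegral_mono fun z => ?_) h2).ne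
  exact ENNReal.ofReal_le_ofReal (Real.le_norm_self _)

lemma JJ_mono {r s : ℝ} (h : r ≤ s) : JJ n r ≤ JJ n s := lintegral_mono_set (ball_subset_ball h)

lemma JJ_small (hn : 1 ≤ n) {e : ℝ≥0∞} (he : 0 < e) {R : ℝ} (hR : 0 < R) : ∃ r, 0 < r ∧ r ≤ R ∧ JJ n r ≤ e := by
  obtain ⟨d, hd, h⟩ := exists_pos_setLIntegral_lt_of_measure_lt (μ := volume.restrict (ball (0 : Cn n) 1)) (f := fun z => oR ((‖z‖ ^ (2 * n - 1))⁻¹)) (JJ_fin hn) he.ne'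
  have hfr : Module.finrank ℝ (Cn n) = 2 * n := by
    rw [Module.finrank_pi_fintype]; simp [Complex.finrank_real_complex]; ring
  have ht : Tendsto (fun r : ℝ => volume (ball (0 : Cn n) r)) (𝓝[>] 0) (𝓝 0) := by
    have : Tendsto (fun r : ℝ => oR (r ^ (2 * n)) * volume (ball (0 : Cn n) 1)) (𝓝[>] 0) (𝓝 0) := by
      have h1 : Tendsto (fun r : ℝ => oR (r ^ (2 * n))) (𝓝[>] 0) (𝓝 0) := by
        have : Continuous fun r : ℝ => oR (r ^ (2 * n)) := ENNReal.continuous_ofReal.comp fP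
        have h3 := this.tendsto 0
        rw [zero_pow (by omega), ENNReal.ofReal_zero] at h3
        exact h3.mono_left nhdsWithin_le_nhds
      have := ENNReal.Tendsto.mul_const h1 (b := volume (ball (0 : Cn n) 1)) (Or.inr (vol_ball one_pos 0).2)
      simpa using this
    refine this.congr' ?_
    filter_upwards [self_mem_nhdsWithin] with r hr
    rw [Measure.addHaar_ball_of_pos _ _ hr, hfr]
  obtain ⟨r, hr1, hr2, hr3⟩ := ((ht.eventually_lt_const hd).and ((Ioc_mem_nhdsGT (lt_min hR one_pos)))).exists
  refine ⟨r, hr2, hr3.trans (min_le_left _ _), ?_⟩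
  have := h (ball 0 r) (lt_of_le_of_lt (Measure.restrict_le_self _) hr1)
  rw [Measure.restrict_restrict measurableSet_ball, inter_eq_left.2 (ball_subset_ball (hr3.trans (min_le_right _ _)))] at this
  exact this.le

noncomputable def N2 (D : Set (Cn n)) (f : Fc n) : ℝ≥0∞ := ∫⁻ z in D, ‖f z‖ₑ ^ 2

lemma esq_sub (a c : ℂ) : ‖a - c‖ₑ ^ 2 ≤ 2 * ‖a‖ₑ ^ 2 + 2 * ‖c‖ₑ ^ 2 := by
  have h2 : (2 : ℝ≥0∞) = oR 2 := by simp
  rw [← ofReal_sq, ← ofReal_sq, ← ofReal_sq, h2, ← ENNReal.ofReal_mul nN, ← ENNReal.ofReal_mul nN, ← ENNReal.ofReal_add pS pS]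
  refine ENNReal.ofReal_le_ofReal ?_
  have := norm_sub_le a c
  have h0 := norm_nonneg (a - c)
  nlinarith [sq_nonneg (‖a‖ - ‖c‖)]

lemma N2_shift (f : Fc n) (c : ℂ) : N2 D (fun z => f z - c) ≤ 2 * N2 D f + 2 * ‖c‖ₑ ^ 2 * volume D := by
  calc _ ≤ ∫⁻ z in D, (2 * ‖f z‖ₑ ^ 2 + 2 * ‖c‖ₑ ^ 2) := lintegral_mono fun z => esq_sub _ _
    _ = _ := by rw [lintegral_add_right _ measurable_const, lintegral_const_mul' _ _ sM, lintegral_const]; simp [N2]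

lemma N2_congr (hD : IsOpen D) {f g : Fc n} (h : EqOn f g D) : N2 D f = N2 D g :=
  setLIntegral_congr_fun hD.measurableSet fun z hz => by simp only [h hz]

lemma sum_sq_bound {b z : Cn n} {g : Fin n → Fc n} {Y : ℝ≥0∞} (h : ∀ i, ‖g i z‖ₑ ^ 2 ≤ Y) (hY : Y ≠ ⊤) :
    ‖∑ i, (z i - b i) * g i z‖ ≤ (n * √Y.toReal) * ‖z - b‖ := by
  have h1 : ∀ i, ‖g i z‖ ≤ √Y.toReal := fun i => by
    refine Real.le_sqrt_of_sq_le ?_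
    have := h i
    rw [← ofReal_sq] at this
    exact (ENNReal.ofReal_le_iff_le_toReal hY).1 this
  calc _ ≤ ∑ i : Fin n, ‖z - b‖ * √Y.toReal := by
        refine (norm_sum_le _ _).trans (Finset.sum_le_sum fun i _ => ?_)
        rw [norm_mul]
        gcongr
        · exact norm_le_pi_norm (z - b) i
        · exact h1 i
    _ = _ := by simp; ring

lemma div_qual (hopen : IsOpen D) (hbd : Bornology.IsBounded D) (hpsc : IsPseudoconvex D) (hne : Dᶜ.Nonempty) (hn : 1 ≤ n)
    {f : Fc n} (hf : f ∈ L2h D) {b : Cn n} (hb : b ∈ D) :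
    ∃ g : Fin n → Fc n, (∀ i, g i ∈ L2h D) ∧ ∀ z ∈ D, f z = f b + ∑ i, (z i - b i) * g i z := by
  obtain ⟨C, hC⟩ := thmS hopen hbd hpsc hne hn
  set h0 : Fc n := fun z => f z - f b with hh0
  have hd0 : DifferentiableOn ℂ h0 D := hf.1.sub_const _
  set h : Fc n := D.indicator h0 with hh
  have heq : EqOn h h0 D := fun z hz => indicator_of_mem hz _
  have hd : DifferentiableOn ℂ h D := hd0.congr heq
  have hN : N2 D h < ⊤ := by
    rw [N2_congr hopen heq]
    refine (N2_shift f (f b)).trans_lt (ENNReal.add_lt_top.2 ⟨ENNReal.mul_lt_top sM hf.2, ENNReal.mul_lt_top (ENNReal.mul_lt_top sM sM) hbd.measure_lt_top⟩)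
  have hO := ((hd0.differentiableAt (hopen.mem_nhds hb)).isBigO_sub)
  obtain ⟨M, hM0, hM⟩ := hO.exists_pos
  obtain ⟨r, hr, hr2⟩ := Metric.eventually_nhds_iff_ball.1 hM.bound
  have hNN := NN_bound (f := h) (D := D) hn (lt_min hr one_pos) hM0.le (fun z hz hzr => by
    have := hr2 z (ball_subset_ball (min_le_left _ _) hzr)
    rw [heq hz]; simpa [hh0] using this) hopen
  have hNt : NN D b (n - 1/2) h < ⊤ := by
    refine hNN.trans_lt (ENNReal.add_lt_top.2 ⟨ENNReal.mul_lt_top sM ?_, ENNReal.mul_lt_top sM hN⟩)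
    exact (JJ_mono (min_le_right _ _)).trans_lt (JJ_fin hn).lt_top
  obtain ⟨g, hg, hg2⟩ := hC b hb h hd (hol_meas hopen hd0) hNt
  refine ⟨g, fun i => ⟨(hg i).1, (hg i).2.trans_lt (ENNReal.mul_lt_top sM hNt)⟩, fun z hz => ?_⟩
  rw [← hg2 z hz, heq hz]; simp [hh0]

lemma div_quant (hopen : IsOpen D) (hbd : Bornology.IsBounded D) (hpsc : IsPseudoconvex D) (hne : Dᶜ.Nonempty) (hn : 1 ≤ n)
    {w : Cn n} {r0 : ℝ} (hr0 : 0 < r0) {C : ℝ≥0} (hK : ∀ f ∈ L2h D, ∀ z ∈ D, z ∈ ball w (2 * r0) → ‖f z‖ₑ ^ 2 ≤ C * N2 D f) :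
    ∃ A : ℝ≥0, ∀ a ∈ D, a ∈ ball w r0 → ∀ f ∈ L2h D, ∃ g : Fin n → Fc n,
      (∀ i, g i ∈ L2h D ∧ N2 D (g i) ≤ A * N2 D f) ∧ ∀ z ∈ D, f z = f a + ∑ i, (z i - a i) * g i z := by
  obtain ⟨C', hC⟩ := thmS hopen hbd hpsc hne hn
  set K : ℝ≥0 := n ^ 2 * C * C' with hKd
  obtain ⟨r, hr, hrr, hJ⟩ := JJ_small hn (e := ((2 * K + 1)⁻¹ : ℝ≥0∞)) (ENNReal.inv_pos.2 (by finiteness)) hr0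
  have hJt : JJ n r ≠ ⊤ := (hJ.trans_lt (ENNReal.inv_lt_top.2 pS)).ne
  have hKJ : (K : ℝ) * (JJ n r).toReal ≤ 1 / 2 := by
    have h1 := ENNReal.toReal_mono (ENNReal.inv_ne_top.2 pS) hJ
    have h2 : ((2 * K + 1)⁻¹ : ℝ≥0∞).toReal = (2 * K + 1 : ℝ)⁻¹ := by
      rw [ENNReal.toReal_inv, ENNReal.toReal_add (by finiteness) (by finiteness)]; simp
    rw [h2] at h1
    calc (K : ℝ) * (JJ n r).toReal ≤ K * (2 * K + 1 : ℝ)⁻¹ := by gcongr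
      _ ≤ 1 / 2 := by
        have : (0:ℝ) ≤ K := K.2
        rw [← div_eq_mul_inv, div_le_iff₀ pS]; linarith
  set J : ℝ := (JJ n r).toReal with hJd
  set c : ℝ := (r ^ (2 * n + 1))⁻¹ with hc
  have hc0 : 0 < c := by positivity
  set V : ℝ≥0 := (volume D).toNNReal with hV
  have hVD : volume D = V := (ENNReal.coe_toNNReal hbd.measure_lt_top.ne).symm
  refine ⟨(C' * (Real.toNNReal (2 * K * c * J + c))) * (2 + 2 * C * V), fun a ha haw f hf => ?_⟩
  obtain ⟨g0, hg0, hg0'⟩ := div_qual hopen hbd hpsc hne hn hf ha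
  set h0 : Fc n := fun z => f z - f a with hh0
  have hd0 : DifferentiableOn ℂ h0 D := hf.1.sub_const _
  set h : Fc n := D.indicator h0 with hh
  have heq : EqOn h h0 D := fun z hz => indicator_of_mem hz _
  have hd : DifferentiableOn ℂ h D := hd0.congr heq
  have hN : N2 D h ≤ (2 + 2 * C * V) * N2 D f := by
    rw [N2_congr hopen heq]
    refine (N2_shift f (f a)).trans ?_
    have h1 := hK f hf a ha (ball_subset_ball lA haw)
    calc _ ≤ 2 * N2 D f + 2 * (C * N2 D f) * V := by rw [hVD]; gcongr
      _ = _ := by ring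
  have hNt : N2 D h ≠ ⊤ := (hN.trans_lt (ENNReal.mul_lt_top (by finiteness) hf.2)).ne
  set b : ℝ := (N2 D h).toReal with hb
  have hbh : N2 D h = oR b := (ENNReal.ofReal_toReal hNt).symm
  have hbs : ball a r ⊆ ball w (2 * r0) := ball_subset_ball' (by rw [mem_ball] at haw; linarith)
  set S : Set ℝ := {M | 0 ≤ M ∧ ∀ z ∈ D, z ∈ ball a r → ‖h z‖ ≤ M * ‖z - a‖} with hS
  have imp : ∀ M ∈ S, ∃ g : Fin n → Fc n, (∀ i, DifferentiableOn ℂ (g i) D ∧ N2 D (g i) ≤ C' * oR (M ^ 2 * J + c * b)) ∧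
      ∀ z ∈ D, h z = ∑ i, (z i - a i) * g i z := by
    intro M hM
    have hNN := NN_bound (f := h) (D := D) hn hr hM.1 hM.2 hopen
    have e1 : oR (M ^ 2) * JJ n r + oR ((r ^ (2 * n + 1))⁻¹) * ∫⁻ z in D, ‖h z‖ₑ ^ 2 = oR (M ^ 2 * J + c * b) := by
      change _ + _ * N2 D h = _
      rw [hbh, ENNReal.ofReal_add pS pS, ENNReal.ofReal_mul pS, ENNReal.ofReal_mul hc0.le, hJd, ENNReal.ofReal_toReal hJt]
    rw [e1] at hNN
    obtain ⟨g, hg, hg2⟩ := hC a ha h hd (hol_meas hopen hd0) (hNN.trans_lt ENNReal.ofReal_lt_top)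
    exact ⟨g, fun i => ⟨(hg i).1, (hg i).2.trans (by gcongr)⟩, hg2⟩
  have imp2 : ∀ M ∈ S, √(M ^ 2 / 2 + K * c * b) ∈ S := by
    intro M hM
    obtain ⟨g, hg, hg2⟩ := imp M hM
    refine ⟨Real.sqrt_nonneg _, fun z hz hzr => ?_⟩
    rw [hg2 z hz]
    refine (sum_sq_bound (Y := C * (C' * oR (M ^ 2 * J + c * b))) (fun i => ?_) (by finiteness)).trans ?_
    · refine (hK (g i) ⟨(hg i).1, (hg i).2.trans_lt (by finiteness)⟩ z hz (hbs hzr)).trans ?_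
      gcongr
      exact (hg i).2
    · refine mul_le_mul_of_nonneg_right (Real.le_sqrt_of_sq_le ?_) (norm_nonneg _)
      have hnn : 0 ≤ M ^ 2 * J + c * b := by positivity
      rw [mul_pow, Real.sq_sqrt ENNReal.toReal_nonneg]
      simp only [ENNReal.toReal_mul, ENNReal.coe_toReal, ENNReal.toReal_ofReal hnn]
      have e2 : (n : ℝ) ^ 2 * (C * (C' * (M ^ 2 * J + c * b))) = M ^ 2 * (K * J) + K * c * b := by
        rw [hKd]; push_cast; ring
      rw [e2]
      nlinarith [sq_nonneg M]
  have hSc : IsClosed S := by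
    have : S = Ici 0 ∩ ⋂ z ∈ D ∩ ball a r, {M : ℝ | ‖h z‖ ≤ M * ‖z - a‖} := by
      ext M; simp [hS]
    rw [this]
    exact isClosed_Ici.inter (isClosed_biInter fun z _ => isClosed_le fP fP)
  have hSn : S.Nonempty := by
    have hY : C * ∑ j, N2 D (g0 j) ≠ ⊤ := ENNReal.mul_ne_top sM (ENNReal.sum_lt_top.2 fun j _ => (hg0 j).2).ne
    refine ⟨n * √(C * ∑ j, N2 D (g0 j)).toReal, by positivity, fun z hz hzr => ?_⟩
    have e3 : h z = ∑ i, (z i - a i) * g0 i z := by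
      rw [heq hz, hh0]; beta_reduce; rw [hg0' z hz]; ring
    rw [e3]
    refine sum_sq_bound (fun i => (hK (g0 i) (hg0 i) z hz (hbs hzr)).trans ?_) hY
    gcongr
    exact Finset.single_le_sum (f := fun j => N2 D (g0 j)) (fun _ _ => zero_le) (Finset.mem_univ i)
  have hSb : BddBelow S := ⟨0, fun M hM => hM.1⟩
  have hM0 := hSc.csInf_mem hSn hSb
  set M0 := sInf S
  have hMM : M0 ≤ √(M0 ^ 2 / 2 + K * c * b) := csInf_le hSb (imp2 M0 hM0)
  have hM2 : M0 ^ 2 ≤ 2 * (K * c * b) := by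
    have := (Real.le_sqrt hM0.1 pS).1 hMM
    linarith
  obtain ⟨g, hg, hg2⟩ := imp M0 hM0
  have hfin : ∀ i, N2 D (g i) ≤ ((C' * (Real.toNNReal (2 * K * c * J + c))) * (2 + 2 * C * V) : ℝ≥0) * N2 D f := fun i => by
    refine (hg i).2.trans ?_
    have e4 : M0 ^ 2 * J + c * b ≤ (2 * K * c * J + c) * b := by
      have : 0 ≤ J := ENNReal.toReal_nonneg
      nlinarith
    calc _ ≤ (C' : ℝ≥0∞) * oR ((2 * K * c * J + c) * b) := by gcongr
      _ = C' * Real.toNNReal (2 * K * c * J + c) * N2 D h := by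
        rw [ENNReal.ofReal_mul pS, ← hbh]; exact (mul_assoc _ _ _).symm
      _ ≤ C' * Real.toNNReal (2 * K * c * J + c) * ((2 + 2 * C * V) * N2 D f) := by gcongr
      _ = _ := by push_cast; ring
  refine ⟨g, fun i => ⟨⟨(hg i).1, (hfin i).trans_lt (ENNReal.mul_lt_top ENNReal.coe_lt_top hf.2)⟩, hfin i⟩, fun z hz => ?_⟩
  rw [← hg2 z hz, heq hz]; simp [hh0]

noncomputable def PP {X : Type} (G : X → Fin n → X) (a : Cn n) (e : X → Fc n) : ℕ → X → Fc n
  | 0, f, z => e f z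
  | m + 1, f, z => ∑ i, (z i - a i) * PP G a e m (G f i) z

lemma PP_bound {X : Type} {G : X → Fin n → X} {a z : Cn n} {e : X → Fc n} {q : X → ℝ} {B s : ℝ} (hB : 0 ≤ B) (hs : 0 ≤ s)
    (hG : ∀ f i, q (G f i) ≤ s * q f) (he : ∀ f, ‖e f z‖ ≤ B * q f) (m : ℕ) (f : X) :
    ‖PP G a e m f z‖ ≤ B * (n * ‖z - a‖ * s) ^ m * q f := by
  induction m generalizing f with
  | zero => simpa [PP] using he f
  | succ m ih =>
    rw [PP]
    calc _ ≤ ∑ i : Fin n, ‖z - a‖ * (B * (n * ‖z - a‖ * s) ^ m * (s * q f)) := by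
          refine (norm_sum_le _ _).trans (Finset.sum_le_sum fun i _ => ?_)
          rw [norm_mul]
          refine mul_le_mul (norm_le_pi_norm (z - a) i) ((ih _).trans ?_) (norm_nonneg _) (norm_nonneg _)
          exact mul_le_mul_of_nonneg_left (hG f i) pS
      _ = _ := by simp; ring

lemma PP_tel {X : Type} {G : X → Fin n → X} {a z : Cn n} {e : X → Fc n}
    (h : ∀ f, e f z = e f a + ∑ i, (z i - a i) * e (G f i) z) (m : ℕ) (f : X) :
    PP G a e m f z = PP G a (fun f _ => e f a) m f z + PP G a e (m + 1) f z := by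
  induction m generalizing f with
  | zero => exact h f
  | succ m ih =>
    rw [PP, PP, PP, ← Finset.sum_add_distrib]
    refine Finset.sum_congr rfl fun i _ => ?_
    rw [ih, mul_add]

lemma PP_diff {X : Type} {G : X → Fin n → X} {a : Cn n} {e : X → ℂ} (m : ℕ) (f : X) :
    Differentiable ℂ (PP G a (fun f _ => e f) m f) := by
  induction m generalizing f with
  | zero => exact differentiable_const _
  | succ m ih =>
    have : PP G a (fun f _ => e f) (m + 1) f = fun z => ∑ i, (z i - a i) * PP G a (fun f _ => e f) m (G f i) z := by
      ext z; rw [PP]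
    rw [this]
    exact Differentiable.fun_sum fun i _ => Differentiable.fun_mul fP (ih _)

lemma enorm_to_real {x : ℂ} {C : ℝ≥0} {y : ℝ≥0∞} (hy : y ≠ ⊤) (h : ‖x‖ₑ ^ 2 ≤ C * y) : ‖x‖ ≤ √C * √y.toReal := by
  rw [← Real.sqrt_mul (NNReal.coe_nonneg C)]
  refine Real.le_sqrt_of_sq_le ?_
  rw [← ofReal_sq] at h
  have := (ENNReal.ofReal_le_iff_le_toReal (by finiteness)).1 h
  simpa using this

lemma ext_ball {a w : Cn n} (ha : a ∈ D) {r0 : ℝ} (haw : a ∈ ball w r0) {C A : ℝ≥0}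
    (hK : ∀ f ∈ L2h D, ∀ z ∈ D, z ∈ ball w (2 * r0) → ‖f z‖ₑ ^ 2 ≤ C * N2 D f)
    (hA : ∀ f ∈ L2h D, ∃ g : Fin n → Fc n,
      (∀ i, g i ∈ L2h D ∧ N2 D (g i) ≤ A * N2 D f) ∧ ∀ z ∈ D, f z = f a + ∑ i, (z i - a i) * g i z)
    {ρ : ℝ} (hρ1 : ρ ≤ r0) (hρ2 : n * ρ * √A ≤ 1 / 2) (hf : f ∈ L2h D) :
    ∃ F : Fc n, DifferentiableOn ℂ F (ball a ρ) ∧ ∀ z ∈ D, z ∈ ball a ρ → F z = f z := by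
  have hbs : ball a ρ ⊆ ball w (2 * r0) := ball_subset_ball' (by rw [mem_ball] at haw; linarith)
  let X := {f : Fc n // f ∈ L2h D}
  choose G0 hG1 hG2 using fun x : X => hA x.1 x.2
  let G : X → Fin n → X := fun x i => ⟨G0 x i, (hG1 x i).1⟩
  let q : X → ℝ := fun x => √(N2 D x.1).toReal
  have hq0 : ∀ x, 0 ≤ q x := fun x => Real.sqrt_nonneg _
  have hGq : ∀ x i, q (G x i) ≤ √A * q x := fun x i => by
    change √(N2 D (G0 x i)).toReal ≤ √A * √(N2 D x.1).toReal
    rw [← Real.sqrt_mul (NNReal.coe_nonneg A)]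
    refine Real.sqrt_le_sqrt ?_
    have := ENNReal.toReal_mono (ENNReal.mul_ne_top sM x.2.2.ne) (hG1 x i).2
    rw [ENNReal.toReal_mul] at this
    exact this
  let e : X → Fc n := fun x z => x.1 z
  have he : ∀ z ∈ D, z ∈ ball w (2 * r0) → ∀ x : X, ‖e x z‖ ≤ √C * q x := fun z hz hzw x =>
    enorm_to_real x.2.2.ne (hK x.1 x.2 z hz hzw)
  have haw2 : a ∈ ball w (2 * r0) := ball_subset_ball (by have := dist_nonneg.trans_lt (mem_ball.1 haw); linarith) haw
  let x0 : X := ⟨f, hf⟩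
  have hhalf : ∀ z ∈ ball a ρ, ∀ m : ℕ, √C * (n * ‖z - a‖ * √A) ^ m * q x0 ≤ √C * q x0 * (1 / 2) ^ m := fun z hz m => by
    have h1 : n * ‖z - a‖ * √A ≤ 1 / 2 := by
      refine le_trans ?_ hρ2
      gcongr
      rw [mem_ball, dist_eq_norm] at hz; exact hz.le
    calc _ ≤ √C * (1 / 2) ^ m * q x0 := by
          have := hq0 x0
          gcongr
      _ = _ := by ring
  have hu : TendstoUniformlyOn (fun M z => ∑ m ∈ Finset.range M, PP G a (fun f _ => e f a) m x0 z) (fun z => ∑' m, PP G a (fun f _ => e f a) m x0 z) atTop (ball a ρ) := by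
    refine tendstoUniformlyOn_tsum_nat ((summable_geometric_of_lt_one nN (by norm_num : (1/2:ℝ) < 1)).mul_left (√C * q x0)) fun m z hz => ?_
    exact (PP_bound (z := z) (e := fun f _ => e f a) (q := q) (Real.sqrt_nonneg _) (Real.sqrt_nonneg _) hGq (he a ha haw2) m x0).trans (hhalf z hz m)
  refine ⟨fun z => ∑' m, PP G a (fun f _ => e f a) m x0 z, fun z hz => ?_, fun z hz hza => ?_⟩
  · obtain ⟨r, hr, hrs⟩ := Metric.isOpen_iff.1 isOpen_ball z hz
    refine (hol_lim hr 0 (fun m _ => ?_) (hu.mono hrs)).differentiableWithinAt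
    exact DifferentiableOn.fun_sum fun m _ => (PP_diff m x0).differentiableOn
  · have h1 := hu.tendsto_at hza
    have h2 : Tendsto (fun m => PP G a e m x0 z) atTop (𝓝 0) := by
      refine squeeze_zero_norm (fun m => (PP_bound (z := z) (e := e) (q := q) (Real.sqrt_nonneg _) (Real.sqrt_nonneg _) hGq (he z hz (hbs hza)) m x0).trans (hhalf z hza m)) ?_
      simpa using (tendsto_pow_atTop_nhds_zero_of_lt_one nN (by norm_num : (1/2:ℝ) < 1)).const_mul (√C * q x0)
    have h3 : ∀ M, ∑ m ∈ Finset.range M, PP G a (fun f _ => e f a) m x0 z = f z - PP G a e M x0 z := fun M => by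
      induction M with
      | zero => simp [PP, e, x0]
      | succ M ih => rw [Finset.sum_range_succ, ih, PP_tel (fun x => hG2 x z hz) M x0]; ring
    simp only [h3] at h1
    have h4 := h2.const_sub (f z)
    rw [sub_zero] at h4
    exact tendsto_nhds_unique h1 h4

lemma zero_of_N2 (hopen : IsOpen D) (hf : DifferentiableOn ℂ f D) (h : N2 D f = 0) {z : Cn n} (hz : z ∈ D) : f z = 0 := by
  obtain ⟨r, hr, hrD⟩ := exists_ball hopen hz
  have := (bergman_unif (mem_ball_self hr) (hf.mono hrD)).trans (lintegral_mono_set hrD)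
  rw [← N2, h] at this
  have h2 := le_zero_iff.1 this
  rcases mul_eq_zero.1 h2 with h3 | h3
  · simpa using h3
  · exact absurd h3 (vol_ball hr 0).1

lemma kernel_le {z : Cn n} (hopen : IsOpen D) (hz : z ∈ D) (hf : f ∈ L2h D) : ‖f z‖ₑ ^ 2 ≤ bergmanKernel D z * N2 D f := by
  by_cases h : ∃ w ∈ D, f w ≠ 0
  · have h1 : ‖f z‖ₑ ^ 2 / N2 D f ≤ bergmanKernel D z := by
      unfold bergmanKernel
      exact le_iSup_of_le f (le_iSup_of_le hf (le_iSup_of_le h le_rfl))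
    have h0 : N2 D f ≠ 0 := fun h0 => by
      obtain ⟨w, hw, hw2⟩ := h
      exact hw2 (zero_of_N2 hopen hf.1 h0 hw)
    exact (ENNReal.div_le_iff h0 hf.2.ne).1 h1
  · push Not at h
    rw [h z hz]; simp

lemma le_kernel {z : Cn n} {C : ℝ≥0∞} (h : ∀ f ∈ L2h D, ‖f z‖ₑ ^ 2 ≤ C * N2 D f) : bergmanKernel D z ≤ C :=
  iSup_le fun f => iSup_le fun hf => iSup_le fun _ => ENNReal.div_le_of_le_mul (h f hf)

theorem forward (hopen : IsOpen D) (hbd : Bornology.IsBounded D) (hpsc : IsPseudoconvex D) (hne : Dᶜ.Nonempty) (hn : 1 ≤ n)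
    (hL : IsL2hDomainOfHolomorphy D) {w : Cn n} (hw : w ∈ frontier D) : limsup (fun z => bergmanKernel D z) (𝓝[D] w) = (⊤ : ℝ≥0∞) := by
  by_contra hlim
  obtain ⟨C, hC1, hC2⟩ := ENNReal.lt_iff_exists_nnreal_btwn.1 (lt_top_iff_ne_top.2 hlim)
  have hev := eventually_lt_of_limsup_lt hC1
  rw [eventually_nhdsWithin_iff, Metric.eventually_nhds_iff_ball] at hev
  obtain ⟨R, hR, hRb⟩ := hev
  obtain ⟨r0, hr0, hr2⟩ : ∃ r0 > 0, 2 * r0 = R := ⟨R / 2, by positivity, by ring⟩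
  have hK : ∀ f ∈ L2h D, ∀ z ∈ D, z ∈ ball w (2 * r0) → ‖f z‖ₑ ^ 2 ≤ C * N2 D f := fun f hf z hz hzw => by
    refine (kernel_le hopen hz hf).trans ?_
    gcongr
    exact (hRb z (hr2 ▸ hzw) hz).le
  obtain ⟨A, hA⟩ := div_quant hopen hbd hpsc hne hn hr0 hK
  set ρ : ℝ := min r0 (1 / (2 * (n * √A + 1))) with hρ
  have hρ0 : 0 < ρ := lt_min hr0 pS
  have hρ2 : n * ρ * √A ≤ 1 / 2 := by
    calc n * ρ * √A = n * √A * ρ := by ring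
      _ ≤ n * √A * (1 / (2 * (n * √A + 1))) := by gcongr; exact min_le_right _ _
      _ ≤ 1 / 2 := by
        have : 0 ≤ n * √A := by positivity
        rw [mul_one_div, div_le_div_iff₀ pS pS]; linarith
  obtain ⟨a, ha, haw⟩ := Metric.mem_closure_iff.1 (frontier_subset_closure hw) ρ hρ0
  have haw' : a ∈ ball w r0 := by
    rw [mem_ball, dist_comm]; exact haw.trans_le (min_le_left _ _)
  obtain ⟨s, hs, hsD⟩ := Metric.isOpen_iff.1 (hopen.inter isOpen_ball) a ⟨ha, mem_ball_self hρ0⟩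
  refine hL ⟨ball a s, ball a ρ, isOpen_ball, (isConnected_ball hs), isOpen_ball, isConnected_ball hρ0, fun z hz => ⟨(hsD hz).2, (hsD hz).1⟩, fun h => ?_, fun f hf => ?_⟩
  · have h1 : w ∈ D := h (mem_ball.2 haw)
    rw [hopen.frontier_eq] at hw
    exact hw.2 h1
  · obtain ⟨F, hF, hF2⟩ := ext_ball ha haw' hK (hA a ha haw') (min_le_left _ _) hρ2 hf
    exact ⟨F, hF, fun z hz => hF2 z (hsD hz).1 (hsD hz).2⟩

lemma N2_smul (f : Fc n) (c : ℂ) : N2 D (fun z => c * f z) = ‖c‖ₑ ^ 2 * N2 D f := by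
  rw [N2, N2, ← lintegral_const_mul' _ _ sM]
  simp only [enorm_mul, mul_pow]

lemma nrmlz (hopen : IsOpen D) {b : Cn n} (hb : b ∈ D) (hf : f ∈ L2h D) {C : ℝ} (hC : 0 ≤ C)
    (h : ¬ ‖f b‖ₑ ^ 2 ≤ oR (C ^ 2) * N2 D f) : ∃ g ∈ L2h D, N2 D g ≤ 1 ∧ C < ‖g b‖ := by
  have h0 : N2 D f ≠ 0 := fun h0 => h (by rw [zero_of_N2 hopen hf.1 h0 hb]; simp)
  set t := √(N2 D f).toReal with ht
  have ht0 : 0 < t := Real.sqrt_pos.2 (ENNReal.toReal_pos h0 hf.2.ne)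
  have hNt : N2 D f = oR (t ^ 2) := by
    rw [ht, Real.sq_sqrt ENNReal.toReal_nonneg]; exact (ENNReal.ofReal_toReal hf.2.ne).symm
  have hN : N2 D (fun z => ((t⁻¹ : ℝ) : ℂ) * f z) = 1 := by
    rw [N2_smul, hNt, ← ofReal_sq, ← ENNReal.ofReal_mul pS, norm_real, Real.norm_eq_abs, sq_abs, ← ENNReal.ofReal_one]
    congr 1; field_simp
  refine ⟨fun z => ((t⁻¹ : ℝ) : ℂ) * f z, ⟨hf.1.const_mul _, ?_⟩, hN.le, ?_⟩
  · change N2 D _ < ⊤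
    rw [hN]; simp
  · rw [not_le, hNt, ← ofReal_sq, ← ENNReal.ofReal_mul pS, ENNReal.ofReal_lt_ofReal_iff_of_nonneg pS, ← mul_pow] at h
    have := lt_of_pow_lt_pow_left₀ 2 (norm_nonneg _) h
    rw [norm_mul, norm_real, Real.norm_of_nonneg pS, lt_inv_mul_iff₀ ht0]
    linarith

lemma unif_bdd (hopen : IsOpen D) {S : Set (Cn n)} (hS : S ⊆ D) (h : ∀ f ∈ L2h D, ∃ B : ℝ, ∀ b ∈ S, ‖f b‖ ≤ B) :
    ∃ C : ℝ≥0, ∀ f ∈ L2h D, ∀ b ∈ S, ‖f b‖ₑ ^ 2 ≤ C * N2 D f := by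
  by_contra hcon
  push Not at hcon
  have hm : ∀ m : ℕ, ∃ g ∈ L2h D, ∃ b ∈ S, N2 D g ≤ 1 ∧ (8:ℝ) ^ m < ‖g b‖ := fun m => by
    obtain ⟨f, hf, b, hb, hlt⟩ := hcon (Real.toNNReal (((8:ℝ) ^ m) ^ 2))
    obtain ⟨g, hg, hg1, hg2⟩ := nrmlz hopen (hS hb) hf (C := 8 ^ m) pS (not_le.2 hlt)
    exact ⟨g, hg, b, hb, hg1, hg2⟩
  choose g hg b hb hg1 hg2 using hm
  have hbound : ∀ z ∈ D, ∃ B : ℝ, ∀ m, ‖g m z‖ ≤ B := fun z hz => by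
    obtain ⟨r, hr, hrD⟩ := exists_ball hopen hz
    refine ⟨_, fun m => geo_bound (A := 1) (θ := 0) (m := 0) (vol_ball hr (0 : Cn n)).1 (vol_ball hr (0 : Cn n)).2 sM le_rfl ?_⟩
    rw [pow_zero, mul_one]
    exact ((bergman_unif (mem_ball_self hr) ((hg m).1.mono hrD)).trans (lintegral_mono_set hrD)).trans (hg1 m)
  choose! B hB using hbound
  let G : BoundedContinuousFunction ℕ ℂ → ℕ → Fc n := fun c m z => c m * (1/4 : ℂ) ^ m * g m z
  have hGb : ∀ c, ∀ z ∈ D, ∀ m, ‖G c m z‖ ≤ (‖c‖ * B z) * (1/4 : ℝ) ^ m := fun c z hz m => by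
    have e1 : ‖(1/4 : ℂ) ^ m‖ = (1/4 : ℝ) ^ m := by rw [norm_pow]; norm_num
    change ‖c m * (1/4 : ℂ) ^ m * g m z‖ ≤ _
    rw [norm_mul, norm_mul, e1]
    calc _ ≤ ‖c‖ * (1/4 : ℝ) ^ m * B z := by
          gcongr
          · exact c.norm_coe_le_norm m
          · exact hB z hz m
      _ = _ := by ring
  have hgs : Summable fun m : ℕ => (1/4 : ℝ) ^ m := summable_geometric_of_lt_one nN nN
  have hsum : ∀ c, ∀ z ∈ D, Summable fun m => G c m z := fun c z hz =>
    Summable.of_norm_bounded (hgs.mul_left _) (hGb c z hz)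
  have hL2 : ∀ c, (fun z => ∑' m, G c m z) ∈ L2h D := fun c => by
    have hs := hol_series hopen (G := G c) (fun m => (hg m).1.const_mul _) (A := oR (‖c‖ ^ 2)) sM (θ := 1/16) nN nN (fun m => by
      change N2 D (fun z => c m * (1/4 : ℂ) ^ m * g m z) ≤ _
      rw [N2_smul]
      calc _ ≤ oR (‖c‖ ^ 2) * oR (1/16) ^ m * 1 := by
            gcongr
            · rw [← ofReal_sq, ← ENNReal.ofReal_pow nN, ← ENNReal.ofReal_mul pS]
              refine ENNReal.ofReal_le_ofReal ?_
              rw [norm_mul, mul_pow, norm_pow, ← pow_mul, mul_comm m 2, pow_mul]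
              have : ‖(1/4 : ℂ)‖ ^ 2 = 1/16 := by norm_num
              rw [this]
              gcongr
              exact c.norm_coe_le_norm m
            · exact hg1 m
        _ = _ := mul_one _)
    refine ⟨hs.1, hs.2.2.2.trans_lt (ENNReal.mul_lt_top sM (ENNReal.pow_lt_top (ENNReal.inv_lt_top.2 (tsub_pos_of_lt ?_))))⟩
    rw [← ENNReal.ofReal_one]; exact (ENNReal.ofReal_lt_ofReal_iff one_pos).2 (sqrt_lt nN nN)
  let e : S → BoundedContinuousFunction ℕ ℂ →L[ℂ] ℂ := fun z => LinearMap.mkContinuous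
    { toFun := fun c => ∑' m, G c m z.1
      map_add' := fun c d => by
        rw [← (hsum c z (hS z.2)).tsum_add (hsum d z (hS z.2))]
        congr 1; ext m; simp only [G, BoundedContinuousFunction.coe_add, Pi.add_apply]; ring
      map_smul' := fun a c => by
        rw [RingHom.id_apply, smul_eq_mul, ← tsum_mul_left]
        congr 1; ext m; simp only [G, BoundedContinuousFunction.coe_smul, smul_eq_mul]; ring }
    (B z.1 * ∑' m : ℕ, (1/4 : ℝ) ^ m) (fun c => by
      refine (tsum_of_norm_bounded (hgs.mul_left (‖c‖ * B z.1)).hasSum (hGb c z (hS z.2))).trans (le_of_eq ?_)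
      rw [tsum_mul_left]; ring)
  have he : ∀ z c, e z c = ∑' m, G c m z.1 := fun z c => rfl
  obtain ⟨C, hC⟩ := banach_steinhaus (g := e) (fun c => by
    obtain ⟨M, hM⟩ := h _ (hL2 c)
    exact ⟨M, fun z => hM z.1 z.2⟩)
  have h2 : ∀ m : ℕ, (2:ℝ) ^ m ≤ C := fun m => by
    let d : BoundedContinuousFunction ℕ ℂ := BoundedContinuousFunction.ofNormedAddCommGroupDiscrete (Pi.single m 1) 1 (fun k => by
      by_cases hk : k = m
      · subst hk; simp
      · simp [Pi.single_eq_of_ne hk])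
    have hdn : ‖d‖ ≤ 1 := BoundedContinuousFunction.norm_ofNormedAddCommGroup_le _ zero_le_one _
    have hd : ∀ k, d k = (Pi.single m 1 : ℕ → ℂ) k := fun k => rfl
    have h3 : e ⟨b m, hb m⟩ d = (1/4 : ℂ) ^ m * g m (b m) := by
      rw [he, tsum_eq_single m (fun k hk => by simp [G, hd, Pi.single_eq_of_ne hk])]
      simp [G, hd]
    have h4 := (e ⟨b m, hb m⟩).le_opNorm d
    rw [h3, norm_mul, norm_pow] at h4
    have e4 : ‖(1/4 : ℂ)‖ = 1/4 := by norm_num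
    rw [e4] at h4
    have hC0 : 0 ≤ C := (norm_nonneg _).trans (hC ⟨b m, hb m⟩)
    calc (2:ℝ) ^ m = (1/4) ^ m * 8 ^ m := by rw [← mul_pow]; norm_num
      _ ≤ (1/4) ^ m * ‖g m (b m)‖ := by gcongr; exact (hg2 m).le
      _ ≤ _ := h4
      _ ≤ C * 1 := mul_le_mul (hC _) hdn (norm_nonneg _) hC0
      _ = C := mul_one C
  obtain ⟨m, hm⟩ := pow_unbounded_of_one_lt C one_lt_two
  exact absurd (h2 m) (not_le.2 hm)

theorem backward (hopen : IsOpen D) (hbd : Bornology.IsBounded D) (hpsc : IsPseudoconvex D) (hne : Dᶜ.Nonempty) (hn : 1 ≤ n)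
    (hlim : ∀ w ∈ frontier D, limsup (fun z => bergmanKernel D z) (𝓝[D] w) = (⊤ : ℝ≥0∞)) : IsL2hDomainOfHolomorphy D := by
  rintro ⟨D0, D1, h0o, h0c, h1o, h1c, h01, hnot, hext⟩
  obtain ⟨p, hp⟩ := h0c.nonempty
  obtain ⟨y, hy1, hy2⟩ := not_subset.1 hnot
  obtain ⟨w, hw1, hw⟩ : ∃ w ∈ D1, w ∈ frontier D := by
    by_contra! hcon
    have hcl : ∀ z ∈ D1, z ∉ D → z ∉ closure D := fun z hz hzD hzc => hcon z hz (by rw [hopen.frontier_eq]; exact ⟨hzc, hzD⟩)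
    obtain ⟨z, -, hz1, hz2⟩ := h1c.isPreconnected D (closure D)ᶜ hopen isClosed_closure.isOpen_compl
      (fun z hz => (em (z ∈ D)).imp id (hcl z hz)) ⟨p, h01 hp⟩ ⟨y, hy1, hcl y hy1 hy2⟩
    exact hz2 (subset_closure hz1)
  choose! E hE1 hE2 using hext
  have hEf : ∀ f ∈ L2h D, ∀ b ∈ D, b ∈ D1 → E f b = f b := fun f hf b hb hb1 => by
    obtain ⟨g, hg, hg2⟩ := div_qual hopen hbd hpsc hne hn hf hb
    have := hol_id h1o h1c.isPreconnected (f := fun z => E f z - (f b + ∑ i, (z i - b i) * E (g i) z))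
      ((hE1 f hf).sub (DifferentiableOn.const_add _ (DifferentiableOn.fun_sum fun i _ => DifferentiableOn.fun_mul fP (hE1 (g i) (hg i)))))
      h0o h0c.nonempty (fun z hz => (h01 hz).1) (fun z hz => by
        beta_reduce
        rw [hE2 f hf hz, hg2 z (h01 hz).2, sub_eq_zero]
        congr 1
        exact Finset.sum_congr rfl fun i _ => by rw [hE2 (g i) (hg i) hz]) b hb1
    simpa [sub_eq_zero] using this
  obtain ⟨r, hr, hrD⟩ := Metric.isOpen_iff.1 h1o w hw1
  have hcb : closedBall w (r / 2) ⊆ D1 := (closedBall_subset_ball lA).trans hrD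
  obtain ⟨C, hC⟩ := unif_bdd hopen (S := D ∩ closedBall w (r / 2)) inter_subset_left (fun f hf => by
    obtain ⟨M, hM⟩ := (isCompact_closedBall w (r / 2)).exists_bound_of_continuousOn ((hE1 f hf).continuousOn.mono hcb)
    refine ⟨M, fun b hb => ?_⟩
    rw [← hEf f hf b hb.1 (hcb hb.2)]
    exact hM b hb.2)
  have hle : limsup (fun z => bergmanKernel D z) (𝓝[D] w) ≤ C := by
    refine limsup_le_of_le (by isBoundedDefault) ?_
    filter_upwards [self_mem_nhdsWithin, mem_nhdsWithin_of_mem_nhds (closedBall_mem_nhds w (half_pos hr))] with z hz hz2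
    exact le_kernel fun f hf => hC f hf z ⟨hz, hz2⟩
  rw [hlim w hw] at hle
  exact absurd hle sM
end

/-- **Theorem 1.** A bounded pseudoconvex domain `D ⊆ ℂⁿ` is an `L²ₕ`-domain of holomorphy
iff for every `w ∈ ∂D` one has `limsup_{D ∋ z → w} K_D(z) = ∞`. -/
theorem l2h_domain_iff_bergman_limsup_top {n : ℕ} (D : Set (Fin n → ℂ))
    (hopen : IsOpen D) (hconn : IsConnected D) (hbd : Bornology.IsBounded D)
    (hpsc : IsPseudoconvex D) :
    IsL2hDomainOfHolomorphy D ↔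
      ∀ w ∈ frontier D,
        Filter.limsup (fun z => bergmanKernel D z) (𝓝[D] w) = (⊤ : ℝ≥0∞) := by
  rcases Nat.eq_zero_or_pos n with rfl | hn
  · obtain ⟨p, hp⟩ := hconn.nonempty
    have hD : D = univ := eq_univ_of_forall fun z => Subsingleton.elim p z ▸ hp
    subst hD
    simp only [frontier_univ, mem_empty_iff_false, false_imp_iff, implies_true, iff_true]
    rintro ⟨D0, D1, -, -, -, -, -, h, -⟩
    exact h (subset_univ _)
  · have : Nonempty (Fin n) := ⟨⟨0, hn⟩⟩
    have hne : Dᶜ.Nonempty := by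
      rw [nonempty_compl]
      rintro rfl
      exact NormedSpace.unbounded_univ ℂ (Fin n → ℂ) hbd
    exact ⟨fun h w hw => forward hopen hbd hpsc hne hn h hw, backward hopen hbd hpsc hne hn⟩
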